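/- arXiv:1603.08447 — 5 statements merged into one kernel-verified Lean document; each statement's English description precedes it below -/
import Mathlib

section
/- For every t ∈ (0,1), the function t ↦ E[log Z_t] is differentiable and (d/dt) E[log Z_t] = E[ Σ_{1≤i≤j≤n} ⟨A_{ij}⟩_t + Σ_{i=1}^n ⟨B_i⟩_t ], where A_{ij}(x) = −x_i² x_j²/(2Δn) + x_i x_j x*_i x*_j/(Δn) + x_i x_j ξ_{ij}/(2√(nΔt)) and B_i(x) = m x_i²/(2Δ) − m x_i x*_i/Δ − (x_i z_i/2)·√(m/(Δ(1−t))). -/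
open MeasureTheory ProbabilityTheory Filter Real

noncomputable section

/-- Index set of pairs `1 ≤ i ≤ j ≤ n`. -/
abbrev SymIdx (n : ℕ) := {q : Fin n × Fin n // q.1 ≤ q.2}

/-- The interpolating Hamiltonian `H_t(x)` given the quenched variables
`x*` (the signal), `ξ` (matrix noise) and `z` (vector noise). -/
def Ham (Δ m : ℝ) (n : ℕ) (t : ℝ)
    (xs : Fin n → ℝ) (ξ : SymIdx n → ℝ) (z : Fin n → ℝ) (x : Fin n → ℝ) : ℝ :=
  (∑ q : SymIdx n,
      (-(t * x q.1.1 ^ 2 * x q.1.2 ^ 2) / (2 * Δ * n)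
        + t * x q.1.1 * x q.1.2 * xs q.1.1 * xs q.1.2 / (Δ * n)
        + Real.sqrt (t / (n * Δ)) * x q.1.1 * x q.1.2 * ξ q))
    - (1 - t) * m * (∑ i, x i ^ 2) / (2 * Δ)
    + (1 - t) * m * (∑ i, x i * xs i) / Δ
    + Real.sqrt (m * (1 - t) / Δ) * (∑ i, x i * z i)

/-- The interpolating partition function `Z_t`. -/
def Zt (p : Measure ℝ) (Δ m : ℝ) (n : ℕ) (t : ℝ)
    (xs : Fin n → ℝ) (ξ : SymIdx n → ℝ) (z : Fin n → ℝ) : ℝ :=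
  ∫ x, Real.exp (Ham Δ m n t xs ξ z x) ∂(Measure.pi fun _ : Fin n => p)

/-- The Gibbs expectation `⟨f⟩_t` under the interpolating Gibbs measure. -/
def gibbs (p : Measure ℝ) (Δ m : ℝ) (n : ℕ) (t : ℝ)
    (xs : Fin n → ℝ) (ξ : SymIdx n → ℝ) (z : Fin n → ℝ) (f : (Fin n → ℝ) → ℝ) : ℝ :=
  (∫ x, f x * Real.exp (Ham Δ m n t xs ξ z x) ∂(Measure.pi fun _ : Fin n => p))
    / Zt p Δ m n t xs ξ z

/-- The law of the quenched variables `(x*, ξ, z)` : coordinates of `x*` are i.i.d. `p`,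
and `ξ`, `z` are i.i.d. standard Gaussians, all independent. -/
def baseP (p : Measure ℝ) (n : ℕ) :
    Measure ((Fin n → ℝ) × (SymIdx n → ℝ) × (Fin n → ℝ)) :=
  (Measure.pi fun _ : Fin n => p).prod
    ((Measure.pi fun _ : SymIdx n => gaussianReal 0 1).prod
      (Measure.pi fun _ : Fin n => gaussianReal 0 1))

/-- The averaged log-partition function `t ↦ E[log Z_t]`. -/
def Favg (p : Measure ℝ) (Δ m : ℝ) (n : ℕ) (t : ℝ) : ℝ :=
  ∫ ω, Real.log (Zt p Δ m n t ω.1 ω.2.1 ω.2.2) ∂(baseP p n)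

/-- The integrand `A_{ij}(x)` appearing in the `t`-derivative of the Hamiltonian. -/
def Aterm (Δ : ℝ) (n : ℕ) (t : ℝ) (xs : Fin n → ℝ) (ξ : SymIdx n → ℝ)
    (q : SymIdx n) (x : Fin n → ℝ) : ℝ :=
  -(x q.1.1 ^ 2 * x q.1.2 ^ 2) / (2 * Δ * n)
    + x q.1.1 * x q.1.2 * xs q.1.1 * xs q.1.2 / (Δ * n)
    + x q.1.1 * x q.1.2 * ξ q / (2 * Real.sqrt (n * Δ * t))

/-- The integrand `B_i(x)` appearing in the `t`-derivative of the Hamiltonian. -/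
def Bterm (Δ m : ℝ) (n : ℕ) (t : ℝ) (xs : Fin n → ℝ) (z : Fin n → ℝ)
    (i : Fin n) (x : Fin n → ℝ) : ℝ :=
  m * x i ^ 2 / (2 * Δ) - m * x i * xs i / Δ
    - (x i * z i / 2) * Real.sqrt (m / (Δ * (1 - t)))

section FiniteSupport

variable {α : Type*} [MeasurableSpace α] [MeasurableSingletonClass α] {μ : Measure α}
  [IsFiniteMeasure μ] {s : Finset α}

/-- Every real function is integrable for a finite measure carried by a finite set. -/
lemma integrable_of_ae_mem_finset (hs : ∀ᵐ x ∂μ, x ∈ s) (f : α → ℝ) : Integrable f μ := by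
  have h : Integrable f (μ.restrict (s : Set α)) := IntegrableOn.finset
  rwa [Measure.restrict_eq_self_of_ae_mem (by simpa using hs)] at h

/-- The integral for a finite measure carried by a finite set is a finite sum. -/
lemma integral_eq_sum_of_ae_mem_finset (hs : ∀ᵐ x ∂μ, x ∈ s) (f : α → ℝ) :
    ∫ x, f x ∂μ = ∑ x ∈ s, μ.real {x} * f x := by
  have h : ∫ x in (s : Set α), f x ∂μ = ∑ x ∈ s, μ.real {x} • f x :=
    setIntegral_finset s IntegrableOn.finset
  rwa [Measure.restrict_eq_self_of_ae_mem (by simpa using hs)] at h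

end FiniteSupport

lemma ae_mem_piFinset {ι : Type*} [Fintype ι] [DecidableEq ι] {p : Measure ℝ}
    [IsProbabilityMeasure p] {s : Finset ℝ} (hs : p (↑s : Set ℝ)ᶜ = 0) :
    ∀ᵐ x ∂(Measure.pi fun _ : ι => p), x ∈ Fintype.piFinset fun _ => s := by
  simp only [Fintype.mem_piFinset]
  refine ae_all_iff.2 fun i => ?_
  have h : ∀ᵐ y ∂p, y ∈ s := hs
  exact Measure.tendsto_eval_ae_ae.eventually h

section LogSumExp

variable {ι : Type*} {S : Finset ι} {w : ι → ℝ}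

lemma sum_mul_exp_pos (hw : ∀ x ∈ S, 0 ≤ w x) (hw1 : ∑ x ∈ S, w x = 1) (h : ι → ℝ) :
    0 < ∑ x ∈ S, w x * exp (h x) := by
  obtain ⟨x, hx, hne⟩ := Finset.exists_ne_zero_of_sum_ne_zero (hw1.trans_ne one_ne_zero)
  exact Finset.sum_pos' (fun y hy => mul_nonneg (hw y hy) (exp_pos _).le)
    ⟨x, hx, mul_pos ((hw x hx).lt_of_ne' hne) (exp_pos _)⟩

lemma abs_log_sum_mul_exp_le (hw : ∀ x ∈ S, 0 ≤ w x) (hw1 : ∑ x ∈ S, w x = 1) {h : ι → ℝ}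
    {M : ℝ} (hM : ∀ x ∈ S, |h x| ≤ M) : |log (∑ x ∈ S, w x * exp (h x))| ≤ M := by
  have hpos := sum_mul_exp_pos hw hw1 h
  rw [abs_le, le_log_iff_exp_le hpos, log_le_iff_le_exp hpos]
  constructor
  · calc exp (-M) = ∑ x ∈ S, w x * exp (-M) := by rw [← Finset.sum_mul, hw1, one_mul]
      _ ≤ _ := Finset.sum_le_sum fun x hx => mul_le_mul_of_nonneg_left
        (exp_le_exp.2 (abs_le.1 (hM x hx)).1) (hw x hx)
  · calc ∑ x ∈ S, w x * exp (h x)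
      _ ≤ ∑ x ∈ S, w x * exp M := Finset.sum_le_sum fun x hx => mul_le_mul_of_nonneg_left
        (exp_le_exp.2 (abs_le.1 (hM x hx)).2) (hw x hx)
      _ = exp M := by rw [← Finset.sum_mul, hw1, one_mul]

lemma abs_sum_mul_exp_div_le (hw : ∀ x ∈ S, 0 ≤ w x) (hw1 : ∑ x ∈ S, w x = 1)
    {h g : ι → ℝ} {M : ℝ} (hM : ∀ x ∈ S, |g x| ≤ M) :
    |(∑ x ∈ S, w x * (g x * exp (h x))) / ∑ x ∈ S, w x * exp (h x)| ≤ M := by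
  have hpos := sum_mul_exp_pos hw hw1 h
  rw [abs_div, abs_of_pos hpos, div_le_iff₀ hpos, Finset.mul_sum]
  refine (Finset.abs_sum_le_sum_abs _ _).trans (Finset.sum_le_sum fun x hx => ?_)
  rw [abs_mul, abs_mul, abs_of_nonneg (hw x hx), abs_exp, mul_left_comm]
  exact mul_le_mul_of_nonneg_right (hM x hx) (mul_nonneg (hw x hx) (exp_pos _).le)

/-- Differentiation of an averaged log-partition function over finitely many configurations. -/
lemma hasDerivAt_integral_log_sum_mul_exp {Ω : Type*} [MeasurableSpace Ω] {μ : Measure Ω}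
    (hw : ∀ x ∈ S, 0 ≤ w x) (hw1 : ∑ x ∈ S, w x = 1)
    {H H' : ℝ → Ω → ι → ℝ} {G : Ω → ι → ℝ} {t : ℝ} {U : Set ℝ} (hU : U ∈ nhds t)
    (hHm : ∀ r x, Measurable fun ω => H r ω x) (hHm' : ∀ x, Measurable fun ω => H' t ω x)
    (hHi : ∀ x, Integrable (fun ω => H t ω x) μ) (hG : ∀ x, Integrable (fun ω => G ω x) μ)
    (hbound : ∀ r ∈ U, ∀ ω x, |H' r ω x| ≤ G ω x)
    (hderiv : ∀ r ∈ U, ∀ ω x, HasDerivAt (fun u => H u ω x) (H' r ω x) r) :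
    HasDerivAt (fun r => ∫ ω, log (∑ x ∈ S, w x * exp (H r ω x)) ∂μ)
      (∫ ω, (∑ x ∈ S, w x * (H' t ω x * exp (H t ω x))) / (∑ x ∈ S, w x * exp (H t ω x)) ∂μ)
      t := by
  have hmeas (r : ℝ) : Measurable fun ω => log (∑ x ∈ S, w x * exp (H r ω x)) := by
    have := hHm r
    fun_prop
  refine (hasDerivAt_integral_of_dominated_loc_of_deriv_le (bound := fun ω => ∑ x ∈ S, G ω x)
    (F' := fun r ω => (∑ x ∈ S, w x * (H' r ω x * exp (H r ω x))) /
      ∑ x ∈ S, w x * exp (H r ω x)) hU ?_ ?_ ?_ ?_ ?_ ?_).2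
  · exact .of_forall fun r => (hmeas r).aestronglyMeasurable
  · refine Integrable.mono' (g := fun ω => ∑ x ∈ S, |H t ω x|)
      (integrable_finsetSum _ fun x _ => (hHi x).abs) (hmeas t).aestronglyMeasurable
      (.of_forall fun ω => ?_)
    exact abs_log_sum_mul_exp_le hw hw1 fun x hx =>
      Finset.single_le_sum (f := fun x => |H t ω x|) (fun y _ => abs_nonneg _) hx
  · have := hHm t
    exact Measurable.aestronglyMeasurable (by fun_prop)
  · refine .of_forall fun ω r hr => abs_sum_mul_exp_div_le hw hw1 fun x hx => ?_
    exact (hbound r hr ω x).trans (Finset.single_le_sum (f := fun x => G ω x)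
      (fun y _ => (abs_nonneg _).trans (hbound r hr ω y)) hx)
  · exact integrable_finsetSum _ fun x _ => hG x
  · refine .of_forall fun ω r hr => HasDerivAt.log ?_ (sum_mul_exp_pos hw hw1 _).ne'
    refine HasDerivAt.fun_sum fun x _ => ?_
    simpa only [mul_comm] using ((hderiv r hr ω x).exp).const_mul (w x)

end LogSumExp

section Hamiltonian

/-- The `t`-derivative of the Hamiltonian. -/
def HamDeriv (Δ m : ℝ) (n : ℕ) (t : ℝ)
    (xs : Fin n → ℝ) (ξ : SymIdx n → ℝ) (z : Fin n → ℝ) (x : Fin n → ℝ) : ℝ :=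
  ∑ q : SymIdx n, Aterm Δ n t xs ξ q x + ∑ i, Bterm Δ m n t xs z i x

/-- A bound for the `t`-derivative of the Hamiltonian, uniform over `t ∈ [a, b]`. -/
def HamDerivBound (Δ m : ℝ) (n : ℕ) (a b : ℝ)
    (xs : Fin n → ℝ) (ξ : SymIdx n → ℝ) (z : Fin n → ℝ) (x : Fin n → ℝ) : ℝ :=
  ∑ q : SymIdx n, (|-(x q.1.1 ^ 2 * x q.1.2 ^ 2) / (2 * Δ * n)|
      + |x q.1.1 * x q.1.2 * xs q.1.1 * xs q.1.2 / (Δ * n)|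
      + |x q.1.1 * x q.1.2 * ξ q| / (2 * √(n * Δ * a)))
    + ∑ i, (|m * x i ^ 2 / (2 * Δ)| + |m * x i * xs i / Δ|
      + |x i * z i / 2| * √(m / (Δ * (1 - b))))

variable {Δ m : ℝ} {n : ℕ}

lemma abs_HamDeriv_le (hΔ : 0 < Δ) (hm : 0 ≤ m) (hn : 1 ≤ n) {a b r : ℝ} (ha : 0 < a)
    (hb : b < 1) (har : a ≤ r) (hrb : r ≤ b)
    (xs : Fin n → ℝ) (ξ : SymIdx n → ℝ) (z : Fin n → ℝ) (x : Fin n → ℝ) :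
    |HamDeriv Δ m n r xs ξ z x| ≤ HamDerivBound Δ m n a b xs ξ z x := by
  have hn' : (0 : ℝ) < n := by exact_mod_cast hn
  refine (abs_add_le _ _).trans (add_le_add ?_ ?_)
  · refine (Finset.abs_sum_le_sum_abs _ _).trans (Finset.sum_le_sum fun q _ => ?_)
    refine (abs_add_three _ _ _).trans (add_le_add le_rfl ?_)
    rw [abs_div, abs_of_nonneg (by positivity : 0 ≤ 2 * √(n * Δ * r))]
    gcongr
  · refine (Finset.abs_sum_le_sum_abs _ _).trans (Finset.sum_le_sum fun i _ => ?_)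
    refine (abs_sub _ _).trans (add_le_add (abs_sub _ _) ?_)
    rw [abs_mul, abs_of_nonneg (sqrt_nonneg _)]
    have : 0 < 1 - b := by linarith
    gcongr

lemma hasDerivAt_Ham (hΔ : 0 < Δ) (hm : 0 ≤ m) (hn : 1 ≤ n) {t : ℝ} (ht0 : 0 < t) (ht1 : t < 1)
    (xs : Fin n → ℝ) (ξ : SymIdx n → ℝ) (z : Fin n → ℝ) (x : Fin n → ℝ) :
    HasDerivAt (fun r => Ham Δ m n r xs ξ z x) (HamDeriv Δ m n t xs ξ z x) t := by
  have hn' : (0 : ℝ) < n := by exact_mod_cast hn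
  have ht1' : 0 < 1 - t := by linarith
  have hsqrt : HasDerivAt (fun r => √(r / (n * Δ))) (1 / (2 * √(n * Δ * t))) t := by
    refine (((hasDerivAt_id' t).div_const (n * Δ)).sqrt (by positivity)).congr_deriv ?_
    have h : √(n * Δ * t) = √(t / (n * Δ)) * (n * Δ) := by
      rw [← sqrt_sq (by positivity : 0 ≤ √(t / (n * Δ)) * (n * Δ)), mul_pow,
        sq_sqrt (by positivity)]
      congr 1
      field_simp
    rw [h]
    field_simp
  have hsqrt' : HasDerivAt (fun r => √(m * (1 - r) / Δ)) (-(√(m / (Δ * (1 - t))) / 2)) t := by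
    rcases hm.eq_or_lt with rfl | hm
    · simpa using hasDerivAt_const t (0 : ℝ)
    refine (((((hasDerivAt_id' t).const_sub 1).const_mul m).div_const Δ).sqrt
      (by positivity)).congr_deriv ?_
    have h : √(m / (Δ * (1 - t))) * √(m * (1 - t) / Δ) = m / Δ := by
      rw [← sqrt_mul (by positivity), ← sqrt_sq (by positivity : 0 ≤ m / Δ)]
      congr 1
      field_simp
    rw [div_eq_iff (by positivity)]
    linear_combination h
  unfold Ham
  have hlin : HasDerivAt (fun r : ℝ => 1 - r) (-1) t := by
    simpa using (hasDerivAt_id' t).const_sub 1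
  have hq (q : SymIdx n) : HasDerivAt (fun r => -(r * x q.1.1 ^ 2 * x q.1.2 ^ 2) / (2 * Δ * n)
        + r * x q.1.1 * x q.1.2 * xs q.1.1 * xs q.1.2 / (Δ * n)
        + √(r / (n * Δ)) * x q.1.1 * x q.1.2 * ξ q) (Aterm Δ n t xs ξ q x) t := by
    refine (((((((hasDerivAt_id' t).mul_const (x q.1.1 ^ 2)).mul_const
      (x q.1.2 ^ 2)).fun_neg).div_const (2 * Δ * n)).fun_add ((((((hasDerivAt_id' t).mul_const
      (x q.1.1)).mul_const (x q.1.2)).mul_const (xs q.1.1)).mul_const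
      (xs q.1.2)).div_const (Δ * n))).fun_add
      (((hsqrt.mul_const (x q.1.1)).mul_const (x q.1.2)).mul_const (ξ q))).congr_deriv ?_
    simp only [Aterm]
    ring
  refine ((((HasDerivAt.fun_sum fun q (_ : q ∈ Finset.univ) => hq q).fun_sub
    (((hlin.mul_const m).mul_const (∑ i, x i ^ 2)).div_const (2 * Δ))).fun_add
    (((hlin.mul_const m).mul_const (∑ i, x i * xs i)).div_const Δ)).fun_add
    (hsqrt'.mul_const (∑ i, x i * z i))).congr_deriv ?_
  have hB : ∑ i, Bterm Δ m n t xs z i x = m / (2 * Δ) * ∑ i, x i ^ 2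
      - m / Δ * ∑ i, x i * xs i - √(m / (Δ * (1 - t))) / 2 * ∑ i, x i * z i := by
    simp only [Finset.mul_sum, ← Finset.sum_sub_distrib, Bterm]
    exact Finset.sum_congr rfl fun i _ => by ring
  rw [HamDeriv, hB]
  ring

end Hamiltonian

section Disorder

variable {p : Measure ℝ} [IsProbabilityMeasure p] {s : Finset ℝ} {n : ℕ}

instance : IsProbabilityMeasure (baseP p n) := by
  unfold baseP
  infer_instance

lemma integrable_signal (hs : p (↑s : Set ℝ)ᶜ = 0) (f : (Fin n → ℝ) → ℝ) :
    Integrable (fun ω => f ω.1) (baseP p n) :=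
  (integrable_of_ae_mem_finset (ae_mem_piFinset hs) f).comp_fst _

lemma integrable_gaussianReal_id : Integrable (fun y : ℝ => y) (gaussianReal 0 1) :=
  (memLp_id_gaussianReal 1).integrable le_rfl

lemma integrable_matrixNoise (q : SymIdx n) : Integrable (fun ω => ω.2.1 q) (baseP p n) :=
  ((integrable_comp_eval (μ := fun _ : SymIdx n => gaussianReal 0 1) (i := q)
    integrable_gaussianReal_id).comp_fst _).comp_snd _

lemma integrable_vectorNoise (i : Fin n) : Integrable (fun ω => ω.2.2 i) (baseP p n) :=
  ((integrable_comp_eval (μ := fun _ : Fin n => gaussianReal 0 1) (i := i)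
    integrable_gaussianReal_id).comp_snd _).comp_snd _

lemma integrable_Ham (hs : p (↑s : Set ℝ)ᶜ = 0) (Δ m t : ℝ) (x : Fin n → ℝ) :
    Integrable (fun ω => Ham Δ m n t ω.1 ω.2.1 ω.2.2 x) (baseP p n) := by
  refine ((((integrable_finsetSum _ fun q _ => ?_).sub (integrable_const _)).add ?_).add
    (Integrable.const_mul (integrable_finsetSum _ fun i _ =>
      (integrable_vectorNoise i).const_mul _) _))
  · exact (integrable_signal hs fun xs => -(t * x q.1.1 ^ 2 * x q.1.2 ^ 2) / (2 * Δ * n)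
      + t * x q.1.1 * x q.1.2 * xs q.1.1 * xs q.1.2 / (Δ * n)).add
      ((integrable_matrixNoise q).const_mul _)
  · exact integrable_signal hs fun xs => (1 - t) * m * (∑ i, x i * xs i) / Δ

lemma integrable_HamDerivBound (hs : p (↑s : Set ℝ)ᶜ = 0) (Δ m a b : ℝ) (x : Fin n → ℝ) :
    Integrable (fun ω => HamDerivBound Δ m n a b ω.1 ω.2.1 ω.2.2 x) (baseP p n) := by
  refine (integrable_finsetSum _ fun q _ => ?_).add (integrable_finsetSum _ fun i _ => ?_)
  · exact (integrable_signal hs fun xs => |-(x q.1.1 ^ 2 * x q.1.2 ^ 2) / (2 * Δ * n)|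
      + |x q.1.1 * x q.1.2 * xs q.1.1 * xs q.1.2 / (Δ * n)|).add
      (((integrable_matrixNoise q).const_mul _).abs.div_const _)
  · exact (integrable_signal hs fun xs => |m * x i ^ 2 / (2 * Δ)| + |m * x i * xs i / Δ|).add
      ((((integrable_vectorNoise i).const_mul _).div_const _).abs.mul_const _)

lemma gibbs_eq_sum_div (hs : p (↑s : Set ℝ)ᶜ = 0) (Δ m t : ℝ)
    (xs : Fin n → ℝ) (ξ : SymIdx n → ℝ) (z : Fin n → ℝ) (f : (Fin n → ℝ) → ℝ) :
    gibbs p Δ m n t xs ξ z f =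
      (∑ x ∈ Fintype.piFinset fun _ => s, (Measure.pi fun _ : Fin n => p).real {x} *
        (f x * exp (Ham Δ m n t xs ξ z x))) /
      ∑ x ∈ Fintype.piFinset fun _ => s, (Measure.pi fun _ : Fin n => p).real {x} *
        exp (Ham Δ m n t xs ξ z x) := by
  simp only [gibbs, Zt, integral_eq_sum_of_ae_mem_finset (ae_mem_piFinset hs)]

end Disorder

/-- **Derivative of the averaged log-partition function** : for `t ∈ (0,1)`,
`(d/dt) E[log Z_t] = E[ Σ_{i≤j} ⟨A_{ij}⟩_t + Σ_i ⟨B_i⟩_t ]`. -/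
theorem deriv_avg_logZ
    (p : Measure ℝ) [IsProbabilityMeasure p]
    (hsupp : ∃ s : Finset ℝ, p (↑s : Set ℝ)ᶜ = 0)
    (Δ : ℝ) (hΔ : 0 < Δ) (m : ℝ) (hm : 0 ≤ m)
    (n : ℕ) (hn : 1 ≤ n) (t : ℝ) (ht : t ∈ Set.Ioo (0 : ℝ) 1) :
    DifferentiableAt ℝ (Favg p Δ m n) t ∧
      deriv (Favg p Δ m n) t
        = ∫ ω, (∑ q : SymIdx n,
              gibbs p Δ m n t ω.1 ω.2.1 ω.2.2 (Aterm Δ n t ω.1 ω.2.1 q)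
            + ∑ i : Fin n,
              gibbs p Δ m n t ω.1 ω.2.1 ω.2.2 (Bterm Δ m n t ω.1 ω.2.2 i))
          ∂(baseP p n) := by
  obtain ⟨s, hs⟩ := hsupp
  obtain ⟨ht0, ht1⟩ := ht
  let w : (Fin n → ℝ) → ℝ := fun x => (Measure.pi fun _ : Fin n => p).real {x}
  have hw1 : ∑ x ∈ Fintype.piFinset fun _ => s, w x = 1 := by
    simpa only [mul_one, integral_const, probReal_univ, smul_eq_mul] using
      (integral_eq_sum_of_ae_mem_finset (ae_mem_piFinset (ι := Fin n) hs) fun _ => 1).symm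
  have key := hasDerivAt_integral_log_sum_mul_exp (μ := baseP p n) (w := w)
    (H := fun r ω x => Ham Δ m n r ω.1 ω.2.1 ω.2.2 x)
    (H' := fun r ω x => HamDeriv Δ m n r ω.1 ω.2.1 ω.2.2 x)
    (G := fun ω x => HamDerivBound Δ m n (t / 2) ((1 + t) / 2) ω.1 ω.2.1 ω.2.2 x)
    (U := Set.Icc (t / 2) ((1 + t) / 2)) (fun _ _ => measureReal_nonneg) hw1
    (Icc_mem_nhds (by linarith) (by linarith))
    (fun r x => by unfold Ham; fun_prop)
    (fun x => by unfold HamDeriv Aterm Bterm; fun_prop)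
    (integrable_Ham hs Δ m t) (integrable_HamDerivBound hs Δ m _ _)
    (fun r hr ω x => abs_HamDeriv_le hΔ hm hn (by linarith) (by linarith) hr.1 hr.2 _ _ _ x)
    (fun r hr ω x => hasDerivAt_Ham hΔ hm hn (by linarith [hr.1]) (by linarith [hr.2]) _ _ _ x)
  have hF : Favg p Δ m n = fun r => ∫ ω, log (∑ x ∈ Fintype.piFinset fun _ => s,
      w x * exp (Ham Δ m n r ω.1 ω.2.1 ω.2.2 x)) ∂(baseP p n) := by
    ext r
    simp only [Favg, Zt, integral_eq_sum_of_ae_mem_finset (ae_mem_piFinset hs), w]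
  rw [hF]
  refine ⟨key.differentiableAt, key.deriv.trans (integral_congr_ae (.of_forall fun ω => ?_))⟩
  simp only [gibbs_eq_sum_div hs, ← Finset.sum_div, ← add_div]
  congr 1
  rw [Finset.sum_comm, Finset.sum_comm (s := (Finset.univ : Finset (Fin n))),
    ← Finset.sum_add_distrib]
  refine Finset.sum_congr rfl fun x _ => ?_
  rw [← Finset.mul_sum, ← Finset.mul_sum, ← mul_add, ← Finset.sum_mul, ← Finset.sum_mul,
    ← add_mul]
  rfl
end
end

section
/- For every t ∈ (0,1), the exact derivative identity (1/n)·(d/dt) E[log Z_t] = (1/(2Δn²)) Σ_{1≤i≤j≤n} E[⟨x_i x_j⟩_t · x*_i x*_j] − (m/(2Δn)) Σ_{i=1}^n E[⟨x_i⟩_t · x*_i] holds. -/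
open MeasureTheory ProbabilityTheory Filter Real

noncomputable section

section GaussianSpace

variable {ι : Type*} [Fintype ι]

/-- The Lebesgue density of the standard Gaussian measure on `ι → ℝ`. -/
def stdGaussianDensity (y : ι → ℝ) : ℝ :=
  (√(2 * π))⁻¹ ^ Fintype.card ι * exp (-∑ a, y a ^ 2 / 2)

/-- The exponent of the Cameron-Martin density of a Gaussian vector translated by `v`. -/
def shiftExponent (v y : ι → ℝ) : ℝ := ∑ a, (v a * y a - v a ^ 2 / 2)

/-- The standard Gaussian measure on `ι → ℝ`. -/
abbrev stdGaussianPi (ι : Type*) [Fintype ι] : Measure (ι → ℝ) :=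
  Measure.pi fun _ : ι => gaussianReal 0 1

lemma stdGaussianDensity_nonneg (y : ι → ℝ) : 0 ≤ stdGaussianDensity y := by
  unfold stdGaussianDensity
  positivity

lemma stdGaussianDensity_eq_prod (y : ι → ℝ) :
    stdGaussianDensity y = ∏ a, gaussianPDFReal 0 1 (y a) := by
  simp [stdGaussianDensity, gaussianPDFReal, Finset.prod_mul_distrib, ← Real.exp_sum,
    ← Finset.sum_neg_distrib, neg_div]

lemma stdGaussianPi_eq_withDensity :
    stdGaussianPi ι = volume.withDensity fun y => ENNReal.ofReal (stdGaussianDensity y) := by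
  refine Measure.pi_eq fun s hs => ?_
  rw [withDensity_apply _ (MeasurableSet.univ_pi hs), volume_pi, Measure.restrict_pi_pi]
  simp_rw [stdGaussianDensity_eq_prod]
  rw [← ofReal_integral_eq_lintegral_ofReal]
  · rw [integral_fintype_prod_eq_prod (fun (_ : ι) x => gaussianPDFReal 0 1 x),
      ENNReal.ofReal_prod_of_nonneg]
    · exact Finset.prod_congr rfl fun a _ =>
        (gaussianReal_apply_eq_integral 0 one_ne_zero (s a)).symm
    · exact fun a _ => integral_nonneg fun x => gaussianPDFReal_nonneg 0 1 x
  · exact Integrable.fintype_prod fun a => (integrable_gaussianPDFReal 0 1).integrableOn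
  · exact .of_forall fun y => Finset.prod_nonneg fun a _ => gaussianPDFReal_nonneg 0 1 _

@[fun_prop]
lemma continuous_stdGaussianDensity : Continuous (stdGaussianDensity (ι := ι)) := by
  unfold stdGaussianDensity
  fun_prop

@[fun_prop]
lemma continuous_shiftExponent (v : ι → ℝ) : Continuous (shiftExponent v) := by
  unfold shiftExponent
  fun_prop

lemma integrable_stdGaussianPi_iff {f : (ι → ℝ) → ℝ} :
    Integrable f (stdGaussianPi ι) ↔ Integrable (fun y => stdGaussianDensity y * f y) volume := by
  rw [stdGaussianPi_eq_withDensity, integrable_withDensity_iff_integrable_smul'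
    (by fun_prop) (.of_forall fun _ => ENNReal.ofReal_lt_top)]
  simp_rw [ENNReal.toReal_ofReal (stdGaussianDensity_nonneg _), smul_eq_mul]

lemma integral_stdGaussianPi (f : (ι → ℝ) → ℝ) :
    ∫ y, f y ∂stdGaussianPi ι = ∫ y, stdGaussianDensity y * f y := by
  rw [stdGaussianPi_eq_withDensity, integral_withDensity_eq_integral_toReal_smul
    (by fun_prop) (.of_forall fun _ => ENNReal.ofReal_lt_top)]
  simp_rw [ENNReal.toReal_ofReal (stdGaussianDensity_nonneg _), smul_eq_mul]

lemma stdGaussianDensity_mul_exp_shiftExponent (v y : ι → ℝ) :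
    stdGaussianDensity y * exp (shiftExponent v y) = stdGaussianDensity (y - v) := by
  simp only [stdGaussianDensity, shiftExponent, mul_assoc, ← Real.exp_add]
  congr 2
  rw [← Finset.sum_neg_distrib, ← Finset.sum_neg_distrib, ← Finset.sum_add_distrib]
  refine Finset.sum_congr rfl fun a _ => ?_
  simp only [Pi.sub_apply]
  ring

/-- Cameron-Martin formula for the standard Gaussian measure. -/
lemma integral_add_left_stdGaussianPi (v : ι → ℝ) (f : (ι → ℝ) → ℝ) :
    ∫ y, f (v + y) ∂stdGaussianPi ι = ∫ y, exp (shiftExponent v y) * f y ∂stdGaussianPi ι := by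
  simp_rw [integral_stdGaussianPi, ← mul_assoc, stdGaussianDensity_mul_exp_shiftExponent]
  rw [← integral_add_left_eq_self (fun y => stdGaussianDensity (y - v) * f y) v]
  simp

lemma integrable_add_left_stdGaussianPi (v : ι → ℝ) {f : (ι → ℝ) → ℝ}
    (hf : Integrable (fun y => exp (shiftExponent v y) * f y) (stdGaussianPi ι)) :
    Integrable (fun y => f (v + y)) (stdGaussianPi ι) := by
  simp_rw [integrable_stdGaussianPi_iff, ← mul_assoc,
    stdGaussianDensity_mul_exp_shiftExponent] at hf ⊢
  simpa using hf.comp_add_left v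

lemma integrable_exp_mul_norm_stdGaussianPi {c : ℝ} (hc : 0 ≤ c) :
    Integrable (fun y => exp (c * (1 + ‖y‖))) (stdGaussianPi ι) := by
  have key : Integrable (fun y : ι → ℝ => exp c * ∏ a, exp (c * |y a|)) (stdGaussianPi ι) :=
    (Integrable.fintype_prod (f := fun _ x => exp (c * |x|)) fun a =>
      integrable_exp_mul_abs (integrable_exp_mul_gaussianReal c)
        (integrable_exp_mul_gaussianReal (-c))).const_mul _
  refine key.mono' (by fun_prop) (.of_forall fun y => ?_)
  rw [Real.norm_eq_abs, Real.abs_exp, ← Real.exp_sum, ← Real.exp_add, Real.exp_le_exp, mul_add,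
    mul_one, ← Finset.mul_sum]
  gcongr
  refine (pi_norm_le_iff_of_nonneg (by positivity)).2 fun a => ?_
  exact Finset.single_le_sum (f := fun a => |y a|) (fun _ _ => abs_nonneg _) (Finset.mem_univ a)

lemma integrable_stdGaussianPi_of_le {f : (ι → ℝ) → ℝ} (hf : Continuous f) {c : ℝ} (hc : 0 ≤ c)
    (h : ∀ y, |f y| ≤ exp (c * (1 + ‖y‖))) : Integrable f (stdGaussianPi ι) :=
  (integrable_exp_mul_norm_stdGaussianPi hc).mono' hf.aestronglyMeasurable (.of_forall h)

/-- Gaussian integration by parts. -/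
lemma integral_mul_stdGaussianPi_eq_integral_lineDeriv [DecidableEq ι] (a : ι)
    {f f' : (ι → ℝ) → ℝ}
    (hf : ∀ y, HasLineDerivAt ℝ f (f' y) y (Pi.single a 1))
    (hint : Integrable f (stdGaussianPi ι))
    (hint' : Integrable f' (stdGaussianPi ι))
    (hmul : Integrable (fun y => y a * f y) (stdGaussianPi ι)) :
    ∫ y, y a * f y ∂stdGaussianPi ι = ∫ y, f' y ∂stdGaussianPi ι := by
  rw [integrable_stdGaussianPi_iff] at hint hint' hmul
  rw [integral_stdGaussianPi, integral_stdGaussianPi]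
  have hρ (y : ι → ℝ) : HasLineDerivAt ℝ stdGaussianDensity (-(y a) * stdGaussianDensity y) y
      (Pi.single a 1) := by
    have hsum : HasDerivAt (fun u : ℝ => ∑ b, (y + u • (Pi.single a (1 : ℝ) : ι → ℝ)) b ^ 2 / 2) (y a) 0 := by
      have := HasDerivAt.fun_sum (u := Finset.univ) (x := (0 : ℝ))
        (A := fun b u => (y + u • (Pi.single a (1 : ℝ) : ι → ℝ)) b ^ 2 / 2)
        (A' := fun b => y b * (Pi.single a (1 : ℝ) : ι → ℝ) b) fun b _ => by
          have h := (((hasDerivAt_id (0 : ℝ)).mul_const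
            ((Pi.single a (1 : ℝ) : ι → ℝ) b)).const_add (y b)).pow 2 |>.div_const 2
          refine h.congr_deriv ?_
          simp
          ring
      simpa [Pi.single_apply] using this
    have := (hsum.neg.exp.const_mul ((√(2 * π))⁻¹ ^ Fintype.card ι))
    refine HasDerivAt.congr_deriv this ?_
    simp [stdGaussianDensity]
    ring
  have := integral_bilinear_hasLineDerivAt_right_eq_neg_left_of_integrable
    (μ := (volume : Measure (ι → ℝ))) (B := ContinuousLinearMap.mul ℝ ℝ)
    (f := stdGaussianDensity) (f' := fun y => -(y a) * stdGaussianDensity y) (g := f) (g' := f')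
    (v := Pi.single a 1) ?_ hint' hint (fun y _ => hρ y) (fun y _ => hf y)
  · simp only [ContinuousLinearMap.mul_apply'] at this
    rw [this, ← integral_neg]
    exact integral_congr_ae (.of_forall fun y => by simp; ring)
  · refine hmul.neg.congr (.of_forall fun y => ?_)
    simp
    ring

end GaussianSpace

section TiltedMixture

variable {ι K : Type*} [Fintype ι] [Fintype K]

/-- The partition function of a finite mixture of translated standard Gaussians,
with weights `w` and means `v`. -/
def mixPartition (w : K → ℝ) (v : K → ι → ℝ) (y : ι → ℝ) : ℝ :=
  ∑ k, w k * exp (shiftExponent (v k) y)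

/-- The posterior mean of `f` given the observation `y` of a finite mixture of translated standard
Gaussians. -/
def mixMean (w : K → ℝ) (v : K → ι → ℝ) (f : K → ℝ) (y : ι → ℝ) : ℝ :=
  (∑ k, w k * f k * exp (shiftExponent (v k) y)) / mixPartition w v y

lemma abs_sum_le_of_forall_le {f y : ι → ℝ} {M : ℝ} (hM : 0 ≤ M)
    (hf : ∀ a, |f a| ≤ M * ‖y‖ + M ^ 2) :
    |∑ a, f a| ≤ Fintype.card ι * (M + M ^ 2) * (1 + ‖y‖) := by
  calc |∑ a, f a| ≤ ∑ a, |f a| := Finset.abs_sum_le_sum_abs _ _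
    _ ≤ ∑ _a : ι, (M + M ^ 2) * (1 + ‖y‖) := by
        refine Finset.sum_le_sum fun a _ => (hf a).trans ?_
        nlinarith [norm_nonneg y, mul_nonneg (sq_nonneg M) (norm_nonneg y)]
    _ = _ := by simp [mul_assoc]

lemma abs_shiftExponent_le {v : ι → ℝ} {M : ℝ} (hM : 0 ≤ M) (hv : ∀ a, |v a| ≤ M) (y : ι → ℝ) :
    |shiftExponent v y| ≤ Fintype.card ι * (M + M ^ 2) * (1 + ‖y‖) := by
  refine abs_sum_le_of_forall_le hM fun a => (abs_sub _ _).trans ?_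
  have hy : |y a| ≤ ‖y‖ := norm_le_pi_norm y a
  rw [abs_mul, abs_of_nonneg (by positivity : 0 ≤ v a ^ 2 / 2), ← sq_abs (v a)]
  have := mul_le_mul (hv a) hy (abs_nonneg _) hM
  nlinarith [pow_le_pow_left₀ (abs_nonneg _) (hv a) 2, sq_nonneg (v a), sq_nonneg |v a|]

lemma hasLineDerivAt_shiftExponent [DecidableEq ι] (v y : ι → ℝ) (a : ι) :
    HasLineDerivAt ℝ (shiftExponent v) (v a) y (Pi.single a 1) := by
  have h : (fun u : ℝ => shiftExponent v (y + u • Pi.single a 1)) =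
      fun u => shiftExponent v y + u * v a := by
    ext u
    simp only [shiftExponent, Pi.add_apply, Pi.smul_apply, smul_eq_mul, mul_add,
      Finset.sum_sub_distrib, Finset.sum_add_distrib]
    simp [Pi.single_apply]
    ring
  unfold HasLineDerivAt
  rw [h]
  simpa using ((hasDerivAt_id (0 : ℝ)).mul_const (v a)).const_add (shiftExponent v y)

variable {w : K → ℝ} {v : K → ι → ℝ}

lemma mixPartition_pos (hw : ∀ k, 0 ≤ w k) (hw1 : ∑ k, w k = 1) (v : K → ι → ℝ) (y : ι → ℝ) :
    0 < mixPartition w v y := by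
  obtain ⟨k, -, hk⟩ := Finset.exists_ne_zero_of_sum_ne_zero (hw1.trans_ne one_ne_zero)
  exact Finset.sum_pos' (fun k _ => mul_nonneg (hw k) (exp_pos _).le)
    ⟨k, Finset.mem_univ k, mul_pos ((hw k).lt_of_ne' hk) (exp_pos _)⟩

@[fun_prop]
lemma continuous_mixPartition (w : K → ℝ) (v : K → ι → ℝ) : Continuous (mixPartition w v) := by
  unfold mixPartition
  fun_prop

lemma continuous_log_mixPartition (hw : ∀ k, 0 ≤ w k) (hw1 : ∑ k, w k = 1) (v : K → ι → ℝ) :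
    Continuous fun y => log (mixPartition w v y) :=
  (continuous_mixPartition w v).log fun y => (mixPartition_pos hw hw1 v y).ne'

lemma continuous_mixMean (hw : ∀ k, 0 ≤ w k) (hw1 : ∑ k, w k = 1) (v : K → ι → ℝ) (f : K → ℝ) :
    Continuous (mixMean w v f) := by
  unfold mixMean
  exact Continuous.div (by fun_prop) (by fun_prop) fun y => (mixPartition_pos hw hw1 v y).ne'

lemma abs_mixMean_le (hw : ∀ k, 0 ≤ w k) (hw1 : ∑ k, w k = 1) (v : K → ι → ℝ) {f : K → ℝ} {M : ℝ}
    (hf : ∀ k, |f k| ≤ M) (y : ι → ℝ) : |mixMean w v f y| ≤ M := by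
  have hZ := mixPartition_pos hw hw1 v y
  rw [mixMean, abs_div, abs_of_pos hZ, div_le_iff₀ hZ, mixPartition, Finset.mul_sum]
  refine (Finset.abs_sum_le_sum_abs _ _).trans (Finset.sum_le_sum fun k _ => ?_)
  rw [abs_mul, abs_mul, Real.abs_exp, abs_of_nonneg (hw k), mul_comm (w k), mul_assoc]
  exact mul_le_mul_of_nonneg_right (hf k) (mul_nonneg (hw k) (exp_pos _).le)

lemma sum_mul_le_of_forall_le (hw : ∀ k, 0 ≤ w k) (hw1 : ∑ k, w k = 1) {f : K → ℝ} {c : ℝ}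
    (hf : ∀ k, f k ≤ c) : ∑ k, w k * f k ≤ c := by
  calc ∑ k, w k * f k ≤ ∑ k, w k * c :=
        Finset.sum_le_sum fun k _ => mul_le_mul_of_nonneg_left (hf k) (hw k)
    _ = c := by rw [← Finset.sum_mul, hw1, one_mul]

lemma abs_log_mixPartition_le (hw : ∀ k, 0 ≤ w k) (hw1 : ∑ k, w k = 1) {M : ℝ} (hM : 0 ≤ M)
    (hv : ∀ k a, |v k a| ≤ M) (y : ι → ℝ) :
    |log (mixPartition w v y)| ≤ Fintype.card ι * (M + M ^ 2) * (1 + ‖y‖) := by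
  have hZ := mixPartition_pos hw hw1 v y
  have h k := abs_le.1 (abs_shiftExponent_le hM (hv k) y)
  rw [abs_le, Real.le_log_iff_exp_le hZ, Real.log_le_iff_le_exp hZ]
  refine ⟨?_, sum_mul_le_of_forall_le hw hw1 fun k => exp_le_exp.2 (h k).2⟩
  have := sum_mul_le_of_forall_le hw hw1 (f := fun k => -exp (shiftExponent (v k) y))
    fun k => neg_le_neg (exp_le_exp.2 (h k).1)
  simp only [mul_neg, Finset.sum_neg_distrib] at this
  exact neg_le_neg_iff.1 this

lemma exp_shiftExponent_le {v : ι → ℝ} {M : ℝ} (hM : 0 ≤ M) (hv : ∀ a, |v a| ≤ M) (y : ι → ℝ) :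
    |exp (shiftExponent v y)| ≤ exp (Fintype.card ι * (M + M ^ 2) * (1 + ‖y‖)) := by
  rw [Real.abs_exp, exp_le_exp]
  exact (le_abs_self _).trans (abs_shiftExponent_le hM hv y)

lemma abs_log_mixPartition_add_one_le (hw : ∀ k, 0 ≤ w k) (hw1 : ∑ k, w k = 1) {M : ℝ}
    (hM : 0 ≤ M) (hv : ∀ k a, |v k a| ≤ M) (y : ι → ℝ) :
    |log (mixPartition w v y) + 1| ≤ exp (Fintype.card ι * (M + M ^ 2) * (1 + ‖y‖)) := by
  refine (abs_add_le _ _).trans ?_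
  rw [abs_one]
  exact (add_le_add_left (abs_log_mixPartition_le hw hw1 hM hv y) 1).trans (add_one_le_exp _)

lemma integrable_exp_mul_log_mixPartition (hw : ∀ k, 0 ≤ w k) (hw1 : ∑ k, w k = 1)
    (v : K → ι → ℝ) (l : K) :
    Integrable (fun y => exp (shiftExponent (v l) y) * log (mixPartition w v y))
      (stdGaussianPi ι) := by
  have hv k a : |v k a| ≤ ‖v‖ := (norm_le_pi_norm (v k) a).trans (norm_le_pi_norm v k)
  have hc := continuous_log_mixPartition hw hw1 v
  refine integrable_stdGaussianPi_of_le (by fun_prop)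
    (c := 2 * (Fintype.card ι * (‖v‖ + ‖v‖ ^ 2))) (by positivity) fun y => ?_
  rw [abs_mul, mul_assoc, two_mul, Real.exp_add]
  gcongr
  · exact exp_shiftExponent_le (norm_nonneg v) (hv l) y
  · refine (abs_log_mixPartition_le hw hw1 (norm_nonneg v) hv y).trans ?_
    linarith [add_one_le_exp (Fintype.card ι * (‖v‖ + ‖v‖ ^ 2) * (1 + ‖y‖))]

lemma integrable_exp_mul_mixMean (hw : ∀ k, 0 ≤ w k) (hw1 : ∑ k, w k = 1)
    (v : K → ι → ℝ) (l : K) (f : K → ℝ) :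
    Integrable (fun y => exp (shiftExponent (v l) y) * mixMean w v f y) (stdGaussianPi ι) := by
  have hv a : |v l a| ≤ ‖v‖ := (norm_le_pi_norm (v l) a).trans (norm_le_pi_norm v l)
  have hc := continuous_mixMean hw hw1 v f
  refine integrable_stdGaussianPi_of_le (by fun_prop)
    (c := Fintype.card ι * (‖v‖ + ‖v‖ ^ 2) + ‖f‖) (by positivity) fun y => ?_
  rw [abs_mul, add_mul, Real.exp_add]
  gcongr
  · exact exp_shiftExponent_le (norm_nonneg v) hv y
  · refine (abs_mixMean_le hw hw1 v (norm_le_pi_norm f) y).trans ?_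
    nlinarith [add_one_le_exp (‖f‖ * (1 + ‖y‖)), mul_nonneg (norm_nonneg f) (norm_nonneg y)]

lemma integrable_exp_mul_log_add_one (hw : ∀ k, 0 ≤ w k) (hw1 : ∑ k, w k = 1)
    (v : K → ι → ℝ) (l : K) :
    Integrable (fun y => exp (shiftExponent (v l) y) * (log (mixPartition w v y) + 1))
      (stdGaussianPi ι) := by
  have hv k a : |v k a| ≤ ‖v‖ := (norm_le_pi_norm (v k) a).trans (norm_le_pi_norm v k)
  have hc := continuous_log_mixPartition hw hw1 v
  refine integrable_stdGaussianPi_of_le (by fun_prop)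
    (c := 2 * (Fintype.card ι * (‖v‖ + ‖v‖ ^ 2))) (by positivity) fun y => ?_
  rw [abs_mul, mul_assoc, two_mul, Real.exp_add]
  gcongr
  · exact exp_shiftExponent_le (norm_nonneg v) (hv l) y
  · exact abs_log_mixPartition_add_one_le hw hw1 (norm_nonneg v) hv y

lemma integrable_coord_mul_exp_mul_log_add_one (hw : ∀ k, 0 ≤ w k) (hw1 : ∑ k, w k = 1)
    (v : K → ι → ℝ) (l : K) (a : ι) :
    Integrable (fun y => y a * (exp (shiftExponent (v l) y) * (log (mixPartition w v y) + 1)))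
      (stdGaussianPi ι) := by
  have hv k a : |v k a| ≤ ‖v‖ := (norm_le_pi_norm (v k) a).trans (norm_le_pi_norm v k)
  have hc := continuous_log_mixPartition hw hw1 v
  refine integrable_stdGaussianPi_of_le (by fun_prop)
    (c := 1 + 2 * (Fintype.card ι * (‖v‖ + ‖v‖ ^ 2))) (by positivity) fun y => ?_
  rw [abs_mul, abs_mul, add_mul, mul_assoc 2, two_mul, Real.exp_add, Real.exp_add]
  gcongr
  · have hy : |y a| ≤ ‖y‖ := norm_le_pi_norm y a
    linarith [add_one_le_exp (1 * (1 + ‖y‖))]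
  · exact exp_shiftExponent_le (norm_nonneg v) (hv l) y
  · exact abs_log_mixPartition_add_one_le hw hw1 (norm_nonneg v) hv y

lemma hasLineDerivAt_exp_mul_log_add_one [DecidableEq ι] (hw : ∀ k, 0 ≤ w k) (hw1 : ∑ k, w k = 1)
    (v : K → ι → ℝ) (l : K) (a : ι) (y : ι → ℝ) :
    HasLineDerivAt ℝ
      (fun y => exp (shiftExponent (v l) y) * (log (mixPartition w v y) + 1))
      (v l a * (exp (shiftExponent (v l) y) * (log (mixPartition w v y) + 1))
        + exp (shiftExponent (v l) y) * mixMean w v (fun k => v k a) y) y (Pi.single a 1) := by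
  have hE k := HasDerivAt.exp (hasLineDerivAt_shiftExponent (v k) y a)
  have hZ : HasDerivAt (fun u : ℝ => mixPartition w v (y + u • Pi.single a 1)) _ 0 :=
    HasDerivAt.fun_sum (u := Finset.univ) fun k _ => (hE k).const_mul (w k)
  have hZ0 := (mixPartition_pos hw hw1 v (y + (0 : ℝ) • Pi.single a 1)).ne'
  refine ((hE l).mul ((hZ.log hZ0).add_const 1)).congr_deriv ?_
  simp only [zero_smul, add_zero, mixMean]
  congr 1
  · ring
  · congr 2
    exact Finset.sum_congr rfl fun k _ => by ring

/-- The covariance of the signal with the score of the observation reduces to a posterior mean. -/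
lemma integral_sub_mul_exp_mul_log_add_one (hw : ∀ k, 0 ≤ w k) (hw1 : ∑ k, w k = 1)
    (v : K → ι → ℝ) (l : K) (a : ι) :
    ∫ y, (y a - v l a) * (exp (shiftExponent (v l) y) * (log (mixPartition w v y) + 1))
        ∂stdGaussianPi ι
      = ∫ y, mixMean w v (fun k => v k a) (v l + y) ∂stdGaussianPi ι := by
  classical
  have h1 := integrable_exp_mul_log_add_one hw hw1 v l
  have h2 := integrable_exp_mul_mixMean hw hw1 v l fun k => v k a
  have h3 := integrable_coord_mul_exp_mul_log_add_one hw hw1 v l a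
  rw [integral_add_left_stdGaussianPi (v l) (mixMean w v fun k => v k a)]
  simp_rw [sub_mul]
  rw [integral_sub h3 (h1.const_mul _), integral_mul_stdGaussianPi_eq_integral_lineDeriv a
    (hasLineDerivAt_exp_mul_log_add_one hw hw1 v l a) h1 ((h1.const_mul _).add h2) h3,
    integral_add (h1.const_mul _) h2]
  ring

lemma sum_integral_log_mixPartition (hw : ∀ k, 0 ≤ w k) (hw1 : ∑ k, w k = 1) (v : K → ι → ℝ) :
    ∑ l, w l * ∫ y, log (mixPartition w v (v l + y)) ∂stdGaussianPi ι
      = ∫ y, mixPartition w v y * log (mixPartition w v y) ∂stdGaussianPi ι := by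
  have h l := (integrable_exp_mul_log_mixPartition hw hw1 v l).const_mul (w l)
  have (l : K) := integral_add_left_stdGaussianPi (v l) fun y => log (mixPartition w v y)
  simp_rw [this, ← integral_const_mul]
  rw [← integral_finsetSum _ fun l _ => h l]
  simp_rw [← mul_assoc, ← Finset.sum_mul]
  rfl

lemma exists_ball_bound {E : Type*} [NormedAddCommGroup E] [NormedSpace ℝ E] {v : ℝ → E} {t : ℝ}
    (hv : ContDiffAt ℝ 1 v t) :
    ∃ M, 0 ≤ M ∧ ∀ᶠ τ in nhds t, HasDerivAt v (deriv v τ) τ ∧ ‖v τ‖ ≤ M ∧ ‖deriv v τ‖ ≤ M := by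
  have hd : ContinuousAt (deriv v) t := by
    have := (hv.continuousAt_fderiv one_ne_zero).clm_apply (continuousAt_const (y := (1 : ℝ)))
    simpa using this
  refine ⟨max (‖v t‖ + 1) (‖deriv v t‖ + 1), by positivity, ?_⟩
  filter_upwards [hv.eventually (by simp),
    hv.continuousAt.norm.eventually_lt_const (lt_add_one _),
    hd.norm.eventually_lt_const (lt_add_one _)] with τ h1 h2 h3
  exact ⟨(h1.differentiableAt one_ne_zero).hasDerivAt, h2.le.trans (le_max_left _ _),
    h3.le.trans (le_max_right _ _)⟩

/-- The derivative of the free entropy of a finite mixture of Gaussians along a path of means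
(the vector I-MMSE relation). -/
theorem hasDerivAt_sum_integral_log_mixPartition (hw : ∀ k, 0 ≤ w k) (hw1 : ∑ k, w k = 1)
    {v : ℝ → K → ι → ℝ} {t : ℝ} (hv : ContDiffAt ℝ 1 v t) :
    HasDerivAt
      (fun τ => ∑ l, w l * ∫ y, log (mixPartition w (v τ) (v τ l + y)) ∂stdGaussianPi ι)
      (∑ l, w l * ∑ a, deriv v t l a *
        ∫ y, mixMean w (v t) (fun k => v t k a) (v t l + y) ∂stdGaussianPi ι) t := by
  simp_rw [fun τ => sum_integral_log_mixPartition hw hw1 (v τ)]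
  obtain ⟨M, hM, hev⟩ := exists_ball_bound hv
  have hnorm {u : K → ι → ℝ} (hu : ‖u‖ ≤ M) k a : |u k a| ≤ M :=
    ((norm_le_pi_norm (u k) a).trans (norm_le_pi_norm u k)).trans hu
  let F' (τ : ℝ) (y : ι → ℝ) : ℝ := ∑ l, w l * ∑ a, deriv v τ l a *
    ((y a - v τ l a) * (exp (shiftExponent (v τ l) y) * (log (mixPartition w (v τ) y) + 1)))
  have hcont τ := continuous_log_mixPartition hw hw1 (v τ)
  have hD : 0 ≤ Fintype.card ι * (M + M ^ 2) := by positivity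
  have key := hasDerivAt_integral_of_dominated_loc_of_deriv_le (μ := stdGaussianPi ι) (x₀ := t)
    (F := fun τ y => mixPartition w (v τ) y * log (mixPartition w (v τ) y)) (F' := F') hev
    (.of_forall fun τ => Continuous.aestronglyMeasurable (by fun_prop)) ?_
    (Continuous.aestronglyMeasurable (by fun_prop))
    (bound := fun y => exp (3 * (Fintype.card ι * (M + M ^ 2)) * (1 + ‖y‖)))
    (.of_forall fun y τ hτ => ?_)
    (integrable_exp_mul_norm_stdGaussianPi (by positivity)) (.of_forall fun y τ hτ => ?_)
  · refine key.2.congr_deriv ?_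
    have hint l a : Integrable (fun y => deriv v t l a * ((y a - v t l a) *
        (exp (shiftExponent (v t l) y) * (log (mixPartition w (v t) y) + 1))))
        (stdGaussianPi ι) := by
      simp_rw [sub_mul]
      exact ((integrable_coord_mul_exp_mul_log_add_one hw hw1 (v t) l a).sub
        ((integrable_exp_mul_log_add_one hw hw1 (v t) l).const_mul (v t l a))).const_mul _
    simp only [F']
    rw [integral_finsetSum _ fun l _ => (integrable_finsetSum _ fun a _ => hint l a).const_mul _]
    refine Finset.sum_congr rfl fun l _ => ?_
    rw [integral_const_mul, integral_finsetSum _ fun a _ => hint l a]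
    congr 1
    refine Finset.sum_congr rfl fun a _ => ?_
    rw [integral_const_mul, integral_sub_mul_exp_mul_log_add_one hw hw1]
  · refine (integrable_finsetSum Finset.univ fun l _ =>
      (integrable_exp_mul_log_mixPartition hw hw1 (v t) l).const_mul (w l)).congr
        (.of_forall fun y => ?_)
    simp only [mixPartition, Finset.sum_mul, mul_assoc]
  · obtain ⟨-, h2, h3⟩ := hτ
    rw [Real.norm_eq_abs]
    refine (Finset.abs_sum_le_sum_abs _ _).trans ?_
    simp_rw [abs_mul, abs_of_nonneg (hw _)]
    refine sum_mul_le_of_forall_le hw hw1 fun l => ?_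
    simp_rw [← mul_assoc (deriv v τ l _), ← Finset.sum_mul]
    rw [abs_mul, abs_mul, mul_assoc 3, show (3 : ℝ) * (Fintype.card ι * (M + M ^ 2) * (1 + ‖y‖)) =
      Fintype.card ι * (M + M ^ 2) * (1 + ‖y‖) + (Fintype.card ι * (M + M ^ 2) * (1 + ‖y‖)
        + Fintype.card ι * (M + M ^ 2) * (1 + ‖y‖)) by ring, Real.exp_add, Real.exp_add]
    gcongr
    · refine (abs_sum_le_of_forall_le hM fun a => ?_).trans
        ((lt_add_one _).le.trans (add_one_le_exp _))
      rw [abs_mul]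
      have hy : |y a| ≤ ‖y‖ := norm_le_pi_norm y a
      calc |deriv v τ l a| * |y a - v τ l a| ≤ M * (‖y‖ + M) := by
            gcongr
            · exact hnorm h3 l a
            · exact (abs_sub _ _).trans (add_le_add hy (hnorm h2 l a))
        _ = M * ‖y‖ + M ^ 2 := by ring
    · exact exp_shiftExponent_le hM (hnorm h2 l) y
    · exact abs_log_mixPartition_add_one_le hw hw1 hM (hnorm h2) y
  · have hE k : HasDerivAt (fun τ => shiftExponent (v τ k) y)
        (∑ a, deriv v τ k a * (y a - v τ k a)) τ := by
      refine HasDerivAt.fun_sum fun a _ => ?_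
      have h := hasDerivAt_pi.1 (hasDerivAt_pi.1 hτ.1 k) a
      refine ((h.mul_const (y a)).sub ((h.pow 2).div_const 2)).congr_deriv ?_
      simp
      ring
    have hZ : HasDerivAt (fun τ => mixPartition w (v τ) y) _ τ :=
      HasDerivAt.fun_sum (u := Finset.univ) fun k _ => (hE k).exp.const_mul (w k)
    have hZ0 := (mixPartition_pos hw hw1 (v τ) y).ne'
    refine (hZ.mul (hZ.log hZ0)).congr_deriv ?_
    rw [mul_div_cancel₀ _ hZ0, ← mul_add_one, Finset.sum_mul]
    refine Finset.sum_congr rfl fun l _ => ?_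
    simp_rw [← mul_assoc (deriv v τ l _), ← Finset.sum_mul]
    ring

end TiltedMixture

section FiniteSupport

variable {X Y : Type*} [MeasurableSpace X] [MeasurableSingletonClass X] [MeasurableSpace Y]

lemma measure_eq_sum_dirac_of_compl_null {μ : Measure X} {S : Finset X}
    (hS : μ (S : Set X)ᶜ = 0) :
    μ = Measure.sum fun k : S => μ {(k : X)} • Measure.dirac (k : X) := by
  have h : (S : Set X) = ⋃ x ∈ S, {x} := by ext; simp
  calc μ = μ.restrict S := (Measure.restrict_eq_self_of_ae_mem (mem_ae_iff.2 hS)).symm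
    _ = Measure.sum fun k : S => μ.restrict {(k : X)} := by
      rw [h]
      exact Measure.restrict_biUnion_finset (fun x _ y _ hxy => by simpa using hxy)
        fun x => measurableSet_singleton x
    _ = _ := by simp_rw [Measure.restrict_singleton]

lemma integral_prod_eq_sum_of_compl_null {μ : Measure X} [IsFiniteMeasure μ] {S : Finset X}
    (hS : μ (S : Set X)ᶜ = 0) {ν : Measure Y} [SFinite ν] {f : X × Y → ℝ}
    (hf : ∀ k : S, Integrable (fun y => f (k, y)) ν) :
    ∫ ω, f ω ∂(μ.prod ν) = ∑ k : S, μ.real {(k : X)} * ∫ y, f (k, y) ∂ν := by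
  have hemb (k : S) : MeasurableEmbedding (Prod.mk (k : X) : Y → X × Y) :=
    measurableEmbedding_prodMk_left _
  conv_lhs => rw [measure_eq_sum_dirac_of_compl_null hS]
  rw [Measure.prod_sum_left, Measure.sum_fintype, integral_finsetSum_measure]
  · refine Finset.sum_congr rfl fun k _ => ?_
    rw [Measure.prod_smul_left, Measure.dirac_prod, integral_smul_measure, (hemb k).integral_map]
    rfl
  · intro k _
    rw [Measure.prod_smul_left, Measure.dirac_prod]
    exact ((hemb k).integrable_map_iff.2 (hf k)).smul_measure (measure_ne_top _ _)

lemma integral_eq_sum_of_compl_null {μ : Measure X} [IsFiniteMeasure μ] {S : Finset X}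
    (hS : μ (S : Set X)ᶜ = 0) (f : X → ℝ) :
    ∫ x, f x ∂μ = ∑ k : S, μ.real {(k : X)} * f k := by
  conv_lhs => rw [measure_eq_sum_dirac_of_compl_null hS]
  rw [Measure.sum_fintype, integral_finsetSum_measure]
  · simp [integral_smul_measure, measureReal_def]
  · exact fun k _ => (integrable_dirac (by simp)).smul_measure (measure_ne_top _ _)

lemma pi_compl_piFinset_eq_zero {ι : Type*} [Fintype ι] [DecidableEq ι] {μ : Measure X}
    [SigmaFinite μ] {s : Finset X} (hs : μ (s : Set X)ᶜ = 0) :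
    Measure.pi (fun _ : ι => μ) (Fintype.piFinset fun _ : ι => s : Set (ι → X))ᶜ = 0 := by
  rw [← mem_ae_iff]
  have h (i : ι) : ∀ᵐ x ∂Measure.pi (fun _ : ι => μ), x i ∈ s :=
    (Measure.tendsto_eval_ae_ae (μ := fun _ : ι => μ) (i := i)).eventually (mem_ae_iff.2 hs)
  filter_upwards [ae_all_iff.2 h] with x hx
  simpa using hx

end FiniteSupport

section SumGaussian

variable {α β : Type*} [Fintype α] [Fintype β]

lemma measurePreserving_sumElim_stdGaussianPi :
    MeasurePreserving (fun ω : (α → ℝ) × (β → ℝ) => (Sum.elim ω.1 ω.2 : α ⊕ β → ℝ))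
      ((stdGaussianPi α).prod (stdGaussianPi β)) (stdGaussianPi (α ⊕ β)) := by
  convert! measurePreserving_sumPiEquivProdPi_symm fun _ : α ⊕ β => gaussianReal 0 1

lemma measurableEmbedding_sumElim :
    MeasurableEmbedding fun ω : (α → ℝ) × (β → ℝ) => (Sum.elim ω.1 ω.2 : α ⊕ β → ℝ) := by
  convert! (MeasurableEquiv.sumPiEquivProdPi fun _ : α ⊕ β => ℝ).symm.measurableEmbedding

lemma integral_sumElim_stdGaussianPi (f : (α ⊕ β → ℝ) → ℝ) :
    ∫ ω, f (Sum.elim ω.1 ω.2) ∂((stdGaussianPi α).prod (stdGaussianPi β))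
      = ∫ y, f y ∂stdGaussianPi (α ⊕ β) :=
  measurePreserving_sumElim_stdGaussianPi.integral_comp measurableEmbedding_sumElim f

lemma integrable_sumElim_stdGaussianPi {f : (α ⊕ β → ℝ) → ℝ}
    (hf : Integrable f (stdGaussianPi (α ⊕ β))) :
    Integrable (fun ω : (α → ℝ) × (β → ℝ) => f (Sum.elim ω.1 ω.2))
      ((stdGaussianPi α).prod (stdGaussianPi β)) :=
  measurePreserving_sumElim_stdGaussianPi.integrable_comp_of_integrable hf

end SumGaussian

section Interpolation

variable {n : ℕ}

/-- The noiseless observations: all the products `x_i x_j` and all the coordinates `x_i`. -/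
def feature (x : Fin n → ℝ) : SymIdx n ⊕ Fin n → ℝ :=
  Sum.elim (fun q => x q.1.1 * x q.1.2) x

/-- The signal amplitudes of the two interpolating observation channels. -/
def amplitude (Δ m : ℝ) (n : ℕ) (t : ℝ) : SymIdx n ⊕ Fin n → ℝ :=
  Sum.elim (fun _ => √(1 / (n * Δ)) * √t) (fun _ => √(m / Δ) * √(1 - t))

lemma Ham_eq_shiftExponent {Δ m : ℝ} (hΔ : 0 < Δ) (hm : 0 ≤ m) {t : ℝ}
    (ht : t ∈ Set.Ioo (0 : ℝ) 1) (xs : Fin n → ℝ) (ξ : SymIdx n → ℝ) (z x : Fin n → ℝ) :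
    Ham Δ m n t xs ξ z x = shiftExponent (amplitude Δ m n t * feature x)
      (amplitude Δ m n t * feature xs + Sum.elim ξ z) := by
  have ht0 : 0 ≤ t := ht.1.le
  have ht1 : 0 ≤ 1 - t := sub_nonneg.2 ht.2.le
  have hq : √(t / (n * Δ)) = √(1 / (n * Δ)) * √t := by
    rw [← Real.sqrt_mul (by positivity)]
    congr 1
    ring
  have hi : √(m * (1 - t) / Δ) = √(m / Δ) * √(1 - t) := by
    rw [← Real.sqrt_mul (by positivity)]
    congr 1
    ring
  have hq2 : (√(1 / (n * Δ)) * √t) ^ 2 = t / (n * Δ) := by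
    rw [← hq, Real.sq_sqrt (by positivity)]
  have hi2 : (√(m / Δ) * √(1 - t)) ^ 2 = m * (1 - t) / Δ := by
    rw [← hi, Real.sq_sqrt (by positivity)]
  have hmat : ∑ q : SymIdx n, (-(t * x q.1.1 ^ 2 * x q.1.2 ^ 2) / (2 * Δ * n)
        + t * x q.1.1 * x q.1.2 * xs q.1.1 * xs q.1.2 / (Δ * n)
        + √(t / (n * Δ)) * x q.1.1 * x q.1.2 * ξ q)
      = ∑ q : SymIdx n, ((√(1 / (n * Δ)) * √t * (x q.1.1 * x q.1.2))
          * (√(1 / (n * Δ)) * √t * (xs q.1.1 * xs q.1.2) + ξ q)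
        - (√(1 / (n * Δ)) * √t * (x q.1.1 * x q.1.2)) ^ 2 / 2) := by
    refine Finset.sum_congr rfl fun q _ => ?_
    rw [hq]
    generalize √(1 / (n * Δ)) * √t = c at hq2
    have : -(t * x q.1.1 ^ 2 * x q.1.2 ^ 2) / (2 * Δ * n)
        + t * x q.1.1 * x q.1.2 * xs q.1.1 * xs q.1.2 / (Δ * n)
        = t / (n * Δ) * (x q.1.1 * x q.1.2 * (xs q.1.1 * xs q.1.2)
          - (x q.1.1 * x q.1.2) ^ 2 / 2) := by
      ring
    rw [this, ← hq2]
    ring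
  have hvec : -((1 - t) * m * (∑ i, x i ^ 2) / (2 * Δ)) + (1 - t) * m * (∑ i, x i * xs i) / Δ
        + √(m * (1 - t) / Δ) * (∑ i, x i * z i)
      = ∑ i, ((√(m / Δ) * √(1 - t) * x i) * (√(m / Δ) * √(1 - t) * xs i + z i)
        - (√(m / Δ) * √(1 - t) * x i) ^ 2 / 2) := by
    rw [hi]
    generalize √(m / Δ) * √(1 - t) = c at hi2
    rw [Finset.mul_sum, Finset.mul_sum, Finset.mul_sum, Finset.sum_div, Finset.sum_div,
      ← Finset.sum_neg_distrib, ← Finset.sum_add_distrib, ← Finset.sum_add_distrib]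
    refine Finset.sum_congr rfl fun i _ => ?_
    have : -((1 - t) * m * x i ^ 2 / (2 * Δ)) + (1 - t) * m * (x i * xs i) / Δ
        = m * (1 - t) / Δ * (x i * xs i - x i ^ 2 / 2) := by
      ring
    rw [this, ← hi2]
    ring
  rw [Ham, shiftExponent, Fintype.sum_sum_type]
  simp only [Pi.mul_apply, Pi.add_apply, amplitude, feature, Sum.elim_inl, Sum.elim_inr]
  linear_combination hmat + hvec

lemma exists_hasDerivAt_amplitude {Δ m : ℝ} (hΔ : 0 < Δ) (hm : 0 ≤ m) {t : ℝ}
    (ht : t ∈ Set.Ioo (0 : ℝ) 1) :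
    ∃ d, HasDerivAt (amplitude Δ m n) d t ∧
      (∀ q, amplitude Δ m n t (Sum.inl q) * d (Sum.inl q) = 1 / (2 * n * Δ)) ∧
      ∀ i, amplitude Δ m n t (Sum.inr i) * d (Sum.inr i) = -(m / (2 * Δ)) := by
  have ht0 : √t ≠ 0 := (Real.sqrt_pos.2 ht.1).ne'
  have ht1 : √(1 - t) ≠ 0 := (Real.sqrt_pos.2 (sub_pos.2 ht.2)).ne'
  refine ⟨Sum.elim (fun _ => √(1 / (n * Δ)) * (1 / (2 * √t)))
    (fun _ => √(m / Δ) * (-1 / (2 * √(1 - t)))), hasDerivAt_pi.2 fun a => ?_, fun q => ?_,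
    fun i => ?_⟩
  · cases a with
    | inl q => exact (Real.hasDerivAt_sqrt ht.1.ne').const_mul _
    | inr i => exact (((hasDerivAt_id t).const_sub 1).sqrt (sub_pos.2 ht.2).ne').const_mul _
  · calc √(1 / (n * Δ)) * √t * (√(1 / (n * Δ)) * (1 / (2 * √t)))
        = √(1 / (n * Δ)) * √(1 / (n * Δ)) / 2 := by field_simp
      _ = 1 / (2 * n * Δ) := by
        rw [Real.mul_self_sqrt (by positivity)]
        ring
  · calc √(m / Δ) * √(1 - t) * (√(m / Δ) * (-1 / (2 * √(1 - t))))
        = -(√(m / Δ) * √(m / Δ) / 2) := by field_simp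
      _ = -(m / (2 * Δ)) := by
        rw [Real.mul_self_sqrt (by positivity)]
        ring

lemma contDiffAt_amplitude (Δ m : ℝ) {t : ℝ} (ht : t ∈ Set.Ioo (0 : ℝ) 1) :
    ContDiffAt ℝ 1 (amplitude Δ m n) t := by
  refine contDiffAt_pi.2 fun a => ?_
  cases a with
  | inl q => exact contDiffAt_const.mul (Real.contDiffAt_sqrt ht.1.ne')
  | inr i => exact contDiffAt_const.mul ((contDiffAt_const.sub contDiffAt_id).sqrt
      (sub_pos.2 ht.2).ne')

lemma mixMean_const_mul {ι K : Type*} [Fintype ι] [Fintype K] (w : K → ℝ) (v : K → ι → ℝ) (c : ℝ)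
    (f : K → ℝ) (y : ι → ℝ) : mixMean w v (fun k => c * f k) y = c * mixMean w v f y := by
  simp only [mixMean, ← mul_div_assoc, Finset.mul_sum]
  congr 1
  exact Finset.sum_congr rfl fun k _ => by ring

variable {p : Measure ℝ} [IsProbabilityMeasure p] {S : Finset (Fin n → ℝ)} {Δ m t : ℝ}

lemma Zt_eq_mixPartition (hS : Measure.pi (fun _ : Fin n => p) (S : Set (Fin n → ℝ))ᶜ = 0)
    (hΔ : 0 < Δ) (hm : 0 ≤ m) (ht : t ∈ Set.Ioo (0 : ℝ) 1) (xs : Fin n → ℝ) (ξ : SymIdx n → ℝ)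
    (z : Fin n → ℝ) :
    Zt p Δ m n t xs ξ z =
      mixPartition (fun k : S => (Measure.pi fun _ : Fin n => p).real {(k : Fin n → ℝ)})
        (fun k => amplitude Δ m n t * feature k)
        (amplitude Δ m n t * feature xs + Sum.elim ξ z) := by
  simp_rw [Zt, integral_eq_sum_of_compl_null hS, Ham_eq_shiftExponent hΔ hm ht]
  rfl

lemma gibbs_eq_mixMean (hS : Measure.pi (fun _ : Fin n => p) (S : Set (Fin n → ℝ))ᶜ = 0)
    (hΔ : 0 < Δ) (hm : 0 ≤ m) (ht : t ∈ Set.Ioo (0 : ℝ) 1) (xs : Fin n → ℝ) (ξ : SymIdx n → ℝ)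
    (z : Fin n → ℝ) (f : (Fin n → ℝ) → ℝ) :
    gibbs p Δ m n t xs ξ z f =
      mixMean (fun k : S => (Measure.pi fun _ : Fin n => p).real {(k : Fin n → ℝ)})
        (fun k => amplitude Δ m n t * feature k) (fun k => f k)
        (amplitude Δ m n t * feature xs + Sum.elim ξ z) := by
  simp_rw [gibbs, Zt_eq_mixPartition hS hΔ hm ht, integral_eq_sum_of_compl_null hS,
    Ham_eq_shiftExponent hΔ hm ht, ← mul_assoc]
  rfl

lemma integral_baseP_eq_sum (hS : Measure.pi (fun _ : Fin n => p) (S : Set (Fin n → ℝ))ᶜ = 0)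
    {F : (Fin n → ℝ) → (SymIdx n ⊕ Fin n → ℝ) → ℝ}
    (hF : ∀ l : S, Integrable (F l) (stdGaussianPi (SymIdx n ⊕ Fin n))) :
    ∫ ω, F ω.1 (Sum.elim ω.2.1 ω.2.2) ∂(baseP p n) =
      ∑ l : S, (Measure.pi fun _ : Fin n => p).real {(l : Fin n → ℝ)} *
        ∫ y, F l y ∂stdGaussianPi (SymIdx n ⊕ Fin n) := by
  rw [baseP, integral_prod_eq_sum_of_compl_null hS fun l =>
    integrable_sumElim_stdGaussianPi (hF l)]
  exact Finset.sum_congr rfl fun l _ => congrArg _ (integral_sumElim_stdGaussianPi (F l))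

lemma Favg_eq_sum (hS : Measure.pi (fun _ : Fin n => p) (S : Set (Fin n → ℝ))ᶜ = 0)
    (hΔ : 0 < Δ) (hm : 0 ≤ m) (ht : t ∈ Set.Ioo (0 : ℝ) 1)
    {w : S → ℝ} (hw : ∀ k : S, (Measure.pi fun _ : Fin n => p).real {(k : Fin n → ℝ)} = w k)
    (hw1 : ∑ k, w k = 1) :
    Favg p Δ m n t = ∑ l, w l * ∫ y, log (mixPartition w (fun k => amplitude Δ m n t * feature k)
      (amplitude Δ m n t * feature l + y)) ∂stdGaussianPi (SymIdx n ⊕ Fin n) := by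
  have hw0 k : 0 ≤ w k := by simp [← hw]
  simp_rw [Favg, Zt_eq_mixPartition hS hΔ hm ht, hw]
  have hint (l : S) : Integrable (fun y => log (mixPartition w
      (fun k : S => amplitude Δ m n t * feature (k : Fin n → ℝ))
      (amplitude Δ m n t * feature (l : Fin n → ℝ) + y))) (stdGaussianPi (SymIdx n ⊕ Fin n)) :=
    integrable_add_left_stdGaussianPi _ (integrable_exp_mul_log_mixPartition hw0 hw1 _ l)
  have h := integral_baseP_eq_sum hS (F := fun xs y => log (mixPartition w
    (fun k : S => amplitude Δ m n t * feature (k : Fin n → ℝ))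
    (amplitude Δ m n t * feature xs + y))) hint
  simp_rw [hw] at h
  exact h

lemma integral_gibbs_mul_eq_sum
    (hS : Measure.pi (fun _ : Fin n => p) (S : Set (Fin n → ℝ))ᶜ = 0)
    (hΔ : 0 < Δ) (hm : 0 ≤ m) (ht : t ∈ Set.Ioo (0 : ℝ) 1)
    {w : S → ℝ} (hw : ∀ k : S, (Measure.pi fun _ : Fin n => p).real {(k : Fin n → ℝ)} = w k)
    (hw1 : ∑ k, w k = 1) (f g : (Fin n → ℝ) → ℝ) :
    ∫ ω, gibbs p Δ m n t ω.1 ω.2.1 ω.2.2 f * g ω.1 ∂(baseP p n)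
      = ∑ l, w l * (g l * ∫ y, mixMean w (fun k => amplitude Δ m n t * feature k) (fun k => f k)
        (amplitude Δ m n t * feature l + y) ∂stdGaussianPi (SymIdx n ⊕ Fin n)) := by
  have hw0 k : 0 ≤ w k := by simp [← hw]
  simp_rw [gibbs_eq_mixMean hS hΔ hm ht, hw]
  have hint (l : S) : Integrable (fun y => mixMean w
      (fun k : S => amplitude Δ m n t * feature (k : Fin n → ℝ)) (fun k => f k)
      (amplitude Δ m n t * feature (l : Fin n → ℝ) + y) * g l)
      (stdGaussianPi (SymIdx n ⊕ Fin n)) :=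
    (integrable_add_left_stdGaussianPi _
      (integrable_exp_mul_mixMean hw0 hw1 _ l fun k => f k)).mul_const _
  have h := integral_baseP_eq_sum hS (F := fun xs y => mixMean w
    (fun k : S => amplitude Δ m n t * feature (k : Fin n → ℝ)) (fun k => f k)
    (amplitude Δ m n t * feature xs + y) * g xs) hint
  simp_rw [hw, integral_mul_const, mul_comm _ (g _)] at h
  simp_rw [mul_comm _ (g _)]
  exact h

end Interpolation

/-- **Exact derivative identity** : for `t ∈ (0,1)`,
`(1/n)(d/dt)E[log Z_t] = (1/(2Δn²)) Σ_{i≤j} E[⟨x_i x_j⟩_t x*_i x*_j]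
  − (m/(2Δn)) Σ_i E[⟨x_i⟩_t x*_i]`. -/
theorem deriv_avg_logZ_overlap_form
    (p : Measure ℝ) [IsProbabilityMeasure p]
    (hsupp : ∃ s : Finset ℝ, p (↑s : Set ℝ)ᶜ = 0)
    (Δ : ℝ) (hΔ : 0 < Δ) (m : ℝ) (hm : 0 ≤ m)
    (n : ℕ) (hn : 1 ≤ n) (t : ℝ) (ht : t ∈ Set.Ioo (0 : ℝ) 1) :
    DifferentiableAt ℝ (Favg p Δ m n) t ∧
      (1 / n) * deriv (Favg p Δ m n) t
        = (1 / (2 * Δ * n ^ 2))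
            * ∑ q : SymIdx n,
                ∫ ω, gibbs p Δ m n t ω.1 ω.2.1 ω.2.2 (fun x => x q.1.1 * x q.1.2)
                      * ω.1 q.1.1 * ω.1 q.1.2 ∂(baseP p n)
          - (m / (2 * Δ * n))
            * ∑ i : Fin n,
                ∫ ω, gibbs p Δ m n t ω.1 ω.2.1 ω.2.2 (fun x => x i) * ω.1 i
                  ∂(baseP p n) := by
  obtain ⟨s, hs⟩ := hsupp
  have hS := pi_compl_piFinset_eq_zero (ι := Fin n) hs
  set S := Fintype.piFinset fun _ : Fin n => s
  obtain ⟨w, hw⟩ : ∃ w : S → ℝ,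
      ∀ k : S, (Measure.pi fun _ : Fin n => p).real {(k : Fin n → ℝ)} = w k := ⟨_, fun _ => rfl⟩
  have hw0 k : 0 ≤ w k := by simp [← hw]
  have hw1 : ∑ k, w k = 1 := by
    simpa [hw] using (integral_eq_sum_of_compl_null hS fun _ => 1).symm
  obtain ⟨d, hd, hdq, hdi⟩ := exists_hasDerivAt_amplitude (n := n) hΔ hm ht
  let v (τ : ℝ) (k : S) : SymIdx n ⊕ Fin n → ℝ := amplitude Δ m n τ * feature k
  have hv : ContDiffAt ℝ 1 v t :=
    contDiffAt_pi.2 fun k => (contDiffAt_amplitude Δ m ht).mul contDiffAt_const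
  have hv' : HasDerivAt v (fun k => d * feature k) t :=
    hasDerivAt_pi.2 fun k => hd.mul_const (feature (k : Fin n → ℝ))
  have hF : HasDerivAt (Favg p Δ m n) _ t :=
    (hasDerivAt_sum_integral_log_mixPartition hw0 hw1 hv).congr_of_eventuallyEq <| by
      filter_upwards [isOpen_Ioo.mem_nhds ht] with τ hτ
      exact Favg_eq_sum hS hΔ hm hτ hw hw1
  refine ⟨hF.differentiableAt, ?_⟩
  let overlap (a : SymIdx n ⊕ Fin n) : ℝ := ∑ l : S, w l * (feature (l : Fin n → ℝ) a *
    ∫ y, mixMean w (v t) (fun k => feature k a) (v t l + y) ∂stdGaussianPi (SymIdx n ⊕ Fin n))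
  have hq (q : SymIdx n) : ∫ ω, gibbs p Δ m n t ω.1 ω.2.1 ω.2.2 (fun x => x q.1.1 * x q.1.2)
      * ω.1 q.1.1 * ω.1 q.1.2 ∂(baseP p n) = overlap (Sum.inl q) := by
    simp_rw [mul_assoc (gibbs _ _ _ _ _ _ _ _ _)]
    exact integral_gibbs_mul_eq_sum hS hΔ hm ht hw hw1 _ fun x => x q.1.1 * x q.1.2
  have hi (i : Fin n) : ∫ ω, gibbs p Δ m n t ω.1 ω.2.1 ω.2.2 (fun x => x i) * ω.1 i
      ∂(baseP p n) = overlap (Sum.inr i) :=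
    integral_gibbs_mul_eq_sum hS hΔ hm ht hw hw1 _ fun x => x i
  have hmean (l : S) a : ∫ y, mixMean w (v t) (fun k => v t k a) (v t l + y)
        ∂stdGaussianPi (SymIdx n ⊕ Fin n)
      = amplitude Δ m n t a * ∫ y, mixMean w (v t) (fun k => feature k a) (v t l + y)
        ∂stdGaussianPi (SymIdx n ⊕ Fin n) := by
    rw [← integral_const_mul]
    simp_rw [← mixMean_const_mul]
    rfl
  have hderiv : deriv (Favg p Δ m n) t = ∑ a, amplitude Δ m n t a * d a * overlap a := by
    rw [hF.deriv, hv'.deriv]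
    simp_rw [hmean, overlap, Finset.mul_sum]
    rw [Finset.sum_comm]
    refine Finset.sum_congr rfl fun a _ => Finset.sum_congr rfl fun l _ => ?_
    rw [Pi.mul_apply]
    ring
  simp_rw [hq, hi, hderiv, Fintype.sum_sum_type, hdq, hdi, ← Finset.mul_sum]
  have hn0 : (n : ℝ) ≠ 0 := Nat.cast_ne_zero.2 (Nat.one_le_iff_ne_zero.1 hn)
  field_simp
  ring
end
end

section
/- limsup_{n→∞} (1/n)·E[log Z̃_0] ≤ sup_{m∈ℝ} Ḡ(m). -/
open MeasureTheory ProbabilityTheory Filter Real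

noncomputable section

/-- `J(A,B) = log ∫ exp(Bx - A x²/2) p(dx)`. -/
def Jf (p : Measure ℝ) (A B : ℝ) : ℝ := Real.log (∫ x, Real.exp (B * x - A * x ^ 2 / 2) ∂p)

/-- The partition function `Z̃₀` of the ad-hoc model. -/
def Zadhoc (p : Measure ℝ) (Δ mhat : ℝ) (n : ℕ) (xs z : Fin n → ℝ) : ℝ :=
  ∫ x : Fin n → ℝ,
    Real.exp ((1 / (n * Δ)) * ∑ q : SymIdx n, x q.1.1 * x q.1.2 * xs q.1.1 * xs q.1.2
        - mhat * (∑ i, x i ^ 2) / (2 * Δ)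
        + Real.sqrt (mhat / Δ) * (∑ i, x i * z i))
    ∂(Measure.pi fun _ : Fin n => p)

/-- The averaged log-partition function of the ad-hoc model. -/
def adhocAvg (p : Measure ℝ) (Δ mhat : ℝ) (n : ℕ) : ℝ :=
  ∫ ω : (Fin n → ℝ) × (Fin n → ℝ), Real.log (Zadhoc p Δ mhat n ω.1 ω.2)
    ∂((Measure.pi fun _ : Fin n => p).prod
        (Measure.pi fun _ : Fin n => gaussianReal 0 1))

/-- The limiting functional `Ḡ(m) = −m²/(2Δ) + E[J(m̂/Δ, mX/Δ + √(m̂/Δ) Z)]`. -/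
def Gbar (p : Measure ℝ) (Δ mhat : ℝ) (m : ℝ) : ℝ :=
  -(m ^ 2) / (2 * Δ)
    + ∫ w : ℝ × ℝ, Jf p (mhat / Δ) (m * w.1 / Δ + Real.sqrt (mhat / Δ) * w.2)
        ∂(p.prod (gaussianReal 0 1))

lemma sum_symIdx (n : ℕ) (a : Fin n → ℝ) :
    ∑ q : SymIdx n, a q.1.1 * a q.1.2 = ((∑ i, a i) ^ 2 + ∑ i, a i ^ 2) / 2 := by
  have h1 : ∑ q : SymIdx n, a q.1.1 * a q.1.2
      = ∑ i, ∑ j, if i ≤ j then a i * a j else 0 := by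
    rw [← Fintype.sum_prod_type' (f := fun i j => if i ≤ j then a i * a j else 0),
      ← Finset.sum_filter]
    exact (Finset.sum_subtype _ (by simp) fun q : Fin n × Fin n => a q.1 * a q.2).symm
  have h2 : ∑ i, ∑ j, (if i ≤ j then a i * a j else 0)
      = ∑ i, ∑ j, if j ≤ i then a i * a j else 0 := by
    rw [Finset.sum_comm]
    simp_rw [mul_comm]
  have h3 : (∑ i, a i) ^ 2 + ∑ i, a i ^ 2
      = (∑ i, ∑ j, if i ≤ j then a i * a j else 0)
        + ∑ i, ∑ j, if j ≤ i then a i * a j else 0 := by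
    have hd : ∑ i, a i ^ 2 = ∑ i, ∑ j, if i = j then a i * a j else 0 := by
      simp [sq]
    rw [hd, sq, Finset.sum_mul_sum]
    simp only [← Finset.sum_add_distrib]
    refine Finset.sum_congr rfl fun i _ => Finset.sum_congr rfl fun j _ => ?_
    rcases lt_trichotomy i j with h | h | h
    · simp [h.le, h.ne, h.not_ge]
    · simp [h]
    · simp [h.le, h.ne', h.not_ge]
  rw [h1, h3, ← h2]
  ring

/-- A probability measure with finite support is concentrated on a bounded interval. -/
lemma exists_ae_abs_le {p : Measure ℝ} (hsupp : ∃ s : Finset ℝ, p (↑s : Set ℝ)ᶜ = 0) :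
    ∃ K : ℝ, 0 ≤ K ∧ ∀ᵐ x ∂p, |x| ≤ K := by
  obtain ⟨s, hs⟩ := hsupp
  refine ⟨∑ x ∈ s, |x|, Finset.sum_nonneg fun _ _ => abs_nonneg _, ?_⟩
  filter_upwards [mem_ae_iff.mpr hs] with x hx
  exact Finset.single_le_sum (f := fun x => |x|) (fun _ _ => abs_nonneg _) hx

lemma ae_pi_abs_le {p : Measure ℝ} [IsProbabilityMeasure p] {K : ℝ}
    (hK : ∀ᵐ x ∂p, |x| ≤ K) (n : ℕ) :
    ∀ᵐ x ∂(Measure.pi fun _ : Fin n => p), ∀ i, |x i| ≤ K := by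
  rw [ae_all_iff]
  intro i
  exact (measurePreserving_eval (fun _ : Fin n => p) i).quasiMeasurePreserving.ae hK

lemma exponent_abs_le {K A : ℝ} (hA : 0 ≤ A) (B : ℝ) {x : ℝ}
    (hx : |x| ≤ K) : |B * x - A * x ^ 2 / 2| ≤ |B| * K + A * K ^ 2 / 2 := by
  have h1 : |B * x| ≤ |B| * K := by
    rw [abs_mul]; gcongr
  have h2 : x ^ 2 ≤ K ^ 2 := sq_le_sq' (abs_le.mp hx).1 (abs_le.mp hx).2
  have h3 : |A * x ^ 2 / 2| ≤ A * K ^ 2 / 2 := by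
    rw [abs_of_nonneg (by positivity)]
    gcongr
  exact (abs_sub _ _).trans (add_le_add h1 h3)

lemma integrable_exp_of_ae_le {α : Type*} [MeasurableSpace α] {μ : Measure α} [IsFiniteMeasure μ]
    {f : α → ℝ} {c : ℝ} (hf : Measurable f) (h : ∀ᵐ x ∂μ, f x ≤ c) :
    Integrable (fun x => Real.exp (f x)) μ := by
  refine Integrable.of_bound hf.exp.aestronglyMeasurable (Real.exp c) ?_
  filter_upwards [h] with x hx
  rw [Real.norm_eq_abs, Real.abs_exp]
  exact Real.exp_le_exp.mpr hx

lemma abs_log_integral_exp_le {α : Type*} [MeasurableSpace α] {μ : Measure α}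
    [IsProbabilityMeasure μ] {f : α → ℝ} {c : ℝ} (hf : Measurable f)
    (h : ∀ᵐ x ∂μ, |f x| ≤ c) : |Real.log (∫ x, Real.exp (f x) ∂μ)| ≤ c := by
  have hi := integrable_exp_of_ae_le hf (h.mono fun x hx => (abs_le.mp hx).2)
  have hlo : Real.exp (-c) ≤ ∫ x, Real.exp (f x) ∂μ := by
    simpa using integral_mono_ae (integrable_const (Real.exp (-c))) hi
      (h.mono fun x hx => Real.exp_le_exp.mpr (abs_le.mp hx).1)
  have hup : ∫ x, Real.exp (f x) ∂μ ≤ Real.exp c := by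
    simpa using integral_mono_ae hi (integrable_const (Real.exp c))
      (h.mono fun x hx => Real.exp_le_exp.mpr (abs_le.mp hx).2)
  have hpos := (Real.exp_pos _).trans_le hlo
  exact abs_le.mpr ⟨(Real.le_log_iff_exp_le hpos).mpr hlo, (Real.log_le_iff_le_exp hpos).mpr hup⟩

lemma abs_integral_le_of_ae_abs_le {α : Type*} [MeasurableSpace α] {μ : Measure α} {f g : α → ℝ}
    (hg : Integrable g μ) (h : ∀ᵐ x ∂μ, |f x| ≤ g x) : |∫ x, f x ∂μ| ≤ ∫ x, g x ∂μ :=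
  by simpa only [Real.norm_eq_abs] using
    norm_integral_le_of_norm_le (f := f) hg (by simpa only [Real.norm_eq_abs] using h)

lemma measurable_log_integral_exp {α β : Type*} [MeasurableSpace α] [MeasurableSpace β]
    {μ : Measure β} [SFinite μ] {f : α → β → ℝ} (hf : Measurable (Function.uncurry f)) :
    Measurable fun a => Real.log (∫ b, Real.exp (f a b) ∂μ) :=
  (StronglyMeasurable.integral_prod_right (f := fun a b => Real.exp (f a b))
    hf.exp.stronglyMeasurable).measurable.log

lemma measurable_Jf (p : Measure ℝ) [IsProbabilityMeasure p] (A : ℝ) : Measurable (Jf p A) :=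
  measurable_log_integral_exp (f := fun B x => B * x - A * x ^ 2 / 2)
    (by unfold Function.uncurry; fun_prop)

lemma abs_Jf_le {p : Measure ℝ} [IsProbabilityMeasure p] {K A : ℝ}
    (hK : ∀ᵐ x ∂p, |x| ≤ K) (hA : 0 ≤ A) (B : ℝ) : |Jf p A B| ≤ |B| * K + A * K ^ 2 / 2 :=
  abs_log_integral_exp_le (by fun_prop) (hK.mono fun _ hx => exponent_abs_le hA B hx)

lemma exp_Jf {p : Measure ℝ} [IsProbabilityMeasure p] {K A : ℝ}
    (hK : ∀ᵐ x ∂p, |x| ≤ K) (hA : 0 ≤ A) (B : ℝ) :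
    Real.exp (Jf p A B) = ∫ x, Real.exp (B * x - A * x ^ 2 / 2) ∂p := by
  refine Real.exp_log (integral_exp_pos (integrable_exp_of_ae_le (by fun_prop)
    (hK.mono fun _ hx => (abs_le.mp (exponent_abs_le hA B hx)).2)))

/-- The single-site free energy whose mean is `Gbar`. -/
def siteEnergy (p : Measure ℝ) (Δ mhat m : ℝ) (w : ℝ × ℝ) : ℝ :=
  -(m ^ 2) / (2 * Δ) + Jf p (mhat / Δ) (m * w.1 / Δ + Real.sqrt (mhat / Δ) * w.2)

lemma measurable_siteEnergy (p : Measure ℝ) [IsProbabilityMeasure p] (Δ mhat m : ℝ) :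
    Measurable (siteEnergy p Δ mhat m) :=
  ((measurable_Jf p _).comp (by fun_prop)).const_add _

lemma integrable_abs_snd (p : Measure ℝ) [IsProbabilityMeasure p] :
    Integrable (fun w : ℝ × ℝ => |w.2|) (p.prod (gaussianReal 0 1)) := by
  have h : MemLp (id : ℝ → ℝ) 1 (gaussianReal 0 1) := memLp_id_gaussianReal' 1 (by simp)
  exact (memLp_one_iff_integrable.mp h).abs.comp_snd p

lemma abs_Jf_comp_le {p : Measure ℝ} [IsProbabilityMeasure p] {K Δ mhat : ℝ}
    (hK0 : 0 ≤ K) (hK : ∀ᵐ x ∂p, |x| ≤ K) (hΔ : 0 < Δ) (hmhat : 0 ≤ mhat) (m : ℝ) :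
    ∀ᵐ w ∂(p.prod (gaussianReal 0 1)),
      |Jf p (mhat / Δ) (m * w.1 / Δ + Real.sqrt (mhat / Δ) * w.2)|
        ≤ (|m| * K ^ 2 / Δ + mhat / Δ * K ^ 2 / 2) + Real.sqrt (mhat / Δ) * K * |w.2| := by
  filter_upwards [Measure.quasiMeasurePreserving_fst.ae hK] with w hw
  refine (abs_Jf_le hK (by positivity) _).trans ?_
  have h1 : |m * w.1 / Δ + Real.sqrt (mhat / Δ) * w.2|
      ≤ |m| * K / Δ + Real.sqrt (mhat / Δ) * |w.2| := by
    refine (abs_add_le _ _).trans ?_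
    rw [abs_div, abs_mul, abs_mul, abs_of_pos hΔ, abs_of_nonneg (Real.sqrt_nonneg _)]
    gcongr
  calc _ ≤ (|m| * K / Δ + Real.sqrt (mhat / Δ) * |w.2|) * K + mhat / Δ * K ^ 2 / 2 := by gcongr
    _ = _ := by ring

lemma memLp_Jf_comp {p : Measure ℝ} [IsProbabilityMeasure p] {K Δ mhat : ℝ}
    (hK0 : 0 ≤ K) (hK : ∀ᵐ x ∂p, |x| ≤ K) (hΔ : 0 < Δ) (hmhat : 0 ≤ mhat) (m : ℝ) :
    MemLp (fun w : ℝ × ℝ => Jf p (mhat / Δ) (m * w.1 / Δ + Real.sqrt (mhat / Δ) * w.2)) 2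
      (p.prod (gaussianReal 0 1)) := by
  have h : MemLp (id : ℝ → ℝ) 2 (gaussianReal 0 1) := memLp_id_gaussianReal' 2 (by simp)
  have h2 : MemLp (fun w : ℝ × ℝ => |w.2|) 2 (p.prod (gaussianReal 0 1)) := h.abs.comp_snd p
  have h3 : MemLp (fun w : ℝ × ℝ => (|m| * K ^ 2 / Δ + mhat / Δ * K ^ 2 / 2)
      + Real.sqrt (mhat / Δ) * K * |w.2|) 2 (p.prod (gaussianReal 0 1)) :=
    MemLp.add (f := fun _ => |m| * K ^ 2 / Δ + mhat / Δ * K ^ 2 / 2) (memLp_const _)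
      (h2.const_mul _)
  have hmeas : Measurable fun w : ℝ × ℝ =>
      Jf p (mhat / Δ) (m * w.1 / Δ + Real.sqrt (mhat / Δ) * w.2) :=
    (measurable_Jf p _).comp (by fun_prop)
  refine h3.mono' hmeas.aestronglyMeasurable ?_
  simpa only [Real.norm_eq_abs] using abs_Jf_comp_le hK0 hK hΔ hmhat m

lemma memLp_siteEnergy {p : Measure ℝ} [IsProbabilityMeasure p] {K Δ mhat : ℝ}
    (hK0 : 0 ≤ K) (hK : ∀ᵐ x ∂p, |x| ≤ K) (hΔ : 0 < Δ) (hmhat : 0 ≤ mhat) (m : ℝ) :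
    MemLp (siteEnergy p Δ mhat m) 2 (p.prod (gaussianReal 0 1)) :=
  MemLp.add (f := fun _ => -(m ^ 2) / (2 * Δ)) (memLp_const _) (memLp_Jf_comp hK0 hK hΔ hmhat m)

lemma integral_siteEnergy {p : Measure ℝ} [IsProbabilityMeasure p] {K Δ mhat : ℝ}
    (hK0 : 0 ≤ K) (hK : ∀ᵐ x ∂p, |x| ≤ K) (hΔ : 0 < Δ) (hmhat : 0 ≤ mhat) (m : ℝ) :
    ∫ w, siteEnergy p Δ mhat m w ∂(p.prod (gaussianReal 0 1)) = Gbar p Δ mhat m := by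
  unfold siteEnergy Gbar
  rw [integral_add (integrable_const _)
    ((memLp_Jf_comp hK0 hK hΔ hmhat m).integrable one_le_two)]
  simp

lemma bddAbove_range_Gbar {p : Measure ℝ} [IsProbabilityMeasure p] {K Δ mhat : ℝ}
    (hK0 : 0 ≤ K) (hK : ∀ᵐ x ∂p, |x| ≤ K) (hΔ : 0 < Δ) (hmhat : 0 ≤ mhat) :
    BddAbove (Set.range (Gbar p Δ mhat)) := by
  set E := ∫ w : ℝ × ℝ, |w.2| ∂(p.prod (gaussianReal 0 1))
  refine ⟨K ^ 4 / (2 * Δ) + mhat / Δ * K ^ 2 / 2 + Real.sqrt (mhat / Δ) * K * E, ?_⟩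
  rintro _ ⟨m, rfl⟩
  have h1 : ∫ w : ℝ × ℝ, Jf p (mhat / Δ) (m * w.1 / Δ + Real.sqrt (mhat / Δ) * w.2)
        ∂(p.prod (gaussianReal 0 1))
      ≤ (|m| * K ^ 2 / Δ + mhat / Δ * K ^ 2 / 2) + Real.sqrt (mhat / Δ) * K * E := by
    have hb : Integrable (fun w : ℝ × ℝ => (|m| * K ^ 2 / Δ + mhat / Δ * K ^ 2 / 2)
        + Real.sqrt (mhat / Δ) * K * |w.2|) (p.prod (gaussianReal 0 1)) :=
      (integrable_const _).add ((integrable_abs_snd p).const_mul _)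
    have h2 := abs_integral_le_of_ae_abs_le hb (abs_Jf_comp_le hK0 hK hΔ hmhat m)
    refine (le_abs_self _).trans (h2.trans_eq ?_)
    rw [integral_add (integrable_const _) ((integrable_abs_snd p).const_mul _),
      integral_const_mul]
    simp [E]
  have h3 : -(m ^ 2) / (2 * Δ) + |m| * K ^ 2 / Δ ≤ K ^ 4 / (2 * Δ) := by
    rw [← sq_abs m, ← sub_nonneg]
    have : K ^ 4 / (2 * Δ) - (-(|m| ^ 2) / (2 * Δ) + |m| * K ^ 2 / Δ)
      = (K ^ 2 - |m|) ^ 2 / (2 * Δ) := by field_simp; ring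
    rw [this]; positivity
  unfold Gbar
  linarith

lemma measurable_exponent (Δ mhat : ℝ) (n : ℕ) :
    Measurable (Function.uncurry fun (ω : (Fin n → ℝ) × (Fin n → ℝ)) (x : Fin n → ℝ) =>
      (1 / (n * Δ)) * ∑ q : SymIdx n, x q.1.1 * x q.1.2 * ω.1 q.1.1 * ω.1 q.1.2
        - mhat * (∑ i, x i ^ 2) / (2 * Δ)
        + Real.sqrt (mhat / Δ) * (∑ i, x i * ω.2 i)) := by
  unfold Function.uncurry
  fun_prop

lemma measurable_log_Zadhoc (p : Measure ℝ) [IsProbabilityMeasure p] (Δ mhat : ℝ) (n : ℕ) :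
    Measurable fun ω : (Fin n → ℝ) × (Fin n → ℝ) => Real.log (Zadhoc p Δ mhat n ω.1 ω.2) :=
  measurable_log_integral_exp (measurable_exponent Δ mhat n)

lemma sum_symIdx_interaction (n : ℕ) (x xs : Fin n → ℝ) :
    ∑ q : SymIdx n, x q.1.1 * x q.1.2 * xs q.1.1 * xs q.1.2
      = ((∑ i, x i * xs i) ^ 2 + ∑ i, (x i * xs i) ^ 2) / 2 := by
  rw [← sum_symIdx n fun i => x i * xs i]
  exact Finset.sum_congr rfl fun q _ => by ring

lemma abs_sum_le_card_mul {n : ℕ} {f : Fin n → ℝ} {c : ℝ} (h : ∀ i, |f i| ≤ c) :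
    |∑ i, f i| ≤ n * c := by
  simpa using (Finset.abs_sum_le_sum_abs f Finset.univ).trans
    (Finset.sum_le_card_nsmul _ _ c fun i _ => h i)

lemma abs_mul_le_sq {K x y : ℝ} (hx : |x| ≤ K) (hy : |y| ≤ K) : |x * y| ≤ K ^ 2 := by
  rw [abs_mul, sq]
  exact mul_le_mul hx hy (abs_nonneg _) ((abs_nonneg _).trans hx)

lemma sum_sq_overlap_le {K : ℝ} {n : ℕ} {x xs : Fin n → ℝ}
    (hx : ∀ i, |x i| ≤ K) (hxs : ∀ i, |xs i| ≤ K) : ∑ i, (x i * xs i) ^ 2 ≤ n * K ^ 4 := by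
  refine (le_abs_self _).trans (abs_sum_le_card_mul fun i => ?_)
  rw [abs_pow, show K ^ 4 = (K ^ 2) ^ 2 by ring]
  exact pow_le_pow_left₀ (abs_nonneg _) (abs_mul_le_sq (hx i) (hxs i)) 2

lemma abs_interaction_le {K Δ : ℝ} (hΔ : 0 < Δ) {n : ℕ} {x xs : Fin n → ℝ}
    (hx : ∀ i, |x i| ≤ K) (hxs : ∀ i, |xs i| ≤ K) :
    |(1 / (n * Δ)) * ∑ q : SymIdx n, x q.1.1 * x q.1.2 * xs q.1.1 * xs q.1.2|
      ≤ n * (K ^ 4 / Δ) := by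
  rcases Nat.eq_zero_or_pos n with rfl | hn
  · simp
  have hn1 : (1 : ℝ) ≤ n := by exact_mod_cast hn
  have hS : (∑ i, x i * xs i) ^ 2 ≤ (n * K ^ 2) ^ 2 := by
    rw [← sq_abs]
    exact pow_le_pow_left₀ (abs_nonneg _)
      (abs_sum_le_card_mul fun i => abs_mul_le_sq (hx i) (hxs i)) 2
  have hT := sum_sq_overlap_le hx hxs
  have hT0 : 0 ≤ ∑ i, (x i * xs i) ^ 2 := Finset.sum_nonneg fun _ _ => sq_nonneg _
  have hn2 : (n : ℝ) * K ^ 4 ≤ n * (n * K ^ 4) :=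
    mul_le_mul_of_nonneg_left (le_mul_of_one_le_left (by positivity) hn1) (by positivity)
  rw [sum_symIdx_interaction, abs_of_nonneg (by positivity)]
  calc _ ≤ 1 / (n * Δ) * (n * (n * K ^ 4)) := by
        gcongr
        nlinarith
    _ = n * (K ^ 4 / Δ) := by field_simp

lemma abs_exponent_Zadhoc_le {K Δ mhat : ℝ} (hΔ : 0 < Δ) (hmhat : 0 ≤ mhat) {n : ℕ}
    {x xs : Fin n → ℝ} (hx : ∀ i, |x i| ≤ K) (hxs : ∀ i, |xs i| ≤ K) (z : Fin n → ℝ) :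
    |(1 / (n * Δ)) * ∑ q : SymIdx n, x q.1.1 * x q.1.2 * xs q.1.1 * xs q.1.2
        - mhat * (∑ i, x i ^ 2) / (2 * Δ) + Real.sqrt (mhat / Δ) * (∑ i, x i * z i)|
      ≤ n * (K ^ 4 / Δ + mhat * K ^ 2 / (2 * Δ)) + Real.sqrt (mhat / Δ) * K * ∑ i, |z i| := by
  have h1 := abs_interaction_le hΔ hx hxs
  have h2 : |mhat * (∑ i, x i ^ 2) / (2 * Δ)| ≤ n * (mhat * K ^ 2 / (2 * Δ)) := by
    have h : |∑ i, x i ^ 2| ≤ n * K ^ 2 := abs_sum_le_card_mul fun i => by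
      rw [abs_pow]; exact pow_le_pow_left₀ (abs_nonneg _) (hx i) 2
    rw [abs_div, abs_mul, abs_of_nonneg hmhat, abs_of_pos (show 0 < 2 * Δ by positivity)]
    calc _ ≤ mhat * (n * K ^ 2) / (2 * Δ) := by gcongr
      _ = _ := by ring
  have h3 : |Real.sqrt (mhat / Δ) * (∑ i, x i * z i)|
      ≤ Real.sqrt (mhat / Δ) * K * ∑ i, |z i| := by
    rw [abs_mul, abs_of_nonneg (Real.sqrt_nonneg _), mul_assoc, Finset.mul_sum]
    gcongr
    refine (Finset.abs_sum_le_sum_abs _ _).trans (Finset.sum_le_sum fun i _ => ?_)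
    rw [abs_mul]
    gcongr
    exact hx i
  refine (abs_add_le _ _).trans ?_
  have h4 := abs_sub ((1 / (n * Δ)) * ∑ q : SymIdx n, x q.1.1 * x q.1.2 * xs q.1.1 * xs q.1.2)
    (mhat * (∑ i, x i ^ 2) / (2 * Δ))
  linarith

lemma abs_log_Zadhoc_le {p : Measure ℝ} [IsProbabilityMeasure p] {K Δ mhat : ℝ}
    (hK : ∀ᵐ x ∂p, |x| ≤ K) (hΔ : 0 < Δ) (hmhat : 0 ≤ mhat) {n : ℕ}
    {xs : Fin n → ℝ} (hxs : ∀ i, |xs i| ≤ K) (z : Fin n → ℝ) :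
    |Real.log (Zadhoc p Δ mhat n xs z)|
      ≤ n * (K ^ 4 / Δ + mhat * K ^ 2 / (2 * Δ)) + Real.sqrt (mhat / Δ) * K * ∑ i, |z i| :=
  abs_log_integral_exp_le (by fun_prop)
    ((ae_pi_abs_le hK n).mono fun _ hx => abs_exponent_Zadhoc_le hΔ hmhat hx hxs z)

/-- The joint law of `n` independent pairs (signal, noise). -/
def pairLaw (p : Measure ℝ) (n : ℕ) : Measure (Fin n → ℝ × ℝ) :=
  Measure.pi fun _ : Fin n => p.prod (gaussianReal 0 1)

instance (p : Measure ℝ) [IsProbabilityMeasure p] (n : ℕ) :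
    IsProbabilityMeasure (pairLaw p n) :=
  inferInstanceAs (IsProbabilityMeasure (Measure.pi _))

lemma adhocAvg_eq (p : Measure ℝ) [IsProbabilityMeasure p] (Δ mhat : ℝ) (n : ℕ) :
    adhocAvg p Δ mhat n
      = ∫ w, Real.log (Zadhoc p Δ mhat n (fun i => (w i).1) fun i => (w i).2) ∂pairLaw p n :=
  ((measurePreserving_arrowProdEquivProdArrow ℝ ℝ (Fin n) (fun _ => p)
    fun _ => gaussianReal 0 1).integral_comp' _).symm

lemma ae_pairLaw {p : Measure ℝ} [IsProbabilityMeasure p] {P : ℝ → Prop}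
    (hP : ∀ᵐ x ∂p, P x) (n : ℕ) : ∀ᵐ w ∂pairLaw p n, ∀ i, P (w i).1 := by
  rw [ae_all_iff]
  intro i
  exact (measurePreserving_eval (fun _ : Fin n => p.prod (gaussianReal 0 1)) i
    ).quasiMeasurePreserving.ae (Measure.quasiMeasurePreserving_fst.ae hP)

lemma integrable_log_bound (p : Measure ℝ) [IsProbabilityMeasure p] (n : ℕ) (a b : ℝ) :
    Integrable (fun w => a + b * ∑ i, |(w i).2|) (pairLaw p n) :=
  (integrable_const a).add ((integrable_finsetSum _ fun i _ =>
    integrable_comp_eval (μ := fun _ : Fin n => p.prod (gaussianReal 0 1)) (i := i)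
      (integrable_abs_snd p)).const_mul b)

lemma ae_abs_log_Zadhoc_le {p : Measure ℝ} [IsProbabilityMeasure p] {K Δ mhat : ℝ}
    (hK : ∀ᵐ x ∂p, |x| ≤ K) (hΔ : 0 < Δ) (hmhat : 0 ≤ mhat) (n : ℕ) :
    ∀ᵐ w ∂pairLaw p n, |Real.log (Zadhoc p Δ mhat n (fun i => (w i).1) fun i => (w i).2)|
      ≤ n * (K ^ 4 / Δ + mhat * K ^ 2 / (2 * Δ))
        + Real.sqrt (mhat / Δ) * K * ∑ i, |(w i).2| := by
  filter_upwards [ae_pairLaw hK n] with w hw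
  exact abs_log_Zadhoc_le hK hΔ hmhat hw _

lemma integrable_log_Zadhoc {p : Measure ℝ} [IsProbabilityMeasure p] {K Δ mhat : ℝ}
    (hK : ∀ᵐ x ∂p, |x| ≤ K) (hΔ : 0 < Δ) (hmhat : 0 ≤ mhat) (n : ℕ) :
    Integrable (fun w : Fin n → ℝ × ℝ =>
      Real.log (Zadhoc p Δ mhat n (fun i => (w i).1) fun i => (w i).2)) (pairLaw p n) := by
  have hmeas : Measurable fun w : Fin n → ℝ × ℝ =>
      Real.log (Zadhoc p Δ mhat n (fun i => (w i).1) fun i => (w i).2) :=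
    (measurable_log_Zadhoc p Δ mhat n).comp
      (g := fun ω : (Fin n → ℝ) × (Fin n → ℝ) => Real.log (Zadhoc p Δ mhat n ω.1 ω.2))
      (f := fun w : Fin n → ℝ × ℝ => (fun i => (w i).1, fun i => (w i).2)) (by fun_prop)
  refine (integrable_log_bound p n (n * (K ^ 4 / Δ + mhat * K ^ 2 / (2 * Δ)))
    (Real.sqrt (mhat / Δ) * K)).mono' hmeas.aestronglyMeasurable ?_
  simpa only [Real.norm_eq_abs] using ae_abs_log_Zadhoc_le hK hΔ hmhat n

lemma abs_adhocAvg_le {p : Measure ℝ} [IsProbabilityMeasure p] {K Δ mhat : ℝ}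
    (hK : ∀ᵐ x ∂p, |x| ≤ K) (hΔ : 0 < Δ) (hmhat : 0 ≤ mhat) (n : ℕ) :
    |adhocAvg p Δ mhat n| ≤ n * (K ^ 4 / Δ + mhat * K ^ 2 / (2 * Δ)
      + Real.sqrt (mhat / Δ) * K * ∫ w : ℝ × ℝ, |w.2| ∂(p.prod (gaussianReal 0 1))) := by
  rw [adhocAvg_eq]
  refine (abs_integral_le_of_ae_abs_le (integrable_log_bound p n _ _)
    (ae_abs_log_Zadhoc_le hK hΔ hmhat n)).trans_eq ?_
  have hi : ∀ i : Fin n, Integrable (fun w : Fin n → ℝ × ℝ => |(w i).2|) (pairLaw p n) :=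
    fun i => integrable_comp_eval (μ := fun _ : Fin n => p.prod (gaussianReal 0 1)) (i := i)
      (integrable_abs_snd p)
  have he : ∀ i : Fin n, ∫ w, |(w i).2| ∂pairLaw p n
      = ∫ w : ℝ × ℝ, |w.2| ∂(p.prod (gaussianReal 0 1)) :=
    fun i => integral_comp_eval (μ := fun _ : Fin n => p.prod (gaussianReal 0 1)) (i := i)
      (integrable_abs_snd p).aestronglyMeasurable
  rw [integral_add (integrable_const _) ((integrable_finsetSum _ fun i _ => hi i).const_mul _),
    integral_const_mul (Real.sqrt (mhat / Δ) * K), integral_finsetSum _ fun i _ => hi i]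
  simp only [he, integral_const, probReal_univ, Finset.sum_const, Finset.card_univ,
    Fintype.card_fin, nsmul_eq_mul, smul_eq_mul]
  ring

/-- Linearization of the square in the interaction at a nearby point `m` of a grid. -/
lemma exponent_le_of_near {K Δ mhat ε : ℝ} (hΔ : 0 < Δ) {n : ℕ} (hn : 0 < n)
    {x xs : Fin n → ℝ} (hx : ∀ i, |x i| ≤ K) (hxs : ∀ i, |xs i| ≤ K) (z : Fin n → ℝ) {m : ℝ}
    (hm : ((∑ i, x i * xs i) / n - m) ^ 2 / (2 * Δ) ≤ ε) :
    (1 / (n * Δ)) * ∑ q : SymIdx n, x q.1.1 * x q.1.2 * xs q.1.1 * xs q.1.2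
        - mhat * (∑ i, x i ^ 2) / (2 * Δ) + Real.sqrt (mhat / Δ) * (∑ i, x i * z i)
      ≤ (K ^ 4 / (2 * Δ) + n * ε) + ∑ i, (-(m ^ 2) / (2 * Δ)
        + ((m * xs i / Δ + Real.sqrt (mhat / Δ) * z i) * x i - mhat / Δ * x i ^ 2 / 2)) := by
  have hn' : (0 : ℝ) < n := by exact_mod_cast hn
  have hT := sum_sq_overlap_le hx hxs
  have hlin : ∑ i, (-(m ^ 2) / (2 * Δ)
        + ((m * xs i / Δ + Real.sqrt (mhat / Δ) * z i) * x i - mhat / Δ * x i ^ 2 / 2))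
      = -(n * m ^ 2) / (2 * Δ) + m * (∑ i, x i * xs i) / Δ
        + Real.sqrt (mhat / Δ) * (∑ i, x i * z i) - mhat * (∑ i, x i ^ 2) / (2 * Δ) := by
    have : ∀ i, (-(m ^ 2) / (2 * Δ)
        + ((m * xs i / Δ + Real.sqrt (mhat / Δ) * z i) * x i - mhat / Δ * x i ^ 2 / 2))
      = -(m ^ 2) / (2 * Δ) + m / Δ * (x i * xs i) + Real.sqrt (mhat / Δ) * (x i * z i)
        - mhat / (2 * Δ) * x i ^ 2 := fun i => by ring
    simp only [this, Finset.sum_add_distrib, Finset.sum_sub_distrib, ← Finset.mul_sum,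
      Finset.sum_const, Finset.card_univ, Fintype.card_fin, nsmul_eq_mul]
    ring
  rw [hlin, sum_symIdx_interaction]
  set S := ∑ i, x i * xs i
  set T := ∑ i, (x i * xs i) ^ 2
  have hTle : 1 / (n * Δ) * (T / 2) ≤ K ^ 4 / (2 * Δ) := by
    calc 1 / (n * Δ) * (T / 2) ≤ 1 / (n * Δ) * (n * K ^ 4 / 2) := by gcongr
      _ = _ := by field_simp
  have hS : 1 / (n * Δ) * (S ^ 2 / 2) - m * S / Δ + n * m ^ 2 / (2 * Δ) ≤ n * ε := by
    calc _ = n * ((S / n - m) ^ 2 / (2 * Δ)) := by field_simp; ring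
      _ ≤ _ := by gcongr
  have hsplit : 1 / (n * Δ) * ((S ^ 2 + T) / 2)
      = 1 / (n * Δ) * (S ^ 2 / 2) + 1 / (n * Δ) * (T / 2) := by ring
  rw [hsplit, neg_div]
  linarith

lemma exists_grid (R Δ : ℝ) {ε : ℝ} (hΔ : 0 < Δ) (hε : 0 < ε) :
    ∃ M : Finset ℝ, ∀ s : ℝ, |s| ≤ R → ∃ m ∈ M, (s - m) ^ 2 / (2 * Δ) ≤ ε := by
  obtain ⟨t, -, hfin, hcover⟩ := (isCompact_Icc (a := -R) (b := R)).finite_cover_balls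
    (Real.sqrt_pos.mpr (show 0 < 2 * Δ * ε by positivity))
  refine ⟨hfin.toFinset, fun s hs => ?_⟩
  obtain ⟨m, hm, hsm⟩ := Set.mem_iUnion₂.mp (hcover (abs_le.mp hs))
  refine ⟨m, hfin.mem_toFinset.mpr hm, ?_⟩
  rw [Metric.mem_ball, Real.dist_eq] at hsm
  rw [div_le_iff₀ (by positivity), ← sq_abs]
  calc |s - m| ^ 2 ≤ Real.sqrt (2 * Δ * ε) ^ 2 := by gcongr
    _ = ε * (2 * Δ) := by rw [Real.sq_sqrt (by positivity)]; ring

lemma integrable_site {p : Measure ℝ} [IsProbabilityMeasure p] {K A : ℝ}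
    (hK : ∀ᵐ x ∂p, |x| ≤ K) (hA : 0 ≤ A) (c B : ℝ) :
    Integrable (fun x => Real.exp (c + (B * x - A * x ^ 2 / 2))) p :=
  integrable_exp_of_ae_le (c := c + (|B| * K + A * K ^ 2 / 2)) (by fun_prop)
    (hK.mono fun _ hx => by have := (abs_le.mp (exponent_abs_le hA B hx)).2; linarith)

lemma integral_exp_sum_site {p : Measure ℝ} [IsProbabilityMeasure p] {K Δ mhat : ℝ}
    (hK : ∀ᵐ x ∂p, |x| ≤ K) (hΔ : 0 < Δ) (hmhat : 0 ≤ mhat) {n : ℕ}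
    (xs z : Fin n → ℝ) (m : ℝ) :
    ∫ x : Fin n → ℝ, Real.exp (∑ i, (-(m ^ 2) / (2 * Δ)
        + ((m * xs i / Δ + Real.sqrt (mhat / Δ) * z i) * x i - mhat / Δ * x i ^ 2 / 2)))
        ∂(Measure.pi fun _ : Fin n => p)
      = Real.exp (∑ i, siteEnergy p Δ mhat m (xs i, z i)) := by
  simp only [Real.exp_sum]
  rw [integral_fintype_prod_eq_prod (fun i x => Real.exp (-(m ^ 2) / (2 * Δ)
    + ((m * xs i / Δ + Real.sqrt (mhat / Δ) * z i) * x - mhat / Δ * x ^ 2 / 2)))]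
  refine Finset.prod_congr rfl fun i _ => ?_
  rw [siteEnergy, Real.exp_add, exp_Jf hK (by positivity), ← integral_const_mul]
  simp only [Real.exp_add]

lemma Zadhoc_le_sum {p : Measure ℝ} [IsProbabilityMeasure p] {K Δ mhat ε : ℝ}
    (hK : ∀ᵐ x ∂p, |x| ≤ K) (hΔ : 0 < Δ) (hmhat : 0 ≤ mhat) {M : Finset ℝ}
    (hM : ∀ s : ℝ, |s| ≤ K ^ 2 → ∃ m ∈ M, (s - m) ^ 2 / (2 * Δ) ≤ ε) {n : ℕ} (hn : 0 < n)
    {xs : Fin n → ℝ} (hxs : ∀ i, |xs i| ≤ K) (z : Fin n → ℝ) :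
    Zadhoc p Δ mhat n xs z ≤ Real.exp (K ^ 4 / (2 * Δ) + n * ε)
      * ∑ m ∈ M, Real.exp (∑ i, siteEnergy p Δ mhat m (xs i, z i)) := by
  have hn' : (0 : ℝ) < n := by exact_mod_cast hn
  have hint : ∀ m ∈ M, Integrable (fun x : Fin n → ℝ => Real.exp (∑ i, (-(m ^ 2) / (2 * Δ)
      + ((m * xs i / Δ + Real.sqrt (mhat / Δ) * z i) * x i - mhat / Δ * x i ^ 2 / 2))))
      (Measure.pi fun _ : Fin n => p) := fun m _ => by
    simp only [Real.exp_sum]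
    exact Integrable.fintype_prod (f := fun i x => Real.exp (-(m ^ 2) / (2 * Δ)
      + ((m * xs i / Δ + Real.sqrt (mhat / Δ) * z i) * x - mhat / Δ * x ^ 2 / 2)))
      fun i => integrable_site hK (by positivity) _ _
  simp only [← integral_exp_sum_site hK hΔ hmhat]
  rw [← integral_finsetSum _ hint, ← integral_const_mul]
  refine integral_mono_of_nonneg (ae_of_all _ fun _ => (Real.exp_pos _).le)
    ((integrable_finsetSum _ hint).const_mul _) ?_
  filter_upwards [ae_pi_abs_le hK n] with x hx
  have hS : |(∑ i, x i * xs i) / n| ≤ K ^ 2 := by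
    rw [abs_div, abs_of_pos hn', div_le_iff₀ hn', mul_comm]
    exact abs_sum_le_card_mul fun i => abs_mul_le_sq (hx i) (hxs i)
  obtain ⟨m, hmM, hm⟩ := hM _ hS
  refine (Real.exp_le_exp.mpr (exponent_le_of_near (mhat := mhat) hΔ hn hx hxs z hm)).trans ?_
  rw [Real.exp_add]
  gcongr
  exact Finset.single_le_sum (f := fun m => Real.exp (∑ i, (-(m ^ 2) / (2 * Δ)
      + ((m * xs i / Δ + Real.sqrt (mhat / Δ) * z i) * x i - mhat / Δ * x i ^ 2 / 2))))
    (fun _ _ => (Real.exp_pos _).le) hmM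

lemma integral_centered_sum_sq {Ω : Type*} [MeasurableSpace Ω] {μ : Measure Ω}
    [IsProbabilityMeasure μ] {Y : Ω → ℝ} (hY : MemLp Y 2 μ) (n : ℕ) :
    Integrable (fun w : Fin n → Ω => (∑ i, Y (w i) - n * ∫ ω, Y ω ∂μ) ^ 2)
      (Measure.pi fun _ : Fin n => μ) ∧
    ∫ w : Fin n → Ω, (∑ i, Y (w i) - n * ∫ ω, Y ω ∂μ) ^ 2 ∂(Measure.pi fun _ : Fin n => μ)
      = n * Var[Y; μ] := by
  have hLp : ∀ i : Fin n, MemLp (fun w : Fin n → Ω => Y (w i)) 2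
      (Measure.pi fun _ : Fin n => μ) :=
    fun i => hY.comp_measurePreserving (measurePreserving_eval (fun _ : Fin n => μ) i)
  have hsum : MemLp (fun w : Fin n → Ω => ∑ i, Y (w i)) 2 (Measure.pi fun _ : Fin n => μ) :=
    memLp_finsetSum _ fun i _ => hLp i
  have hmean : ∫ w : Fin n → Ω, ∑ i, Y (w i) ∂(Measure.pi fun _ : Fin n => μ)
      = n * ∫ ω, Y ω ∂μ := by
    rw [integral_finsetSum _ fun i _ => (hLp i).integrable one_le_two]
    simp [integral_comp_eval (μ := fun _ : Fin n => μ) hY.aestronglyMeasurable]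
  refine ⟨(hsum.sub (memLp_const _)).integrable_sq, ?_⟩
  have hvar := variance_sum_pi (μ := fun _ : Fin n => μ) (X := fun _ => Y) fun _ => hY
  have hfun : (∑ i : Fin n, fun w : Fin n → Ω => Y (w i)) = fun w => ∑ i, Y (w i) := by
    ext w; simp
  rw [hfun, variance_eq_integral hsum.aestronglyMeasurable.aemeasurable, hmean] at hvar
  simpa using hvar

lemma log_Zadhoc_le {p : Measure ℝ} [IsProbabilityMeasure p] {K Δ mhat ε G δ : ℝ}
    (hK : ∀ᵐ x ∂p, |x| ≤ K) (hΔ : 0 < Δ) (hmhat : 0 ≤ mhat) {M : Finset ℝ}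
    (hM : ∀ s : ℝ, |s| ≤ K ^ 2 → ∃ m ∈ M, (s - m) ^ 2 / (2 * Δ) ≤ ε)
    (hG : ∀ m, Gbar p Δ mhat m ≤ G) (hδ : 0 < δ) {n : ℕ} (hn : 0 < n)
    {w : Fin n → ℝ × ℝ} (hxs : ∀ i, |(w i).1| ≤ K) :
    Real.log (Zadhoc p Δ mhat n (fun i => (w i).1) fun i => (w i).2)
      ≤ (K ^ 4 / (2 * Δ) + n * ε + M.card + n * G + n * δ)
        + ∑ m ∈ M, (1 / (4 * (n * δ)))
          * (∑ i, siteEnergy p Δ mhat m (w i) - n * Gbar p Δ mhat m) ^ 2 := by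
  have hn' : (0 : ℝ) < n := by exact_mod_cast hn
  set D := ∑ m ∈ M, (1 / (4 * (n * δ)))
    * (∑ i, siteEnergy p Δ mhat m (w i) - n * Gbar p Δ mhat m) ^ 2
  have hterm : ∀ m ∈ M, ∑ i, siteEnergy p Δ mhat m (w i) ≤ n * G + n * δ + D := fun m hm => by
    set t := ∑ i, siteEnergy p Δ mhat m (w i) - n * Gbar p Δ mhat m with ht
    have h1 : t ≤ n * δ + 1 / (4 * (n * δ)) * t ^ 2 := by
      have : n * δ + 1 / (4 * (n * δ)) * t ^ 2 - t = (2 * (n * δ) - t) ^ 2 / (4 * (n * δ)) := by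
        field_simp; ring
      rw [← sub_nonneg, this]; positivity
    have h2 : 1 / (4 * (n * δ)) * t ^ 2 ≤ D :=
      Finset.single_le_sum (f := fun m => 1 / (4 * (n * δ))
        * (∑ i, siteEnergy p Δ mhat m (w i) - n * Gbar p Δ mhat m) ^ 2)
        (fun _ _ => by positivity) hm
    have h3 : (n : ℝ) * Gbar p Δ mhat m ≤ n * G := by gcongr; exact hG m
    linarith
  have hZ : Zadhoc p Δ mhat n (fun i => (w i).1) (fun i => (w i).2)
      ≤ Real.exp ((K ^ 4 / (2 * Δ) + n * ε + M.card + n * G + n * δ) + D) := by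
    refine (Zadhoc_le_sum hK hΔ hmhat hM hn hxs _).trans ?_
    have h1 : ∑ m ∈ M, Real.exp (∑ i, siteEnergy p Δ mhat m (w i))
        ≤ Real.exp M.card * Real.exp (n * G + n * δ + D) := by
      refine (Finset.sum_le_card_nsmul _ _ _ fun m hm =>
        Real.exp_le_exp.mpr (hterm m hm)).trans ?_
      rw [nsmul_eq_mul]
      gcongr
      linarith [Real.add_one_le_exp (M.card : ℝ)]
    calc _ ≤ Real.exp (K ^ 4 / (2 * Δ) + n * ε)
          * (Real.exp M.card * Real.exp (n * G + n * δ + D)) := by gcongr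
      _ = _ := by rw [← Real.exp_add, ← Real.exp_add]; congr 1; ring
  have hpos : 0 < Zadhoc p Δ mhat n (fun i => (w i).1) (fun i => (w i).2) := by
    exact integral_exp_pos (integrable_exp_of_ae_le (by fun_prop)
      ((ae_pi_abs_le hK n).mono fun x hx =>
        (abs_le.mp (abs_exponent_Zadhoc_le hΔ hmhat hx hxs fun i => (w i).2)).2))
  exact (Real.log_le_iff_le_exp hpos).mpr hZ

lemma adhocAvg_le {p : Measure ℝ} [IsProbabilityMeasure p] {K Δ mhat ε G δ : ℝ}
    (hK0 : 0 ≤ K) (hK : ∀ᵐ x ∂p, |x| ≤ K) (hΔ : 0 < Δ) (hmhat : 0 ≤ mhat) {M : Finset ℝ}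
    (hM : ∀ s : ℝ, |s| ≤ K ^ 2 → ∃ m ∈ M, (s - m) ^ 2 / (2 * Δ) ≤ ε)
    (hG : ∀ m, Gbar p Δ mhat m ≤ G) (hδ : 0 < δ) {n : ℕ} (hn : 0 < n) :
    adhocAvg p Δ mhat n ≤ n * (G + ε + δ) + (K ^ 4 / (2 * Δ) + M.card
      + ∑ m ∈ M, 1 / (4 * δ) * Var[siteEnergy p Δ mhat m; p.prod (gaussianReal 0 1)]) := by
  have hn' : (0 : ℝ) < n := by exact_mod_cast hn
  have hsq := fun m => integral_centered_sum_sq (memLp_siteEnergy hK0 hK hΔ hmhat m) n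
  simp only [integral_siteEnergy hK0 hK hΔ hmhat] at hsq
  have hi : ∀ m ∈ M, Integrable (fun w : Fin n → ℝ × ℝ => (1 / (4 * (n * δ)))
      * (∑ i, siteEnergy p Δ mhat m (w i) - n * Gbar p Δ mhat m) ^ 2) (pairLaw p n) :=
    fun m _ => (hsq m).1.const_mul _
  rw [adhocAvg_eq]
  refine (integral_mono_ae (integrable_log_Zadhoc hK hΔ hmhat n)
    ((integrable_const _).add (integrable_finsetSum _ hi))
    ((ae_pairLaw hK n).mono fun w hw => log_Zadhoc_le hK hΔ hmhat hM hG hδ hn hw)).trans_eq ?_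
  rw [integral_add' (integrable_const _) (integrable_finsetSum _ hi), integral_finsetSum _ hi]
  have hterm : ∀ m ∈ M, ∫ w : Fin n → ℝ × ℝ, (1 / (4 * (n * δ)))
      * (∑ i, siteEnergy p Δ mhat m (w i) - n * Gbar p Δ mhat m) ^ 2 ∂pairLaw p n
      = 1 / (4 * δ) * Var[siteEnergy p Δ mhat m; p.prod (gaussianReal 0 1)] := fun m _ => by
    rw [integral_const_mul, pairLaw, (hsq m).2]
    field_simp
  rw [Finset.sum_congr rfl hterm]
  simp only [integral_const, probReal_univ, smul_eq_mul]
  ring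

/-- **Laplace-method upper bound for the ad-hoc model** :
`limsup_{n→∞} (1/n) E[log Z̃₀] ≤ sup_{m∈ℝ} Ḡ(m)`. -/
theorem adhoc_limsup_le
    (p : Measure ℝ) [IsProbabilityMeasure p]
    (hsupp : ∃ s : Finset ℝ, p (↑s : Set ℝ)ᶜ = 0)
    (Δ : ℝ) (hΔ : 0 < Δ) (mhat : ℝ) (hmhat : 0 ≤ mhat)
    (hfin : {m : ℝ | deriv (Gbar p Δ mhat) m = 0}.Finite) :
    limsup (fun n : ℕ => adhocAvg p Δ mhat n / n) atTop ≤ ⨆ m : ℝ, Gbar p Δ mhat m := by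
  obtain ⟨K, hK0, hK⟩ := exists_ae_abs_le hsupp
  have hG : ∀ m, Gbar p Δ mhat m ≤ ⨆ m : ℝ, Gbar p Δ mhat m :=
    le_ciSup (bddAbove_range_Gbar hK0 hK hΔ hmhat)
  set c := K ^ 4 / Δ + mhat * K ^ 2 / (2 * Δ)
    + Real.sqrt (mhat / Δ) * K * ∫ w : ℝ × ℝ, |w.2| ∂(p.prod (gaussianReal 0 1))
  have hcob : IsCoboundedUnder (· ≤ ·) atTop fun n : ℕ => adhocAvg p Δ mhat n / n := by
    refine IsBoundedUnder.isCoboundedUnder_le ⟨-c, ?_⟩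
    rw [eventually_map]
    filter_upwards [eventually_gt_atTop 0] with n hn
    have hn' : (0 : ℝ) < n := by exact_mod_cast hn
    have h := (abs_le.mp (abs_adhocAvg_le hK hΔ hmhat n)).1
    rw [le_div_iff₀ hn']
    linarith
  refine le_of_forall_pos_le_add fun ε hε => limsup_le_of_le hcob ?_
  obtain ⟨M, hM⟩ := exists_grid (K ^ 2) Δ hΔ (show 0 < ε / 3 by positivity)
  set C := K ^ 4 / (2 * Δ) + M.card
    + ∑ m ∈ M, 1 / (4 * (ε / 3)) * Var[siteEnergy p Δ mhat m; p.prod (gaussianReal 0 1)]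
  have hlim : Tendsto (fun n : ℕ => C / (n : ℝ)) atTop (nhds 0) :=
    tendsto_const_div_atTop_nhds_zero_nat C
  filter_upwards [eventually_gt_atTop 0, hlim.eventually_le_const (show 0 < ε / 3 by positivity)]
    with n hn hCn
  have hn' : (0 : ℝ) < n := by exact_mod_cast hn
  have h := adhocAvg_le hK0 hK hΔ hmhat hM hG (show 0 < ε / 3 by positivity) hn
  rw [div_le_iff₀ hn'] at hCn ⊢
  linarith
end
end

section
/- For every n ≥ 1 and every t ∈ (0,1), the function t ↦ E[log Z̃_t] is differentiable and −(1/n)·(d/dt) E[log Z̃_t] ≥ −m̂²/(4Δ), i.e. (1/n)·(d/dt) E[log Z̃_t] ≤ m̂²/(4Δ). -/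
open MeasureTheory ProbabilityTheory Filter Real

noncomputable section

/-- The Hamiltonian of the lower-bound interpolation. -/
def HamL (Δ mhat : ℝ) (n : ℕ) (t : ℝ)
    (xs : Fin n → ℝ) (ξ : SymIdx n → ℝ) (z : Fin n → ℝ) (x : Fin n → ℝ) : ℝ :=
  (∑ q : SymIdx n,
      (-(t * x q.1.1 ^ 2 * x q.1.2 ^ 2) / (2 * Δ * n)
        + x q.1.1 * x q.1.2 * xs q.1.1 * xs q.1.2 / (Δ * n)
        + Real.sqrt (t / (n * Δ)) * x q.1.1 * x q.1.2 * ξ q))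
    - (1 - t) * mhat * (∑ i, x i ^ 2) / (2 * Δ)
    + Real.sqrt (mhat * (1 - t) / Δ) * (∑ i, x i * z i)

/-- The partition function `Z̃_t` of the lower-bound interpolation. -/
def ZtL (p : Measure ℝ) (Δ mhat : ℝ) (n : ℕ) (t : ℝ)
    (xs : Fin n → ℝ) (ξ : SymIdx n → ℝ) (z : Fin n → ℝ) : ℝ :=
  ∫ x, Real.exp (HamL Δ mhat n t xs ξ z x) ∂(Measure.pi fun _ : Fin n => p)

/-- The averaged log-partition function `t ↦ E[log Z̃_t]`. -/
def FavgL (p : Measure ℝ) (Δ mhat : ℝ) (n : ℕ) (t : ℝ) : ℝ :=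
  ∫ ω, Real.log (ZtL p Δ mhat n t ω.1 ω.2.1 ω.2.2) ∂(baseP p n)

open Topology

/-- **Gaussian integration by parts** for bounded functions with bounded continuous derivative. -/
theorem integral_id_mul_gaussianReal_eq_integral_deriv {f f' : ℝ → ℝ} {C C' : ℝ}
    (hf : ∀ x, HasDerivAt f (f' x) x) (hf' : Continuous f')
    (hC : ∀ x, |f x| ≤ C) (hC' : ∀ x, |f' x| ≤ C') :
    ∫ x, x * f x ∂(gaussianReal 0 1) = ∫ x, f' x ∂(gaussianReal 0 1) := by
  have hfc : Continuous f := continuous_iff_continuousAt.2 fun x => (hf x).continuousAt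
  have hpdf : ∀ x, HasDerivAt (gaussianPDFReal 0 1) (-(x * gaussianPDFReal 0 1 x)) x := by
    intro x
    have h2 : HasDerivAt (fun x : ℝ => -(x - 0) ^ 2 / (2 * ((1 : NNReal) : ℝ))) (-x) x := by
      have := (((hasDerivAt_id x).sub_const 0).pow 2).neg.div_const (2 * ((1 : NNReal) : ℝ))
      refine this.congr_deriv ?_
      simp
      ring
    have h3 := h2.exp.const_mul (√(2 * π * ((1 : NNReal) : ℝ)))⁻¹
    rw [gaussianPDFReal_def]
    refine h3.congr_deriv ?_
    ring
  have hint : Integrable (gaussianPDFReal 0 1) := integrable_gaussianPDFReal 0 1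
  have hint' : Integrable (fun x => -(x * gaussianPDFReal 0 1 x)) := by
    have := (integrable_mul_exp_neg_mul_sq (b := 1 / 2) (by norm_num)).const_mul
      (-(√(2 * π * ((1 : NNReal) : ℝ)))⁻¹)
    refine this.congr (Eventually.of_forall fun x => ?_)
    simp only [gaussianPDFReal_def, sub_zero, NNReal.coe_one]
    rw [show -x ^ 2 / (2 * 1) = -(1 / 2) * x ^ 2 by ring]
    ring
  have key := integral_mul_deriv_eq_deriv_mul_of_integrable (u := f) (u' := f')
    (v := gaussianPDFReal 0 1) (v' := fun x => -(x * gaussianPDFReal 0 1 x))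
    (fun x _ => hf x) (fun x _ => hpdf x)
    (hint'.bdd_mul hfc.aestronglyMeasurable (Eventually.of_forall hC))
    (hint.bdd_mul hf'.aestronglyMeasurable (Eventually.of_forall hC'))
    (hint.bdd_mul hfc.aestronglyMeasurable (Eventually.of_forall hC))
  rw [integral_gaussianReal_eq_integral_smul one_ne_zero,
    integral_gaussianReal_eq_integral_smul one_ne_zero]
  simp only [smul_eq_mul, mul_neg, integral_neg, neg_inj] at key ⊢
  calc _ = ∫ x, f x * (x * gaussianPDFReal 0 1 x) := by congr 1; ext x; ring
    _ = _ := key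
    _ = _ := by congr 1; ext x; ring

/-- Resampling one coordinate of a product probability measure preserves it. -/
theorem measurePreserving_update_pi {ι : Type*} [Fintype ι] [DecidableEq ι] (μ : Measure ℝ)
    [IsProbabilityMeasure μ] (k : ι) :
    MeasurePreserving (fun q : (ι → ℝ) × ℝ => Function.update q.1 k q.2)
      ((Measure.pi fun _ : ι => μ).prod μ) (Measure.pi fun _ : ι => μ) := by
  have hm : Measurable (fun q : (ι → ℝ) × ℝ => Function.update q.1 k q.2) := by
    refine measurable_pi_iff.2 fun i => ?_
    by_cases h : i = k
    · subst h; simpa using measurable_snd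
    · simpa [Function.update_of_ne h, Function.comp_def] using
        (measurable_pi_apply i).comp measurable_fst
  refine ⟨hm, (Measure.pi_eq fun s hs => ?_).symm⟩
  rw [Measure.map_apply hm (MeasurableSet.univ_pi hs)]
  have : (fun q : (ι → ℝ) × ℝ => Function.update q.1 k q.2) ⁻¹' Set.univ.pi s
      = (Set.univ.pi (Function.update s k Set.univ)) ×ˢ s k := by
    ext q
    simp only [Set.mem_preimage, Set.mem_pi, Set.mem_univ, true_implies, Set.mem_prod]
    constructor
    · intro h
      refine ⟨fun i => ?_, by simpa using h k⟩
      by_cases hi : i = k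
      · subst hi; simp
      · simpa [Function.update_of_ne hi] using h i
    · rintro ⟨h, hk⟩ i
      by_cases hi : i = k
      · subst hi; simpa using hk
      · simpa [Function.update_of_ne hi] using h i
  rw [this, Measure.prod_prod, Measure.pi_pi, ← Finset.mul_prod_erase _ _ (Finset.mem_univ k),
    ← Finset.mul_prod_erase _ _ (Finset.mem_univ k), mul_comm]
  simp only [Function.update_self, measure_univ, one_mul]
  congr 1
  refine Finset.prod_congr rfl fun i hi => ?_
  rw [Function.update_of_ne (Finset.ne_of_mem_erase hi)]

theorem integrable_eval_pi_gaussianReal {ι : Type*} [Fintype ι] (k : ι) :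
    Integrable (fun g : ι → ℝ => g k) (Measure.pi fun _ : ι => gaussianReal 0 1) :=
  integrable_comp_eval (μ := fun _ : ι => gaussianReal 0 1) (i := k) (f := fun x => x)
    (memLp_one_iff_integrable.1 (by exact_mod_cast memLp_id_gaussianReal 1))

/-- Gaussian integration by parts in one coordinate of a standard Gaussian vector. -/
theorem integral_eval_mul_pi_gaussianReal {ι : Type*} [Fintype ι] [DecidableEq ι] (k : ι)
    {f f' : (ι → ℝ) → ℝ} {C C' : ℝ}
    (hf : ∀ g, HasDerivAt (fun u => f (Function.update g k u)) (f' g) (g k))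
    (hfc : Continuous f) (hfc' : Continuous f') (hC : ∀ g, |f g| ≤ C) (hC' : ∀ g, |f' g| ≤ C') :
    ∫ g, g k * f g ∂(Measure.pi fun _ : ι => gaussianReal 0 1)
      = ∫ g, f' g ∂(Measure.pi fun _ : ι => gaussianReal 0 1) := by
  have hp := measurePreserving_update_pi (ι := ι) (gaussianReal 0 1) k
  have hi : Integrable (fun g : ι → ℝ => g k * f g)
      (Measure.pi fun _ : ι => gaussianReal 0 1) :=
    (integrable_eval_pi_gaussianReal k).mul_bdd hfc.aestronglyMeasurable (Eventually.of_forall hC)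
  have hi' : Integrable f' (Measure.pi fun _ : ι => gaussianReal 0 1) :=
    Integrable.of_bound hfc'.aestronglyMeasurable C' (Eventually.of_forall hC')
  have e1 : ∀ F : (ι → ℝ) → ℝ, Integrable F (Measure.pi fun _ : ι => gaussianReal 0 1) →
      ∫ g, F g ∂(Measure.pi fun _ : ι => gaussianReal 0 1)
        = ∫ g, ∫ u, F (Function.update g k u) ∂(gaussianReal 0 1)
          ∂(Measure.pi fun _ : ι => gaussianReal 0 1) := by
    intro F hF
    have h := hp.integrable_comp_of_integrable hF
    rw [← integral_prod (fun q : (ι → ℝ) × ℝ => F (Function.update q.1 k q.2)) h]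
    conv_lhs => rw [← hp.map_eq]
    rw [integral_map hp.measurable.aemeasurable (by rw [hp.map_eq]; exact hF.1)]
  rw [e1 _ hi, e1 _ hi']
  congr 1
  ext g
  simp only [Function.update_self]
  have hu : Continuous fun u : ℝ => Function.update g k u :=
    continuous_const.update k continuous_id
  refine integral_id_mul_gaussianReal_eq_integral_deriv (C := C) (C' := C') (fun u => ?_)
    (hfc'.comp hu) (fun u => hC _) (fun u => hC' _)
  have := hf (Function.update g k u)
  simpa using this

/-- The partition function of a finite Gibbs measure with reference weights `w`. -/
def gibbsZ {α : Type*} (S : Finset α) (w h : α → ℝ) : ℝ := ∑ v ∈ S, w v * exp (h v)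

/-- The average of `f` under a finite Gibbs measure with reference weights `w`. -/
def gibbsAvg {α : Type*} (S : Finset α) (w h f : α → ℝ) : ℝ :=
  (∑ v ∈ S, w v * exp (h v) * f v) / gibbsZ S w h

section Gibbs

variable {α : Type*} {S : Finset α} {w : α → ℝ}

theorem gibbsZ_pos (hw : ∀ v ∈ S, 0 ≤ w v) (hw1 : ∑ v ∈ S, w v = 1) (h : α → ℝ) :
    0 < gibbsZ S w h := by
  have hn : ∀ v ∈ S, 0 ≤ w v * exp (h v) := fun v hv => mul_nonneg (hw v hv) (exp_pos _).le
  refine lt_of_le_of_ne (Finset.sum_nonneg hn) fun h0 => ?_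
  have h1 := (Finset.sum_eq_zero_iff_of_nonneg hn).1 h0.symm
  have : ∑ v ∈ S, w v = 0 := Finset.sum_eq_zero fun v hv => by
    simpa [(exp_pos (h v)).ne'] using h1 v hv
  linarith

theorem abs_log_gibbsZ_le (hw : ∀ v ∈ S, 0 ≤ w v) (hw1 : ∑ v ∈ S, w v = 1) {h : α → ℝ} {M : ℝ}
    (hM : ∀ v ∈ S, |h v| ≤ M) : |log (gibbsZ S w h)| ≤ M := by
  have hpos := gibbsZ_pos hw hw1 h
  have hsum : ∀ c : ℝ, c = ∑ v ∈ S, w v * c := fun c => by rw [← Finset.sum_mul, hw1, one_mul]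
  rw [abs_le, Real.le_log_iff_exp_le hpos, Real.log_le_iff_le_exp hpos]
  constructor
  · rw [hsum (exp (-M))]
    exact Finset.sum_le_sum fun v hv =>
      mul_le_mul_of_nonneg_left (exp_le_exp.2 (abs_le.1 (hM v hv)).1) (hw v hv)
  · rw [hsum (exp M)]
    exact Finset.sum_le_sum fun v hv =>
      mul_le_mul_of_nonneg_left (exp_le_exp.2 (abs_le.1 (hM v hv)).2) (hw v hv)

theorem gibbsAvg_add (h f₁ f₂ : α → ℝ) :
    gibbsAvg S w h (fun v => f₁ v + f₂ v) = gibbsAvg S w h f₁ + gibbsAvg S w h f₂ := by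
  simp only [gibbsAvg, mul_add, Finset.sum_add_distrib, add_div]

theorem gibbsAvg_const_mul (h f : α → ℝ) (c : ℝ) :
    gibbsAvg S w h (fun v => c * f v) = c * gibbsAvg S w h f := by
  simp only [gibbsAvg, mul_div_assoc', Finset.mul_sum]
  congr 1
  exact Finset.sum_congr rfl fun v _ => by ring

theorem gibbsAvg_sum {κ : Type*} (K : Finset κ) (h : α → ℝ) (f : κ → α → ℝ) :
    gibbsAvg S w h (fun v => ∑ k ∈ K, f k v) = ∑ k ∈ K, gibbsAvg S w h (f k) := by
  simp only [gibbsAvg, Finset.mul_sum, Finset.sum_div]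
  rw [Finset.sum_comm]

theorem gibbsAvg_mono (hw : ∀ v ∈ S, 0 ≤ w v) (hw1 : ∑ v ∈ S, w v = 1) {h f₁ f₂ : α → ℝ}
    (hf : ∀ v ∈ S, f₁ v ≤ f₂ v) : gibbsAvg S w h f₁ ≤ gibbsAvg S w h f₂ := by
  refine div_le_div_of_nonneg_right (Finset.sum_le_sum fun v hv => ?_) (gibbsZ_pos hw hw1 h).le
  exact mul_le_mul_of_nonneg_left (hf v hv) (mul_nonneg (hw v hv) (exp_pos _).le)

theorem gibbsAvg_const (hw : ∀ v ∈ S, 0 ≤ w v) (hw1 : ∑ v ∈ S, w v = 1) (h : α → ℝ) (c : ℝ) :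
    gibbsAvg S w h (fun _ => c) = c := by
  rw [gibbsAvg, ← Finset.sum_mul, ← gibbsZ, mul_div_assoc, mul_comm,
    div_mul_cancel₀ _ (gibbsZ_pos hw hw1 h).ne']

theorem abs_gibbsAvg_le (hw : ∀ v ∈ S, 0 ≤ w v) (hw1 : ∑ v ∈ S, w v = 1) {h f : α → ℝ} {M : ℝ}
    (hM : ∀ v ∈ S, |f v| ≤ M) : |gibbsAvg S w h f| ≤ M := by
  rw [abs_le]
  constructor
  · rw [← gibbsAvg_const hw hw1 h (-M)]
    exact gibbsAvg_mono hw hw1 fun v hv => (abs_le.1 (hM v hv)).1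
  · rw [← gibbsAvg_const hw hw1 h M]
    exact gibbsAvg_mono hw hw1 fun v hv => (abs_le.1 (hM v hv)).2

/-- Jensen's inequality for the square. -/
theorem sq_gibbsAvg_le (hw : ∀ v ∈ S, 0 ≤ w v) (hw1 : ∑ v ∈ S, w v = 1) (h f : α → ℝ) :
    gibbsAvg S w h f ^ 2 ≤ gibbsAvg S w h (fun v => f v ^ 2) := by
  set m := gibbsAvg S w h f with hm
  have h1 : gibbsAvg S w h (fun v => 2 * m * f v + -m ^ 2) ≤ gibbsAvg S w h (fun v => f v ^ 2) :=
    gibbsAvg_mono hw hw1 fun v _ => by nlinarith [sq_nonneg (f v - m)]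
  rw [gibbsAvg_add, gibbsAvg_const_mul, gibbsAvg_const hw hw1, ← hm] at h1
  nlinarith

theorem hasDerivAt_log_gibbsZ (hw : ∀ v ∈ S, 0 ≤ w v) (hw1 : ∑ v ∈ S, w v = 1)
    {h : ℝ → α → ℝ} {h' : α → ℝ} {t : ℝ} (hh : ∀ v ∈ S, HasDerivAt (fun t => h t v) (h' v) t) :
    HasDerivAt (fun t => log (gibbsZ S w (h t))) (gibbsAvg S w (h t) h') t := by
  have h1 : HasDerivAt (fun t => gibbsZ S w (h t)) (∑ v ∈ S, w v * (exp (h t v) * h' v)) t :=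
    HasDerivAt.fun_sum fun v hv => (hh v hv).exp.const_mul (w v)
  refine (h1.log (gibbsZ_pos hw hw1 _).ne').congr_deriv ?_
  simp only [gibbsAvg, mul_assoc]

theorem hasDerivAt_gibbsAvg (hw : ∀ v ∈ S, 0 ≤ w v) (hw1 : ∑ v ∈ S, w v = 1)
    {h : ℝ → α → ℝ} {h' : α → ℝ} {t : ℝ} (hh : ∀ v ∈ S, HasDerivAt (fun t => h t v) (h' v) t)
    (f : α → ℝ) :
    HasDerivAt (fun t => gibbsAvg S w (h t) f)
      (gibbsAvg S w (h t) (fun v => h' v * f v)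
        - gibbsAvg S w (h t) h' * gibbsAvg S w (h t) f) t := by
  have hpos := (gibbsZ_pos hw hw1 (h t)).ne'
  have h1 : HasDerivAt (fun t => gibbsZ S w (h t)) (∑ v ∈ S, w v * (exp (h t v) * h' v)) t :=
    HasDerivAt.fun_sum fun v hv => (hh v hv).exp.const_mul (w v)
  have h2 : HasDerivAt (fun t => ∑ v ∈ S, w v * exp (h t v) * f v)
      (∑ v ∈ S, w v * (exp (h t v) * h' v) * f v) t :=
    HasDerivAt.fun_sum fun v hv => ((hh v hv).exp.const_mul (w v)).mul_const (f v)
  refine (h2.div h1 hpos).congr_deriv ?_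
  have e1 : ∑ v ∈ S, w v * (exp (h t v) * h' v) * f v
      = ∑ v ∈ S, w v * exp (h t v) * (h' v * f v) := Finset.sum_congr rfl fun v _ => by ring
  have e2 : ∑ v ∈ S, w v * (exp (h t v) * h' v) = ∑ v ∈ S, w v * exp (h t v) * h' v :=
    Finset.sum_congr rfl fun v _ => by ring
  rw [e1, e2]
  simp only [gibbsAvg]
  field_simp

theorem continuous_gibbsZ {X : Type*} [TopologicalSpace X] {h : X → α → ℝ}
    (hh : ∀ v, Continuous fun x => h x v) : Continuous fun x => gibbsZ S w (h x) :=
  continuous_finsetSum _ fun v _ => continuous_const.mul (continuous_exp.comp (hh v))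

theorem continuous_gibbsAvg (hw : ∀ v ∈ S, 0 ≤ w v) (hw1 : ∑ v ∈ S, w v = 1)
    {X : Type*} [TopologicalSpace X] {h f : X → α → ℝ}
    (hh : ∀ v, Continuous fun x => h x v) (hf : ∀ v, Continuous fun x => f x v) :
    Continuous fun x => gibbsAvg S w (h x) (f x) :=
  (continuous_finsetSum _ fun v _ =>
    (continuous_const.mul (continuous_exp.comp (hh v))).mul (hf v)).div
    (continuous_gibbsZ hh) fun _ => (gibbsZ_pos hw hw1 _).ne'

/-- Gibbs covariances dominate products of averages: the replica overlap inequality. -/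
theorem sq_sum_sq_gibbsAvg_le (hw : ∀ v ∈ S, 0 ≤ w v) (hw1 : ∑ v ∈ S, w v = 1)
    {ι : Type*} [Fintype ι] (h : α → ℝ) (x : α → ι → ℝ) :
    (∑ i, gibbsAvg S w h (fun v => x v i) ^ 2) ^ 2
      ≤ ∑ i, ∑ j, gibbsAvg S w h (fun v => x v i * x v j) ^ 2 := by
  set b : ι → ℝ := fun i => gibbsAvg S w h (fun v => x v i) with hb
  set A : ι → ι → ℝ := fun i j => gibbsAvg S w h (fun v => x v i * x v j)
  set B := ∑ i, b i ^ 2 with hB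
  have h1 := sq_gibbsAvg_le hw hw1 h (fun v => ∑ i, b i * x v i)
  have e1 : gibbsAvg S w h (fun v => ∑ i, b i * x v i) = B := by
    rw [gibbsAvg_sum]
    exact Finset.sum_congr rfl fun i _ => by rw [gibbsAvg_const_mul, sq]
  have e2 : gibbsAvg S w h (fun v => (∑ i, b i * x v i) ^ 2) = ∑ i, ∑ j, b i * b j * A i j := by
    have : (fun v => (∑ i, b i * x v i) ^ 2)
        = fun v => ∑ i, ∑ j, b i * b j * (x v i * x v j) := by
      ext v
      rw [sq, Finset.sum_mul_sum]
      exact Finset.sum_congr rfl fun i _ => Finset.sum_congr rfl fun j _ => by ring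
    rw [this, gibbsAvg_sum]
    refine Finset.sum_congr rfl fun i _ => ?_
    rw [gibbsAvg_sum]
    exact Finset.sum_congr rfl fun j _ => gibbsAvg_const_mul _ _ _
  rw [e1, e2] at h1
  have h2 : ∑ i, ∑ j, b i * b j * A i j ≤ (∑ i, ∑ j, (b i * b j) ^ 2 + ∑ i, ∑ j, A i j ^ 2) / 2 := by
    rw [← Finset.sum_add_distrib, Finset.sum_div]
    refine Finset.sum_le_sum fun i _ => ?_
    rw [← Finset.sum_add_distrib, Finset.sum_div]
    exact Finset.sum_le_sum fun j _ => by nlinarith [sq_nonneg (b i * b j - A i j)]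
  have e3 : ∑ i, ∑ j, (b i * b j) ^ 2 = B ^ 2 := by
    rw [hB, sq, Finset.sum_mul_sum]
    exact Finset.sum_congr rfl fun i _ => Finset.sum_congr rfl fun j _ => by ring
  rw [e3] at h2
  linarith

end Gibbs

/-- A Hamiltonian that is linear in the Gaussian disorder `g`. -/
def linHam {α κ : Type*} [Fintype κ] (c₀ c₁ : α → ℝ) (s : κ → ℝ → ℝ) (a : κ → α → ℝ)
    (t : ℝ) (g : κ → ℝ) (v : α) : ℝ :=
  c₀ v + t * c₁ v + ∑ k, s k t * (a k v * g k)

section LinHam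

variable {α κ : Type*} [Fintype κ] {S : Finset α} {w c₀ c₁ : α → ℝ} {s : κ → ℝ → ℝ}
  {a : κ → α → ℝ}

theorem continuous_linHam (t : ℝ) (v : α) :
    Continuous fun g : κ → ℝ => linHam c₀ c₁ s a t g v := by
  unfold linHam; fun_prop

theorem hasDerivAt_linHam {s' : κ → ℝ} {t : ℝ} (hs : ∀ k, HasDerivAt (s k) (s' k) t)
    (g : κ → ℝ) (v : α) :
    HasDerivAt (fun t => linHam c₀ c₁ s a t g v) (c₁ v + ∑ k, (s' k * g k) * a k v) t := by
  have h1 : HasDerivAt (fun t : ℝ => c₀ v + t * c₁ v) (1 * c₁ v) t :=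
    ((hasDerivAt_id t).mul_const (c₁ v)).const_add (c₀ v)
  have h2 : HasDerivAt (fun t => ∑ k, s k t * (a k v * g k)) (∑ k, s' k * (a k v * g k)) t :=
    HasDerivAt.fun_sum fun k _ => (hs k).mul_const _
  refine (h1.add h2).congr_deriv ?_
  rw [one_mul]
  congr 1
  exact Finset.sum_congr rfl fun k _ => by ring

theorem hasDerivAt_linHam_update [DecidableEq κ] (t : ℝ) (g : κ → ℝ) (k : κ) (v : α) :
    HasDerivAt (fun u => linHam c₀ c₁ s a t (Function.update g k u) v) (s k t * a k v) (g k) := by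
  have h2 : ∀ l, HasDerivAt (fun u : ℝ => s l t * (a l v * Function.update g k u l))
      (if l = k then s k t * a k v else 0) (g k) := by
    intro l
    by_cases h : l = k
    · subst h
      simpa [mul_assoc] using
        (((hasDerivAt_id (g l)).const_mul (a l v)).const_mul (s l t))
    · simpa [Function.update_of_ne h, h] using
        hasDerivAt_const (g k) (s l t * (a l v * g l))
  have h3 := (HasDerivAt.fun_sum (u := Finset.univ) fun l _ => h2 l).const_add (c₀ v + t * c₁ v)
  simpa [linHam] using h3

theorem integrable_log_gibbsZ_linHam (hw : ∀ v ∈ S, 0 ≤ w v) (hw1 : ∑ v ∈ S, w v = 1) (t : ℝ) :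
    Integrable (fun g : κ → ℝ => log (gibbsZ S w (linHam c₀ c₁ s a t g)))
      (Measure.pi fun _ : κ => gaussianReal 0 1) := by
  refine Integrable.mono'
    (g := fun g => ∑ v ∈ S, (|c₀ v + t * c₁ v| + ∑ k, |s k t * a k v| * |g k|)) ?_ ?_ ?_
  · refine integrable_finsetSum _ fun v _ => (integrable_const _).add ?_
    exact integrable_finsetSum _ fun k _ => (integrable_eval_pi_gaussianReal k).abs.const_mul _
  · exact ((continuous_gibbsZ fun v => continuous_linHam t v).log
      fun g => (gibbsZ_pos hw hw1 _).ne').aestronglyMeasurable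
  · refine Eventually.of_forall fun g => abs_log_gibbsZ_le hw hw1 fun v hv => ?_
    have hle : |linHam c₀ c₁ s a t g v|
        ≤ |c₀ v + t * c₁ v| + ∑ k, |s k t * a k v| * |g k| := by
      refine (abs_add_le _ _).trans (add_le_add le_rfl ?_)
      refine (Finset.abs_sum_le_sum_abs _ _).trans (Finset.sum_le_sum fun k _ => ?_)
      rw [← abs_mul, mul_assoc]
    refine hle.trans (Finset.single_le_sum
      (f := fun v => |c₀ v + t * c₁ v| + ∑ k, |s k t * a k v| * |g k|) (fun u _ => ?_) hv)
    positivity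

/-- The derivative of an averaged log-partition function along a Gaussian interpolation, after
integration by parts. -/
theorem hasDerivAt_integral_log_gibbsZ_linHam
    (hw : ∀ v ∈ S, 0 ≤ w v) (hw1 : ∑ v ∈ S, w v = 1) {s' : κ → ℝ → ℝ} {t : ℝ} {C : ℝ}
    (hs : ∀ᶠ r in 𝓝 t, ∀ k, HasDerivAt (s k) (s' k r) r ∧ |s' k r| ≤ C) :
    HasDerivAt (fun r => ∫ g, log (gibbsZ S w (linHam c₀ c₁ s a r g))
        ∂(Measure.pi fun _ : κ => gaussianReal 0 1))
      (∫ g, (gibbsAvg S w (linHam c₀ c₁ s a t g) c₁ + ∑ k, s' k t * s k t *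
          (gibbsAvg S w (linHam c₀ c₁ s a t g) (fun v => a k v * a k v)
            - gibbsAvg S w (linHam c₀ c₁ s a t g) (a k) ^ 2))
        ∂(Measure.pi fun _ : κ => gaussianReal 0 1)) t := by
  classical
  set P := Measure.pi fun _ : κ => gaussianReal 0 1
  obtain ⟨M₁, hM₁⟩ : ∃ M, ∀ v ∈ S, |c₁ v| ≤ M :=
    ⟨∑ v ∈ S, |c₁ v|, fun v hv =>
      Finset.single_le_sum (f := fun v => |c₁ v|) (fun _ _ => abs_nonneg _) hv⟩
  have hbdd : ∀ f : α → ℝ, ∃ M, ∀ v ∈ S, |f v| ≤ M := fun f =>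
    ⟨∑ v ∈ S, |f v|, fun v hv =>
      Finset.single_le_sum (f := fun v => |f v|) (fun _ _ => abs_nonneg _) hv⟩
  choose M hM using fun k => hbdd (a k)
  choose M₂ hM₂ using fun k => hbdd (fun v => a k v * a k v)
  have hcavg : ∀ f : α → ℝ, Continuous fun g => gibbsAvg S w (linHam c₀ c₁ s a t g) f := fun f =>
    continuous_gibbsAvg hw hw1 (fun v => continuous_linHam t v) fun _ => continuous_const
  have hexp : ∀ r g, gibbsAvg S w (linHam c₀ c₁ s a r g)
      (fun v => c₁ v + ∑ k, (s' k r * g k) * a k v)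
      = gibbsAvg S w (linHam c₀ c₁ s a r g) c₁
        + ∑ k, (s' k r * g k) * gibbsAvg S w (linHam c₀ c₁ s a r g) (a k) := by
    intro r g
    rw [gibbsAvg_add, gibbsAvg_sum]
    simp only [gibbsAvg_const_mul]
  have hdom := hasDerivAt_integral_of_dominated_loc_of_deriv_le (μ := P) (x₀ := t)
    (F := fun r g => log (gibbsZ S w (linHam c₀ c₁ s a r g)))
    (F' := fun r g => gibbsAvg S w (linHam c₀ c₁ s a r g)
      (fun v => c₁ v + ∑ k, (s' k r * g k) * a k v))
    (bound := fun g => M₁ + ∑ k, (C * |g k|) * M k) hs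
    (Eventually.of_forall fun r => (integrable_log_gibbsZ_linHam hw hw1 r).1)
    (integrable_log_gibbsZ_linHam hw hw1 t)
    (continuous_gibbsAvg hw hw1 (fun v => continuous_linHam t v)
      fun _ => by fun_prop).aestronglyMeasurable
    (Eventually.of_forall fun g r hr => by
      rw [hexp, Real.norm_eq_abs]
      refine (abs_add_le _ _).trans (add_le_add (abs_gibbsAvg_le hw hw1 hM₁) ?_)
      refine (Finset.abs_sum_le_sum_abs _ _).trans (Finset.sum_le_sum fun k _ => ?_)
      rw [abs_mul, abs_mul]
      exact mul_le_mul (mul_le_mul_of_nonneg_right (hr k).2 (abs_nonneg _))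
        (abs_gibbsAvg_le hw hw1 (hM k)) (abs_nonneg _)
        (mul_nonneg ((abs_nonneg _).trans (hr k).2) (abs_nonneg _)))
    ((integrable_const _).add (integrable_finsetSum _ fun k _ =>
      ((integrable_eval_pi_gaussianReal k).abs.const_mul C).mul_const (M k)))
    (Eventually.of_forall fun g r hr => hasDerivAt_log_gibbsZ hw hw1 fun v _ =>
      hasDerivAt_linHam (fun k => (hr k).1) g v)
  refine hdom.2.congr_deriv ?_
  have hibp : ∀ k, ∫ g, g k * gibbsAvg S w (linHam c₀ c₁ s a t g) (a k) ∂P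
      = ∫ g, s k t * (gibbsAvg S w (linHam c₀ c₁ s a t g) (fun v => a k v * a k v)
            - gibbsAvg S w (linHam c₀ c₁ s a t g) (a k) ^ 2) ∂P := by
    intro k
    refine integral_eval_mul_pi_gaussianReal k (C := M k)
      (C' := |s k t| * (M₂ k + M k ^ 2)) (fun g => ?_) (hcavg _)
      (continuous_const.mul ((hcavg _).sub ((hcavg _).pow 2)))
      (fun g => abs_gibbsAvg_le hw hw1 (hM k)) (fun g => ?_)
    · have h := hasDerivAt_gibbsAvg hw hw1 (f := a k)
        (h := fun u => linHam c₀ c₁ s a t (Function.update g k u)) (t := g k)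
        fun v _ => hasDerivAt_linHam_update t g k v
      refine h.congr_deriv ?_
      simp only [Function.update_eq_self, mul_assoc, gibbsAvg_const_mul]
      ring
    · rw [abs_mul]
      refine mul_le_mul_of_nonneg_left ((abs_sub _ _).trans (add_le_add ?_ ?_)) (abs_nonneg _)
      · exact abs_gibbsAvg_le hw hw1 (hM₂ k)
      · rw [abs_pow]
        exact pow_le_pow_left₀ (abs_nonneg _) (abs_gibbsAvg_le hw hw1 (hM k)) 2
  have hi₁ : Integrable (fun g => gibbsAvg S w (linHam c₀ c₁ s a t g) c₁) P :=
    Integrable.of_bound (hcavg _).aestronglyMeasurable M₁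
      (Eventually.of_forall fun g => abs_gibbsAvg_le hw hw1 hM₁)
  have hi₂ : ∀ k, Integrable (fun g => s' k t * (g k *
      gibbsAvg S w (linHam c₀ c₁ s a t g) (a k))) P := fun k =>
    ((integrable_eval_pi_gaussianReal k).mul_bdd (hcavg _).aestronglyMeasurable
      (Eventually.of_forall fun g => abs_gibbsAvg_le hw hw1 (hM k))).const_mul _
  have hi₃ : ∀ k, Integrable (fun g => s' k t * (s k t *
      (gibbsAvg S w (linHam c₀ c₁ s a t g) (fun v => a k v * a k v)
        - gibbsAvg S w (linHam c₀ c₁ s a t g) (a k) ^ 2))) P := fun k => by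
    refine (Integrable.const_mul (Integrable.sub ?_ ?_) _).const_mul _
    · exact Integrable.of_bound (hcavg _).aestronglyMeasurable (M₂ k)
        (Eventually.of_forall fun g => abs_gibbsAvg_le hw hw1 (hM₂ k))
    · refine Integrable.of_bound ((hcavg _).pow 2).aestronglyMeasurable (M k ^ 2)
        (Eventually.of_forall fun g => ?_)
      rw [Real.norm_eq_abs, abs_pow]
      exact pow_le_pow_left₀ (abs_nonneg _) (abs_gibbsAvg_le hw hw1 (hM k)) 2
  simp only [hexp]
  simp only [mul_assoc]
  rw [integral_add hi₁ (integrable_finsetSum _ fun k _ => hi₂ k),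
    integral_add hi₁ (integrable_finsetSum _ fun k _ => hi₃ k),
    integral_finsetSum _ (fun k _ => hi₂ k), integral_finsetSum _ (fun k _ => hi₃ k)]
  congr 1
  refine Finset.sum_congr rfl fun k _ => ?_
  rw [integral_const_mul, hibp, ← integral_const_mul]

end LinHam

theorem exists_eventually_hasDerivAt_sqrt_affine {b c t : ℝ}
    (h : b = 0 ∧ c = 0 ∨ 0 < b * t + c) :
    (∃ C, ∀ᶠ r in 𝓝 t, HasDerivAt (fun r => √(b * r + c)) (b / (2 * √(b * r + c))) r ∧
      |b / (2 * √(b * r + c))| ≤ C) ∧ b / (2 * √(b * t + c)) * √(b * t + c) = b / 2 := by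
  rcases h with ⟨rfl, rfl⟩ | h
  · exact ⟨⟨0, Eventually.of_forall fun r => by simpa using hasDerivAt_const r (0 : ℝ)⟩, by simp⟩
  · have hsq : √(b * t + c) ≠ 0 := (Real.sqrt_pos.2 h).ne'
    refine ⟨⟨|b / (2 * √(b * t + c))| + 1, ?_⟩, by field_simp⟩
    have hc : ContinuousAt (fun r => b * r + c) t := by fun_prop
    have hc' : ContinuousAt (fun r => |b / (2 * √(b * r + c))|) t :=
      (continuousAt_const.div (continuousAt_const.mul hc.sqrt)
        (mul_ne_zero two_ne_zero hsq)).abs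
    filter_upwards [hc.eventually (lt_mem_nhds h), hc'.eventually (gt_mem_nhds (lt_add_one _))]
      with r hr hr'
    refine ⟨?_, hr'.le⟩
    have h1 : HasDerivAt (fun r => b * r + c) (b * 1) r :=
      ((hasDerivAt_id r).const_mul b).add_const c
    exact (h1.sqrt hr.ne').congr_deriv (by rw [mul_one])

theorem ae_pi_mem_piFinset {ι : Type*} [Fintype ι] [DecidableEq ι] {p : Measure ℝ}
    [IsProbabilityMeasure p] {s : Finset ℝ} (hs : p (↑s : Set ℝ)ᶜ = 0) :
    ∀ᵐ x ∂(Measure.pi fun _ : ι => p), x ∈ (Fintype.piFinset fun _ : ι => s : Finset (ι → ℝ)) := by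
  simp only [Fintype.mem_piFinset]
  refine ae_all_iff.2 fun i => ?_
  have h : ∀ᵐ y ∂p, y ∈ s := hs
  exact (measurePreserving_eval (fun _ : ι => p) i).quasiMeasurePreserving.ae h

theorem integrable_of_ae_mem_finset_s13 {X : Type*} [MeasurableSpace X] [MeasurableSingletonClass X]
    {μ : Measure X} [IsFiniteMeasure μ] {S : Finset X} (hS : ∀ᵐ x ∂μ, x ∈ S) (f : X → ℝ) :
    Integrable f μ := by
  have h : μ.restrict (S : Set X) = μ := Measure.restrict_eq_self_of_ae_mem (by simpa using hS)
  rw [← h]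
  exact IntegrableOn.finset

theorem integral_of_ae_mem_finset {X : Type*} [MeasurableSpace X] [MeasurableSingletonClass X]
    {μ : Measure X} [IsFiniteMeasure μ] {S : Finset X} (hS : ∀ᵐ x ∂μ, x ∈ S) (f : X → ℝ) :
    ∫ x, f x ∂μ = ∑ x ∈ S, μ.real {x} * f x := by
  have h : μ.restrict (S : Set X) = μ := Measure.restrict_eq_self_of_ae_mem (by simpa using hS)
  conv_lhs => rw [← h]
  exact setIntegral_finset S IntegrableOn.finset

theorem sum_sum_le_two_mul_sum_symIdx {n : ℕ} {f : Fin n → Fin n → ℝ} (hf : ∀ i j, 0 ≤ f i j)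
    (hsymm : ∀ i j, f i j = f j i) :
    ∑ i, ∑ j, f i j ≤ 2 * ∑ q : SymIdx n, f q.1.1 q.1.2 := by
  have e1 : ∑ q : SymIdx n, f q.1.1 q.1.2 = ∑ i, ∑ j, if i ≤ j then f i j else 0 := by
    rw [← Fintype.sum_prod_type' fun i j => if i ≤ j then f i j else 0, ← Finset.sum_filter]
    exact (Finset.sum_subtype _ (by simp) fun q : Fin n × Fin n => f q.1 q.2).symm
  have e2 : ∑ i, ∑ j, (if i ≤ j then f i j else 0) = ∑ i, ∑ j, if j ≤ i then f i j else 0 := by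
    rw [Finset.sum_comm]
    exact Finset.sum_congr rfl fun i _ => Finset.sum_congr rfl fun j _ => by rw [hsymm]
  rw [two_mul, e1]
  nth_rewrite 2 [e2]
  rw [← Finset.sum_add_distrib]
  refine Finset.sum_le_sum fun i _ => ?_
  rw [← Finset.sum_add_distrib]
  refine Finset.sum_le_sum fun j _ => ?_
  have := hf i j
  rcases le_total i j with h | h <;> simp only [h, if_true] <;> split_ifs <;> linarith

/-- The slope in `t` of the variance of the Gaussian field attached to each disorder variable. -/
def fieldSlope (Δ mhat : ℝ) (n : ℕ) : SymIdx n ⊕ Fin n → ℝ :=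
  Sum.elim (fun _ => 1 / (n * Δ)) fun _ => -(mhat / Δ)

/-- The variance at `t = 0` of the Gaussian field attached to each disorder variable. -/
def fieldOffset (Δ mhat : ℝ) (n : ℕ) : SymIdx n ⊕ Fin n → ℝ :=
  Sum.elim (fun _ => 0) fun _ => mhat / Δ

/-- The function of the spins multiplying each disorder variable. -/
def fieldSpin (n : ℕ) : SymIdx n ⊕ Fin n → (Fin n → ℝ) → ℝ :=
  Sum.elim (fun q x => x q.1.1 * x q.1.2) fun i x => x i

/-- The part of the Hamiltonian `HamL` that depends neither on time nor on the disorder. -/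
def staticHam (Δ mhat : ℝ) (n : ℕ) (xs x : Fin n → ℝ) : ℝ :=
  (∑ q : SymIdx n, x q.1.1 * x q.1.2 * xs q.1.1 * xs q.1.2 / (Δ * n))
    - mhat * (∑ i, x i ^ 2) / (2 * Δ)

theorem HamL_eq_linHam {Δ mhat : ℝ} {n : ℕ} (t : ℝ) (xs : Fin n → ℝ)
    (g : SymIdx n ⊕ Fin n → ℝ) :
    HamL Δ mhat n t xs (fun q => g (Sum.inl q)) (fun i => g (Sum.inr i))
      = linHam (staticHam Δ mhat n xs)
          (fun x => ∑ k, -(fieldSlope Δ mhat n k / 2) * (fieldSpin n k x * fieldSpin n k x))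
          (fun k r => √(fieldSlope Δ mhat n k * r + fieldOffset Δ mhat n k))
          (fieldSpin n) t g := by
  ext x
  have r1 : √(1 / (n * Δ) * t + 0) = √(t / (n * Δ)) := by congr 1; ring
  have r2 : √(-(mhat / Δ) * t + mhat / Δ) = √(mhat * (1 - t) / Δ) := by congr 1; ring
  simp only [HamL, linHam, staticHam, fieldSlope, fieldOffset, fieldSpin, Fintype.sum_sum_type,
    Sum.elim_inl, Sum.elim_inr, r1, r2]
  simp only [Finset.sum_add_distrib, Finset.mul_sum, mul_add, Finset.sum_div]
  have e1 : ∑ q : SymIdx n, -(t * x q.1.1 ^ 2 * x q.1.2 ^ 2) / (2 * Δ * n)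
      = ∑ q : SymIdx n, t * (-(1 / (n * Δ) / 2) * (x q.1.1 * x q.1.2 * (x q.1.1 * x q.1.2))) :=
    Finset.sum_congr rfl fun q _ => by
      rw [neg_div, div_eq_mul_inv, one_div, mul_inv, mul_inv, mul_inv]; ring
  have e2 : ∑ q : SymIdx n, √(t / (n * Δ)) * x q.1.1 * x q.1.2 * g (Sum.inl q)
      = ∑ q : SymIdx n, √(t / (n * Δ)) * (x q.1.1 * x q.1.2 * g (Sum.inl q)) :=
    Finset.sum_congr rfl fun q _ => by ring
  have e3 : ∑ i, (1 - t) * mhat * x i ^ 2 / (2 * Δ)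
      = ∑ i, mhat * x i ^ 2 / (2 * Δ) - ∑ i, t * (-(-(mhat / Δ) / 2) * (x i * x i)) := by
    rw [← Finset.sum_sub_distrib]
    exact Finset.sum_congr rfl fun i _ => by
      rw [div_eq_mul_inv, div_eq_mul_inv, div_eq_mul_inv, mul_inv]; ring
  rw [e1, e2, e3]
  ring

theorem continuous_HamL (Δ mhat : ℝ) (n : ℕ) (t : ℝ) (x : Fin n → ℝ) :
    Continuous fun ω : (Fin n → ℝ) × (SymIdx n → ℝ) × (Fin n → ℝ) =>
      HamL Δ mhat n t ω.1 ω.2.1 ω.2.2 x := by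
  unfold HamL; fun_prop

theorem sum_fieldSlope_mul_sq_gibbsAvg_le {Δ mhat : ℝ} (hΔ : 0 < Δ) {n : ℕ} (hn : 1 ≤ n)
    {S : Finset (Fin n → ℝ)} {w : (Fin n → ℝ) → ℝ} (hw : ∀ v ∈ S, 0 ≤ w v)
    (hw1 : ∑ v ∈ S, w v = 1) (h : (Fin n → ℝ) → ℝ) :
    ∑ k, -(fieldSlope Δ mhat n k / 2) * gibbsAvg S w h (fieldSpin n k) ^ 2
      ≤ n * (mhat ^ 2 / (4 * Δ)) := by
  have h1 := sum_sum_le_two_mul_sum_symIdx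
    (f := fun i j => gibbsAvg S w h (fun x => x i * x j) ^ 2) (fun _ _ => sq_nonneg _)
    (fun i j => by simp only [mul_comm])
  have h2 := sq_sum_sq_gibbsAvg_le hw hw1 h (fun x : Fin n → ℝ => x)
  simp only [fieldSlope, fieldSpin, Fintype.sum_sum_type, Sum.elim_inl, Sum.elim_inr,
    ← Finset.mul_sum]
  have h3 := h2.trans h1
  clear h1 h2
  generalize ∑ i, gibbsAvg S w h (fun x => x i) ^ 2 = B at h3 ⊢
  generalize ∑ q : SymIdx n, gibbsAvg S w h (fun x => x q.1.1 * x q.1.2) ^ 2 = T at h3 ⊢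
  have hn' : (0 : ℝ) < n := by exact_mod_cast hn
  have e : n * (mhat ^ 2 / (4 * Δ)) - (-(1 / (n * Δ) / 2) * T + -(-(mhat / Δ) / 2) * B)
      = ((n * mhat - B) ^ 2 + (2 * T - B ^ 2)) / (4 * (n * Δ)) := by
    field_simp
    ring
  have : 0 ≤ ((n * mhat - B) ^ 2 + (2 * T - B ^ 2)) / (4 * (n * Δ)) :=
    div_nonneg (by nlinarith [sq_nonneg (n * mhat - B)]) (by positivity)
  linarith

/-- The averaged log-partition function as a finite sum over the planted signal. -/
theorem FavgL_eq_sum {p : Measure ℝ} [IsProbabilityMeasure p] {Δ mhat : ℝ} {n : ℕ}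
    {S : Finset (Fin n → ℝ)} (hS : ∀ᵐ x ∂(Measure.pi fun _ : Fin n => p), x ∈ S)
    (hw1 : ∑ x ∈ S, (Measure.pi fun _ : Fin n => p).real {x} = 1) (t : ℝ) :
    FavgL p Δ mhat n t = ∑ xs ∈ S, (Measure.pi fun _ : Fin n => p).real {xs} *
      ∫ g, log (gibbsZ S (fun x => (Measure.pi fun _ : Fin n => p).real {x})
        (linHam (staticHam Δ mhat n xs)
          (fun x => ∑ k, -(fieldSlope Δ mhat n k / 2) * (fieldSpin n k x * fieldSpin n k x))
          (fun k r => √(fieldSlope Δ mhat n k * r + fieldOffset Δ mhat n k))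
          (fieldSpin n) t g))
        ∂(Measure.pi fun _ : SymIdx n ⊕ Fin n => gaussianReal 0 1) := by
  have hw : ∀ x ∈ S, 0 ≤ (Measure.pi fun _ : Fin n => p).real {x} := fun _ _ => measureReal_nonneg
  have hmp := measurePreserving_sumPiEquivProdPi
    (fun _ : SymIdx n ⊕ Fin n => gaussianReal 0 1)
  have hcont : Continuous fun ω : (Fin n → ℝ) × (SymIdx n → ℝ) × (Fin n → ℝ) =>
      log (gibbsZ S (fun x => (Measure.pi fun _ : Fin n => p).real {x})
        (HamL Δ mhat n t ω.1 ω.2.1 ω.2.2)) :=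
    (continuous_gibbsZ fun x => continuous_HamL Δ mhat n t x).log
      fun ω => (gibbsZ_pos hw hw1 _).ne'
  have hZ : ∀ xs ξ z, ZtL p Δ mhat n t xs ξ z
      = gibbsZ S (fun x => (Measure.pi fun _ : Fin n => p).real {x})
        (HamL Δ mhat n t xs ξ z) := fun xs ξ z =>
    integral_of_ae_mem_finset hS _
  simp only [FavgL, hZ, baseP]
  rw [integral_prod, integral_of_ae_mem_finset hS]
  · refine Finset.sum_congr rfl fun xs _ => ?_
    rw [← hmp.integral_comp']
    simp only [← HamL_eq_linHam]
    rfl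
  · refine (integrable_prod_iff hcont.aestronglyMeasurable).2
      ⟨Eventually.of_forall fun xs => ?_, integrable_of_ae_mem_finset_s13 hS _⟩
    rw [← hmp.integrable_comp_emb (MeasurableEquiv.measurableEmbedding _)]
    have h := integrable_log_gibbsZ_linHam (c₀ := staticHam Δ mhat n xs)
      (c₁ := fun x => ∑ k, -(fieldSlope Δ mhat n k / 2) * (fieldSpin n k x * fieldSpin n k x))
      (s := fun k r => √(fieldSlope Δ mhat n k * r + fieldOffset Δ mhat n k))
      (a := fieldSpin n) hw hw1 t
    simp only [← HamL_eq_linHam] at h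
    exact h

/-- **Lower-bound interpolation lemma** : for every `n ≥ 1` and `t ∈ (0,1)`,
`t ↦ E[log Z̃_t]` is differentiable and `−(1/n)(d/dt)E[log Z̃_t] ≥ −m̂²/(4Δ)`,
i.e. `(1/n)(d/dt)E[log Z̃_t] ≤ m̂²/(4Δ)`. -/
theorem interpolation_derivative_upper_bound
    (p : Measure ℝ) [IsProbabilityMeasure p]
    (hsupp : ∃ s : Finset ℝ, p (↑s : Set ℝ)ᶜ = 0)
    (Δ : ℝ) (hΔ : 0 < Δ) (mhat : ℝ) (hmhat : 0 ≤ mhat)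
    (n : ℕ) (hn : 1 ≤ n) (t : ℝ) (ht : t ∈ Set.Ioo (0 : ℝ) 1) :
    DifferentiableAt ℝ (FavgL p Δ mhat n) t ∧
      (1 / n) * deriv (FavgL p Δ mhat n) t ≤ mhat ^ 2 / (4 * Δ) := by
  obtain ⟨s, hs⟩ := hsupp
  set μ : Measure (Fin n → ℝ) := Measure.pi fun _ : Fin n => p
  set S : Finset (Fin n → ℝ) := Fintype.piFinset fun _ => s
  have hS : ∀ᵐ x ∂μ, x ∈ S := ae_pi_mem_piFinset hs
  set w : (Fin n → ℝ) → ℝ := fun x => μ.real {x}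
  have hw : ∀ x ∈ S, 0 ≤ w x := fun _ _ => measureReal_nonneg
  have hw1 : ∑ x ∈ S, w x = 1 := by
    have h := integral_of_ae_mem_finset hS fun _ => (1 : ℝ)
    simp only [integral_const, probReal_univ, smul_eq_mul, mul_one] at h
    exact h.symm
  have hn' : (0 : ℝ) < n := by exact_mod_cast hn
  have haff : ∀ k, fieldSlope Δ mhat n k = 0 ∧ fieldOffset Δ mhat n k = 0 ∨
      0 < fieldSlope Δ mhat n k * t + fieldOffset Δ mhat n k := by
    rintro (q | i)
    · right
      have := ht.1
      simp only [fieldSlope, fieldOffset, Sum.elim_inl, add_zero]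
      positivity
    · simp only [fieldSlope, fieldOffset, Sum.elim_inr]
      rcases hmhat.eq_or_lt with h | h
      · left; simp [← h]
      · right
        have : 0 < mhat / Δ * (1 - t) := mul_pos (div_pos h hΔ) (sub_pos.2 ht.2)
        linarith
  choose C hC using fun k => (exists_eventually_hasDerivAt_sqrt_affine (haff k)).1
  have hev : ∀ᶠ r in 𝓝 t, ∀ k,
      HasDerivAt (fun r => √(fieldSlope Δ mhat n k * r + fieldOffset Δ mhat n k))
        (fieldSlope Δ mhat n k / (2 * √(fieldSlope Δ mhat n k * r + fieldOffset Δ mhat n k))) r ∧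
      |fieldSlope Δ mhat n k / (2 * √(fieldSlope Δ mhat n k * r + fieldOffset Δ mhat n k))|
        ≤ ∑ l, |C l| := by
    refine eventually_all.2 fun k => (hC k).mono fun r hr => ⟨hr.1, hr.2.trans ?_⟩
    exact (le_abs_self _).trans (Finset.single_le_sum (f := fun l => |C l|)
      (fun _ _ => abs_nonneg _) (Finset.mem_univ k))
  have hder := HasDerivAt.fun_sum (u := S) fun xs _ =>
    (hasDerivAt_integral_log_gibbsZ_linHam (c₀ := staticHam Δ mhat n xs)
      (c₁ := fun x => ∑ k, -(fieldSlope Δ mhat n k / 2) * (fieldSpin n k x * fieldSpin n k x))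
      (a := fieldSpin n) hw hw1 hev).const_mul (w xs)
  rw [← funext fun r => FavgL_eq_sum hS hw1 r] at hder
  refine ⟨hder.differentiableAt, ?_⟩
  rw [hder.deriv, one_div, inv_mul_le_iff₀ hn']
  have hB : 0 ≤ n * (mhat ^ 2 / (4 * Δ)) := by positivity
  have hle : ∀ f : (SymIdx n ⊕ Fin n → ℝ) → ℝ, (∀ g, f g ≤ n * (mhat ^ 2 / (4 * Δ))) →
      ∫ g, f g ∂(Measure.pi fun _ : SymIdx n ⊕ Fin n => gaussianReal 0 1)
        ≤ n * (mhat ^ 2 / (4 * Δ)) := by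
    intro f hf
    by_cases hi : Integrable f (Measure.pi fun _ : SymIdx n ⊕ Fin n => gaussianReal 0 1)
    · simpa using integral_mono hi (integrable_const _) hf
    · rwa [integral_undef hi]
  calc _ ≤ ∑ xs ∈ S, w xs * (n * (mhat ^ 2 / (4 * Δ))) := by
        refine Finset.sum_le_sum fun xs hxs =>
          mul_le_mul_of_nonneg_left (hle _ fun g => ?_) (hw xs hxs)
        refine le_of_eq_of_le ?_ (sum_fieldSlope_mul_sq_gibbsAvg_le hΔ hn hw hw1
          (linHam (staticHam Δ mhat n xs)
            (fun x => ∑ k, -(fieldSlope Δ mhat n k / 2) * (fieldSpin n k x * fieldSpin n k x))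
            (fun k r => √(fieldSlope Δ mhat n k * r + fieldOffset Δ mhat n k)) (fieldSpin n) t g))
        rw [gibbsAvg_sum, ← Finset.sum_add_distrib]
        refine Finset.sum_congr rfl fun k _ => ?_
        rw [gibbsAvg_const_mul, (exists_eventually_hasDerivAt_sqrt_affine (haff k)).2]
        ring
    _ = n * (mhat ^ 2 / (4 * Δ)) := by rw [← Finset.sum_mul, hw1, one_mul]
end
end

section
/- If m̂ > 0 satisfies i_B′(m̂) = 0, then m̂ is a stationary point of i_L, i.e. i_L′(m̂) = 0. -/
open MeasureTheory ProbabilityTheory Real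

noncomputable section

/-- The Bethe mutual information `i_B(m)`. -/
def iB (p : Measure ℝ) (Δ m : ℝ) : ℝ :=
  (m ^ 2 + (∫ x, x ^ 2 ∂p) ^ 2) / (4 * Δ)
    - ∫ w : ℝ × ℝ, Jf p (m / Δ) (m * w.1 / Δ + Real.sqrt (m / Δ) * w.2)
        ∂(p.prod (gaussianReal 0 1))

/-- The lower-bound functional `i_L(m)` built from `m̂`. -/
def iL (p : Measure ℝ) (Δ mhat m : ℝ) : ℝ :=
  (2 * m ^ 2 - mhat ^ 2 + (∫ x, x ^ 2 ∂p) ^ 2) / (4 * Δ)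
    - ∫ w : ℝ × ℝ, Jf p (mhat / Δ) (m * w.1 / Δ + Real.sqrt (mhat / Δ) * w.2)
        ∂(p.prod (gaussianReal 0 1))

open Filter Topology

lemma integrable_standardGaussian_iff (f : ℝ → ℝ) :
    Integrable f (gaussianReal 0 1) ↔ Integrable (fun z ↦ gaussianPDFReal 0 1 z * f z) := by
  rw [gaussianReal_of_var_ne_zero 0 one_ne_zero,
    integrable_withDensity_iff_integrable_smul' (measurable_gaussianPDF 0 1)
      (.of_forall fun _ ↦ gaussianPDF_lt_top)]
  simp [toReal_gaussianPDF]

lemma integral_standardGaussian (f : ℝ → ℝ) :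
    ∫ z, f z ∂gaussianReal 0 1 = ∫ z, gaussianPDFReal 0 1 z * f z := by
  simpa using integral_gaussianReal_eq_integral_smul (μ := 0) (f := f) one_ne_zero

lemma hasDerivAt_standardGaussianPDFReal (z : ℝ) :
    HasDerivAt (gaussianPDFReal 0 1) (-(z * gaussianPDFReal 0 1 z)) z := by
  have h : HasDerivAt (fun z : ℝ ↦ -(z - 0) ^ 2 / (2 * ((1 : NNReal) : ℝ))) (-z) z := by
    have := (((hasDerivAt_id z).sub_const 0).pow 2).neg.div_const (2 * ((1 : NNReal) : ℝ))
    convert! this using 1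
    simp
    ring
  rw [gaussianPDFReal_def]
  convert! (h.exp.const_mul (√(2 * π * ((1 : NNReal) : ℝ)))⁻¹) using 1
  ring

/-- Gaussian integration by parts (Stein's identity). -/
lemma integral_mul_standardGaussian {h h' : ℝ → ℝ} (hh : ∀ z, HasDerivAt h (h' z) z)
    (h_int : Integrable h (gaussianReal 0 1)) (h_int' : Integrable h' (gaussianReal 0 1))
    (hz_int : Integrable (fun z ↦ z * h z) (gaussianReal 0 1)) :
    ∫ z, z * h z ∂gaussianReal 0 1 = ∫ z, h' z ∂gaussianReal 0 1 := by
  rw [integrable_standardGaussian_iff] at h_int h_int' hz_int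
  have key := integral_mul_deriv_eq_deriv_mul_of_integrable (u := h) (u' := h')
    (fun z _ ↦ hh z) (fun z _ ↦ hasDerivAt_standardGaussianPDFReal z)
    (hz_int.neg.congr (.of_forall fun z ↦ by simp; ring))
    (h_int'.congr (.of_forall fun z ↦ by simp; ring))
    (h_int.congr (.of_forall fun z ↦ by simp; ring))
  rw [integral_standardGaussian, integral_standardGaussian]
  calc ∫ z, gaussianPDFReal 0 1 z * (z * h z)
      = -∫ z, h z * -(z * gaussianPDFReal 0 1 z) := by
        rw [← integral_neg]; congr 1 with z; ring
    _ = ∫ z, gaussianPDFReal 0 1 z * h' z := by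
        rw [key, neg_neg]; congr 1 with z; ring

/-- The Cameron–Martin formula for a standard Gaussian variable. -/
lemma integral_add_standardGaussian (f : ℝ → ℝ) (b : ℝ) :
    ∫ z, f (z + b) ∂gaussianReal 0 1
      = ∫ z, f z * exp (b * z - b ^ 2 / 2) ∂gaussianReal 0 1 := by
  rw [integral_standardGaussian, integral_standardGaussian,
    ← integral_add_right_eq_self
      (fun z ↦ gaussianPDFReal 0 1 z * (f z * exp (b * z - b ^ 2 / 2))) b]
  congr 1 with z
  have : gaussianPDFReal 0 1 z
      = gaussianPDFReal 0 1 (z + b) * exp (b * (z + b) - b ^ 2 / 2) := by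
    simp only [gaussianPDFReal]
    rw [mul_assoc _ (exp _), ← exp_add]
    congr 2
    simp
    ring
  rw [this]; ring

/-- The unnormalised `k`-th moment `∑ w x * x ^ k * exp (B x - A x² / 2)` of the weights `w`
tilted by the fields `A` and `B`. -/
def tiltedMoment (s : Finset ℝ) (w : ℝ → ℝ) (k : ℕ) (A B : ℝ) : ℝ :=
  ∑ x ∈ s, w x * x ^ k * exp (B * x - A * x ^ 2 / 2)

/-- The `k`-th moment of the normalised tilted weights. -/
def gibbsMoment (s : Finset ℝ) (w : ℝ → ℝ) (k : ℕ) (A B : ℝ) : ℝ :=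
  tiltedMoment s w k A B / tiltedMoment s w 0 A B

section Gibbs

variable {s : Finset ℝ} {w : ℝ → ℝ}

@[fun_prop]
lemma continuous_tiltedMoment {X : Type*} [TopologicalSpace X] (k : ℕ) {A B : X → ℝ}
    (hA : Continuous A) (hB : Continuous B) :
    Continuous fun t ↦ tiltedMoment s w k (A t) (B t) := by
  unfold tiltedMoment
  fun_prop

lemma tiltedMoment_zero_pos (hw : ∀ x ∈ s, 0 ≤ w x) (hw1 : ∑ x ∈ s, w x = 1) (A B : ℝ) :
    0 < tiltedMoment s w 0 A B := by
  obtain ⟨x, hx, hne⟩ : ∃ x ∈ s, w x ≠ 0 :=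
    Finset.exists_ne_zero_of_sum_ne_zero (by rw [hw1]; exact one_ne_zero)
  refine Finset.sum_pos' (fun y hy ↦ ?_) ⟨x, hx, ?_⟩
  · have := hw y hy; positivity
  · have := (hw x hx).lt_of_ne' hne; positivity

lemma continuous_gibbsMoment (hw : ∀ x ∈ s, 0 ≤ w x) (hw1 : ∑ x ∈ s, w x = 1)
    {X : Type*} [TopologicalSpace X] (k : ℕ) {A B : X → ℝ}
    (hA : Continuous A) (hB : Continuous B) :
    Continuous fun t ↦ gibbsMoment s w k (A t) (B t) :=
  (continuous_tiltedMoment k hA hB).div (continuous_tiltedMoment 0 hA hB)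
    fun _ ↦ (tiltedMoment_zero_pos hw hw1 _ _).ne'

lemma continuous_log_tiltedMoment (hw : ∀ x ∈ s, 0 ≤ w x) (hw1 : ∑ x ∈ s, w x = 1)
    {X : Type*} [TopologicalSpace X] {A B : X → ℝ}
    (hA : Continuous A) (hB : Continuous B) :
    Continuous fun t ↦ log (tiltedMoment s w 0 (A t) (B t)) :=
  (continuous_tiltedMoment 0 hA hB).log fun _ ↦ (tiltedMoment_zero_pos hw hw1 _ _).ne'

lemma abs_gibbsMoment_le (hw : ∀ x ∈ s, 0 ≤ w x) (hw1 : ∑ x ∈ s, w x = 1) {R : ℝ}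
    (hR : ∀ x ∈ s, |x| ≤ R) (k : ℕ) (A B : ℝ) : |gibbsMoment s w k A B| ≤ R ^ k := by
  have hpos := tiltedMoment_zero_pos hw hw1 A B
  rw [gibbsMoment, abs_div, abs_of_pos hpos, div_le_iff₀ hpos, tiltedMoment, tiltedMoment,
    Finset.mul_sum]
  refine (Finset.abs_sum_le_sum_abs _ _).trans (Finset.sum_le_sum fun x hx ↦ ?_)
  have hwx := hw x hx
  rw [abs_mul, abs_mul, abs_exp, abs_of_nonneg hwx, abs_pow, pow_zero, mul_one, mul_comm (w x),
    mul_assoc]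
  gcongr
  exact hR x hx

lemma abs_log_tiltedMoment_le (hw : ∀ x ∈ s, 0 ≤ w x) (hw1 : ∑ x ∈ s, w x = 1) {R : ℝ}
    (hR : ∀ x ∈ s, |x| ≤ R) (A B : ℝ) :
    |log (tiltedMoment s w 0 A B)| ≤ |B| * R + |A| * R ^ 2 / 2 := by
  have hpos := tiltedMoment_zero_pos hw hw1 A B
  have hK : ∀ x ∈ s, |B * x - A * x ^ 2 / 2| ≤ |B| * R + |A| * R ^ 2 / 2 := fun x hx ↦ by
    refine (abs_sub _ _).trans ?_
    rw [abs_mul, abs_div, abs_mul, abs_pow, abs_two]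
    gcongr <;> exact hR x hx
  have hconst : ∀ c : ℝ, ∑ x ∈ s, w x * x ^ 0 * c = c := fun c ↦ by
    simp [← Finset.sum_mul, hw1]
  rw [abs_le, le_log_iff_exp_le hpos, log_le_iff_le_exp hpos, tiltedMoment]
  constructor
  · conv_lhs => rw [← hconst (exp _)]
    refine Finset.sum_le_sum fun x hx ↦ ?_
    have := hw x hx
    gcongr
    exact (abs_le.1 (hK x hx)).1
  · conv_rhs => rw [← hconst (exp _)]
    refine Finset.sum_le_sum fun x hx ↦ ?_
    have := hw x hx
    gcongr
    exact (abs_le.1 (hK x hx)).2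

lemma hasDerivAt_tiltedMoment (k : ℕ) {A B : ℝ → ℝ} {A' B' t : ℝ}
    (hA : HasDerivAt A A' t) (hB : HasDerivAt B B' t) :
    HasDerivAt (fun t ↦ tiltedMoment s w k (A t) (B t))
      (B' * tiltedMoment s w (k + 1) (A t) (B t)
        - A' / 2 * tiltedMoment s w (k + 2) (A t) (B t)) t := by
  unfold tiltedMoment
  have h : ∀ x ∈ s, HasDerivAt (fun t ↦ w x * x ^ k * exp (B t * x - A t * x ^ 2 / 2))
      (w x * x ^ k * (exp (B t * x - A t * x ^ 2 / 2) * (B' * x - A' * x ^ 2 / 2))) t :=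
    fun x _ ↦ ((hB.mul_const x).sub ((hA.mul_const (x ^ 2)).div_const 2)).exp.const_mul _
  convert! HasDerivAt.fun_sum h using 1
  rw [Finset.mul_sum, Finset.mul_sum, ← Finset.sum_sub_distrib]
  refine Finset.sum_congr rfl fun x _ ↦ ?_
  ring

lemma hasDerivAt_log_tiltedMoment (hw : ∀ x ∈ s, 0 ≤ w x) (hw1 : ∑ x ∈ s, w x = 1)
    {A B : ℝ → ℝ} {A' B' t : ℝ} (hA : HasDerivAt A A' t) (hB : HasDerivAt B B' t) :
    HasDerivAt (fun t ↦ log (tiltedMoment s w 0 (A t) (B t)))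
      (B' * gibbsMoment s w 1 (A t) (B t) - A' / 2 * gibbsMoment s w 2 (A t) (B t)) t := by
  convert! (hasDerivAt_tiltedMoment 0 hA hB).log (tiltedMoment_zero_pos hw hw1 _ _).ne' using 1
  simp only [gibbsMoment]
  ring

lemma hasDerivAt_gibbsMoment_one (hw : ∀ x ∈ s, 0 ≤ w x) (hw1 : ∑ x ∈ s, w x = 1)
    (A : ℝ) {B : ℝ → ℝ} {B' t : ℝ} (hB : HasDerivAt B B' t) :
    HasDerivAt (fun t ↦ gibbsMoment s w 1 A (B t))
      (B' * (gibbsMoment s w 2 A (B t) - gibbsMoment s w 1 A (B t) ^ 2)) t := by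
  have hne := (tiltedMoment_zero_pos hw hw1 A (B t)).ne'
  convert! (hasDerivAt_tiltedMoment 1 (hasDerivAt_const t A) hB).div
    (hasDerivAt_tiltedMoment 0 (hasDerivAt_const t A) hB) hne using 1
  simp only [gibbsMoment]
  field_simp
  ring

lemma integrable_gibbsMoment (hw : ∀ x ∈ s, 0 ≤ w x) (hw1 : ∑ x ∈ s, w x = 1) {R : ℝ}
    (hR : ∀ x ∈ s, |x| ≤ R) (k : ℕ) (A b c : ℝ) :
    Integrable (fun z ↦ gibbsMoment s w k A (b + c * z)) (gaussianReal 0 1) :=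
  .of_bound (continuous_gibbsMoment hw hw1 k (by fun_prop) (by fun_prop)).aestronglyMeasurable
    (R ^ k) (.of_forall fun _ ↦ abs_gibbsMoment_le hw hw1 hR k _ _)

lemma integrable_gibbsMoment_sq (hw : ∀ x ∈ s, 0 ≤ w x) (hw1 : ∑ x ∈ s, w x = 1) {R : ℝ}
    (hR : ∀ x ∈ s, |x| ≤ R) (k : ℕ) (A b c : ℝ) :
    Integrable (fun z ↦ gibbsMoment s w k A (b + c * z) ^ 2) (gaussianReal 0 1) := by
  refine .of_bound
    ((continuous_gibbsMoment hw hw1 k (by fun_prop) (by fun_prop)).pow 2).aestronglyMeasurable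
    ((R ^ k) ^ 2) (.of_forall fun z ↦ ?_)
  rw [norm_pow]
  gcongr
  exact abs_gibbsMoment_le hw hw1 hR k _ _

lemma integrable_id_standardGaussian : Integrable (fun z : ℝ ↦ z) (gaussianReal 0 1) :=
  (memLp_id_gaussianReal 1).integrable (by simp)

lemma integrable_mul_gibbsMoment (hw : ∀ x ∈ s, 0 ≤ w x) (hw1 : ∑ x ∈ s, w x = 1) {R : ℝ}
    (hR : ∀ x ∈ s, |x| ≤ R) (k : ℕ) (A b c : ℝ) :
    Integrable (fun z ↦ z * gibbsMoment s w k A (b + c * z)) (gaussianReal 0 1) :=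
  integrable_id_standardGaussian.mul_bdd (c := R ^ k)
    (continuous_gibbsMoment hw hw1 k (by fun_prop) (by fun_prop)).aestronglyMeasurable
    (.of_forall fun _ ↦ abs_gibbsMoment_le hw hw1 hR k _ _)

lemma integrable_log_tiltedMoment (hw : ∀ x ∈ s, 0 ≤ w x) (hw1 : ∑ x ∈ s, w x = 1) {R : ℝ}
    (hR : ∀ x ∈ s, |x| ≤ R) (A b c : ℝ) :
    Integrable (fun z ↦ log (tiltedMoment s w 0 A (b + c * z))) (gaussianReal 0 1) := by
  have hB : Integrable (fun z : ℝ ↦ b + c * z) (gaussianReal 0 1) :=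
    (integrable_const b).add (integrable_id_standardGaussian.const_mul c)
  exact ((hB.abs.mul_const R).add (integrable_const (|A| * R ^ 2 / 2))).mono'
    (continuous_log_tiltedMoment hw hw1 (by fun_prop) (by fun_prop)).aestronglyMeasurable
    (.of_forall fun _ ↦ abs_log_tiltedMoment_le hw hw1 hR _ _)

/-- Stein's identity for the Gibbs mean. -/
lemma integral_mul_gibbsMoment_one (hw : ∀ x ∈ s, 0 ≤ w x) (hw1 : ∑ x ∈ s, w x = 1)
    (A b c : ℝ) :
    ∫ z, z * gibbsMoment s w 1 A (b + c * z) ∂gaussianReal 0 1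
      = c * (∫ z, gibbsMoment s w 2 A (b + c * z) ∂gaussianReal 0 1
          - ∫ z, gibbsMoment s w 1 A (b + c * z) ^ 2 ∂gaussianReal 0 1) := by
  obtain ⟨R, hR⟩ : ∃ R, ∀ x ∈ s, |x| ≤ R :=
    (s.finite_toSet.isCompact.exists_bound_of_continuousOn continuousOn_id)
  have h2 := integrable_gibbsMoment hw hw1 hR 2 A b c
  have h1 := integrable_gibbsMoment_sq hw hw1 hR 1 A b c
  rw [← integral_sub h2 h1, ← integral_const_mul]
  refine integral_mul_standardGaussian
    (fun z ↦ hasDerivAt_gibbsMoment_one hw hw1 A ?_)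
    (integrable_gibbsMoment hw hw1 hR 1 A b c) ((h2.sub h1).const_mul c)
    (integrable_mul_gibbsMoment hw hw1 hR 1 A b c)
  simpa using ((hasDerivAt_id z).const_mul c).const_add b

/-- Change of measure from the planted model to the null model, for an observable `f` of the
field `c² x + c z`. -/
lemma sum_integral_planted {f : ℝ → ℝ} (hf : Continuous f) {K : ℝ} (hK : ∀ y, |f y| ≤ K)
    (k : ℕ) (c : ℝ) :
    ∑ x ∈ s, w x * (x ^ k * ∫ z, f (c ^ 2 * x + c * z) ∂gaussianReal 0 1)
      = ∫ z, f (c * z) * tiltedMoment s w k (c ^ 2) (c * z) ∂gaussianReal 0 1 := by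
  have h_int : ∀ x ∈ s, Integrable
      (fun z ↦ f (c * z) * (w x * x ^ k * exp (c * z * x - c ^ 2 * x ^ 2 / 2)))
      (gaussianReal 0 1) := fun x _ ↦ by
    have : Integrable (fun z ↦ w x * x ^ k * exp (-(c ^ 2 * x ^ 2 / 2)) * exp (c * x * z))
      (gaussianReal 0 1) := (integrable_exp_mul_gaussianReal (c * x)).const_mul _
    refine (this.bdd_mul (c := K) (f := fun z ↦ f (c * z))
      (hf.comp (by fun_prop)).aestronglyMeasurable (.of_forall fun z ↦ hK _)).congr
      (.of_forall fun z ↦ ?_)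
    simp only
    rw [mul_assoc (w x * x ^ k), ← exp_add]
    ring_nf
  simp only [tiltedMoment, Finset.mul_sum]
  rw [integral_finsetSum _ h_int]
  refine Finset.sum_congr rfl fun x _ ↦ ?_
  have hshift := integral_add_standardGaussian (fun z ↦ f (c * z)) (c * x)
  rw [← mul_assoc, show (fun z ↦ f (c ^ 2 * x + c * z)) = fun z ↦ f (c * (z + c * x)) by
    ext z; ring_nf, hshift, ← integral_const_mul]
  congr 1 with z
  ring_nf

/-- The Nishimori identity: the overlap of the Gibbs mean with the signal equals the mean of the
squared Gibbs mean. -/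
lemma nishimori (hw : ∀ x ∈ s, 0 ≤ w x) (hw1 : ∑ x ∈ s, w x = 1) (c : ℝ) :
    ∑ x ∈ s, w x * ∫ z, gibbsMoment s w 1 (c ^ 2) (c ^ 2 * x + c * z) ^ 2 ∂gaussianReal 0 1
      = ∑ x ∈ s, w x *
          (x * ∫ z, gibbsMoment s w 1 (c ^ 2) (c ^ 2 * x + c * z) ∂gaussianReal 0 1) := by
  obtain ⟨R, hR⟩ : ∃ R, ∀ x ∈ s, |x| ≤ R :=
    (s.finite_toSet.isCompact.exists_bound_of_continuousOn continuousOn_id)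
  have hcont : Continuous fun y ↦ gibbsMoment s w 1 (c ^ 2) y :=
    continuous_gibbsMoment hw hw1 1 (by fun_prop) (by fun_prop)
  have hle : ∀ y, |gibbsMoment s w 1 (c ^ 2) y| ≤ R ^ 1 :=
    abs_gibbsMoment_le hw hw1 hR 1 _
  have h1 := sum_integral_planted (s := s) (w := w) hcont hle 1 c
  have h2 := sum_integral_planted (s := s) (w := w)
    (f := fun y ↦ gibbsMoment s w 1 (c ^ 2) y ^ 2) (hcont.pow 2) (K := (R ^ 1) ^ 2)
    (fun y ↦ by rw [abs_pow]; gcongr; exact hle y) 0 c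
  simp only [pow_one, pow_zero, one_mul] at h1 h2
  rw [h1, h2]
  congr 1 with z
  have hne := (tiltedMoment_zero_pos hw hw1 (c ^ 2) (c * z)).ne'
  simp only [gibbsMoment]
  field_simp

/-- Differentiation of the averaged log-partition function along a path of fields. -/
lemma hasDerivAt_integral_log_tiltedMoment (hw : ∀ x ∈ s, 0 ≤ w x) (hw1 : ∑ x ∈ s, w x = 1)
    {A b c A' b' c' : ℝ → ℝ} {t : ℝ}
    (hA : ∀ᶠ u in 𝓝 t, HasDerivAt A (A' u) u) (hb : ∀ᶠ u in 𝓝 t, HasDerivAt b (b' u) u)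
    (hc : ∀ᶠ u in 𝓝 t, HasDerivAt c (c' u) u)
    (hA' : ContinuousAt A' t) (hb' : ContinuousAt b' t) (hc' : ContinuousAt c' t) :
    HasDerivAt
      (fun u ↦ ∫ z, log (tiltedMoment s w 0 (A u) (b u + c u * z)) ∂gaussianReal 0 1)
      (b' t * ∫ z, gibbsMoment s w 1 (A t) (b t + c t * z) ∂gaussianReal 0 1
        + c' t * ∫ z, z * gibbsMoment s w 1 (A t) (b t + c t * z) ∂gaussianReal 0 1
        - A' t / 2 * ∫ z, gibbsMoment s w 2 (A t) (b t + c t * z) ∂gaussianReal 0 1) t := by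
  obtain ⟨R, hR⟩ : ∃ R, ∀ x ∈ s, |x| ≤ R :=
    (s.finite_toSet.isCompact.exists_bound_of_continuousOn continuousOn_id)
  have hbd : ∀ {g : ℝ → ℝ}, ContinuousAt g t → ∀ᶠ u in 𝓝 t, |g u| ≤ |g t| + 1 := fun hg ↦
    (hg.abs.eventually_lt continuousAt_const (by linarith)).mono fun _ ↦ le_of_lt
  set KA := |A' t| + 1
  set Kb := |b' t| + 1
  set Kc := |c' t| + 1
  have hs : {u | (HasDerivAt A (A' u) u ∧ HasDerivAt b (b' u) u ∧ HasDerivAt c (c' u) u) ∧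
      |A' u| ≤ KA ∧ |b' u| ≤ Kb ∧ |c' u| ≤ Kc} ∈ 𝓝 t :=
    (hA.and (hb.and hc)).and ((hbd hA').and ((hbd hb').and (hbd hc')))
  have key := hasDerivAt_integral_of_dominated_loc_of_deriv_le (μ := gaussianReal 0 1)
    (F := fun u z ↦ log (tiltedMoment s w 0 (A u) (b u + c u * z)))
    (F' := fun u z ↦ (b' u + c' u * z) * gibbsMoment s w 1 (A u) (b u + c u * z)
      - A' u / 2 * gibbsMoment s w 2 (A u) (b u + c u * z))
    (bound := fun z ↦ (Kb + Kc * |z|) * R ^ 1 + KA / 2 * R ^ 2) hs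
    (.of_forall fun u ↦
      (continuous_log_tiltedMoment hw hw1 (by fun_prop) (by fun_prop)).aestronglyMeasurable)
    (integrable_log_tiltedMoment hw hw1 hR _ _ _)
    (Continuous.aestronglyMeasurable (((by fun_prop : Continuous fun z ↦ b' t + c' t * z).mul
      (continuous_gibbsMoment hw hw1 1 (by fun_prop) (by fun_prop))).sub
      (continuous_const.mul (continuous_gibbsMoment hw hw1 2 (by fun_prop) (by fun_prop)))))
    (.of_forall fun z u hu ↦ ?_)
    ((((integrable_const Kb).add (integrable_id_standardGaussian.abs.const_mul Kc)).mul_const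
      _).add (integrable_const _))
    (.of_forall fun z u hu ↦
      hasDerivAt_log_tiltedMoment hw hw1 hu.1.1 (hu.1.2.1.add (hu.1.2.2.mul_const z)))
  · convert! key.2 using 1
    have h1 := integrable_gibbsMoment hw hw1 hR 1 (A t) (b t) (c t)
    have h2 := integrable_gibbsMoment hw hw1 hR 2 (A t) (b t) (c t)
    have h3 := integrable_mul_gibbsMoment hw hw1 hR 1 (A t) (b t) (c t)
    simp only [add_mul, mul_assoc (c' t)]
    have h13 : Integrable (fun z ↦ b' t * gibbsMoment s w 1 (A t) (b t + c t * z)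
        + c' t * (z * gibbsMoment s w 1 (A t) (b t + c t * z))) (gaussianReal 0 1) :=
      (h1.const_mul _).add (h3.const_mul _)
    rw [integral_sub h13 (h2.const_mul _),
      integral_add (h1.const_mul _) (h3.const_mul _), integral_const_mul, integral_const_mul,
      integral_const_mul]
  · obtain ⟨-, hAu, hbu, hcu⟩ := hu
    have hB : |b' u + c' u * z| ≤ Kb + Kc * |z| := by
      refine (abs_add_le _ _).trans ?_
      rw [abs_mul]
      gcongr
    refine (abs_sub _ _).trans ?_
    rw [abs_mul, abs_mul, abs_div, abs_two]
    gcongr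
    · exact abs_gibbsMoment_le hw hw1 hR 1 _ _
    · exact abs_gibbsMoment_le hw hw1 hR 2 _ _

end Gibbs

lemma integral_eq_sum_of_finite_support {p : Measure ℝ} [IsFiniteMeasure p] {s : Finset ℝ}
    (hs : p (↑s : Set ℝ)ᶜ = 0) (f : ℝ → ℝ) : ∫ x, f x ∂p = ∑ x ∈ s, p.real {x} * f x := by
  have hp : p.restrict s = p := Measure.restrict_eq_self_of_ae_mem hs
  conv_lhs => rw [← hp]
  simpa using setIntegral_finset s (IntegrableOn.finset (f := f) (μ := p))

lemma integral_Jf_eq_sum {p : Measure ℝ} [IsProbabilityMeasure p] {s : Finset ℝ}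
    (hs : p (↑s : Set ℝ)ᶜ = 0) (hw1 : ∑ x ∈ s, p.real {x} = 1) (A b c d : ℝ) :
    ∫ y : ℝ × ℝ, Jf p A (b * y.1 / d + c * y.2) ∂(p.prod (gaussianReal 0 1))
      = ∑ x ∈ s, p.real {x} * ∫ z, log (tiltedMoment s (fun x ↦ p.real {x}) 0 A
          (b * x / d + c * z)) ∂gaussianReal 0 1 := by
  obtain ⟨R, hR⟩ : ∃ R, ∀ x ∈ s, |x| ≤ R :=
    (s.finite_toSet.isCompact.exists_bound_of_continuousOn continuousOn_id)
  have hw : ∀ x ∈ s, 0 ≤ p.real {x} := fun _ _ ↦ measureReal_nonneg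
  have hJ : Jf p A = fun B ↦ log (tiltedMoment s (fun x ↦ p.real {x}) 0 A B) := by
    ext B
    simp only [Jf, integral_eq_sum_of_finite_support hs, tiltedMoment, pow_zero, mul_one]
  have hcont : Continuous (Jf p A) := by
    rw [hJ]
    exact continuous_log_tiltedMoment hw hw1 continuous_const continuous_id
  have hfin : ∀ g : ℝ → ℝ, Integrable g p := fun g ↦ by
    have hp : p.restrict s = p := Measure.restrict_eq_self_of_ae_mem hs
    have hg : IntegrableOn g s p := IntegrableOn.finset
    rwa [IntegrableOn, hp] at hg
  have h_int : Integrable (fun y : ℝ × ℝ ↦ Jf p A (b * y.1 / d + c * y.2))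
      (p.prod (gaussianReal 0 1)) := by
    rw [integrable_prod_iff (by fun_prop : Continuous fun y : ℝ × ℝ ↦
      Jf p A (b * y.1 / d + c * y.2)).aestronglyMeasurable]
    refine ⟨.of_forall fun x ↦ ?_, hfin _⟩
    simpa only [hJ] using integrable_log_tiltedMoment hw hw1 hR A (b * x / d) c
  rw [integral_prod _ h_int, integral_eq_sum_of_finite_support hs, hJ]

/-- **Stationarity transfer** : if `m̂ > 0` is a stationary point of `i_B`, then it is a
stationary point of `i_L`. -/
theorem stationary_point_transfer
    (p : Measure ℝ) [IsProbabilityMeasure p]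
    (hsupp : ∃ s : Finset ℝ, p (↑s : Set ℝ)ᶜ = 0)
    (Δ : ℝ) (hΔ : 0 < Δ) (mhat : ℝ) (hmhat : 0 < mhat)
    (hstat : deriv (iB p Δ) mhat = 0) :
    deriv (iL p Δ mhat) mhat = 0 := by
  obtain ⟨s, hs⟩ := hsupp
  set w : ℝ → ℝ := fun x ↦ p.real {x} with hw_def
  have hw : ∀ x ∈ s, 0 ≤ w x := fun _ _ ↦ measureReal_nonneg
  have hw1 : ∑ x ∈ s, w x = 1 := by
    have h := integral_eq_sum_of_finite_support hs fun _ ↦ 1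
    simp only [integral_const, probReal_univ, smul_eq_mul, mul_one] at h
    exact h.symm
  set c := √(mhat / Δ) with hc_def
  have hc : 0 < c := by positivity
  have hc2 : c ^ 2 = mhat / Δ := sq_sqrt (by positivity)
  set q := ∑ x ∈ s, w x *
    (x * ∫ z, gibbsMoment s w 1 (c ^ 2) (c ^ 2 * x + c * z) ∂gaussianReal 0 1) with hq
  have hfield : ∀ x, mhat * x / Δ = c ^ 2 * x := fun x ↦ by rw [hc2]; ring
  have hb : ∀ x, ∀ᶠ u in 𝓝 mhat, HasDerivAt (fun u ↦ u * x / Δ) (x / Δ) u := fun x ↦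
    .of_forall fun u ↦ by simpa using ((hasDerivAt_id u).mul_const x).div_const Δ
  have hL : HasDerivAt (iL p Δ mhat) (mhat / Δ - q / Δ) mhat := by
    unfold iL
    simp only [integral_Jf_eq_sum hs hw1]
    refine HasDerivAt.sub ?_ ?_
    · convert! (((((hasDerivAt_id mhat).pow 2).const_mul 2).sub_const (mhat ^ 2)).add_const
        ((∫ x, x ^ 2 ∂p) ^ 2)).div_const (4 * Δ) using 1
      simp
      field_simp
      ring
    · have h := HasDerivAt.fun_sum fun x (_ : x ∈ s) ↦
        (hasDerivAt_integral_log_tiltedMoment hw hw1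
          (.of_forall fun u ↦ hasDerivAt_const u (mhat / Δ)) (hb x)
          (.of_forall fun u ↦ hasDerivAt_const u c)
          continuousAt_const continuousAt_const continuousAt_const).const_mul (w x)
      convert! h using 1
      rw [hq, Finset.sum_div]
      refine Finset.sum_congr rfl fun x _ ↦ ?_
      rw [hfield, ← hc2]
      ring
  have hB : HasDerivAt (iB p Δ) (mhat / (2 * Δ) - q / (2 * Δ)) mhat := by
    unfold iB
    simp only [integral_Jf_eq_sum hs hw1]
    refine HasDerivAt.sub ?_ ?_
    · convert! (((hasDerivAt_id mhat).pow 2).add_const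
        ((∫ x, x ^ 2 ∂p) ^ 2)).div_const (4 * Δ) using 1
      simp
      field_simp
      ring
    · have hA : ∀ u, HasDerivAt (fun u ↦ u / Δ) (1 / Δ) u := fun u ↦
        (hasDerivAt_id u).div_const Δ
      have h := HasDerivAt.fun_sum fun x (_ : x ∈ s) ↦
        (hasDerivAt_integral_log_tiltedMoment hw hw1 (.of_forall hA) (hb x)
          ((lt_mem_nhds hmhat).mono fun u hu ↦ (hA u).sqrt (div_pos hu hΔ).ne')
          continuousAt_const continuousAt_const
          (ContinuousAt.div continuousAt_const (by fun_prop) (by positivity))).const_mul (w x)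
      convert! h using 1
      have hN := nishimori hw hw1 c
      rw [← hq] at hN
      have hsplit : q / (2 * Δ) = ∑ x ∈ s, (w x *
          (x * ∫ z, gibbsMoment s w 1 (c ^ 2) (c ^ 2 * x + c * z) ∂gaussianReal 0 1) / Δ
          - w x * (∫ z, gibbsMoment s w 1 (c ^ 2) (c ^ 2 * x + c * z) ^ 2 ∂gaussianReal 0 1)
            / (2 * Δ)) := by
        rw [Finset.sum_sub_distrib, ← Finset.sum_div, ← Finset.sum_div, hN, ← hq]
        field_simp
        ring
      rw [hsplit]
      refine Finset.sum_congr rfl fun x _ ↦ ?_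
      rw [hfield, ← hc_def, ← hc2, integral_mul_gibbsMoment_one hw hw1]
      field_simp
      ring
  rw [hB.deriv] at hstat
  rw [hL.deriv]
  have : mhat / Δ - q / Δ = 2 * (mhat / (2 * Δ) - q / (2 * Δ)) := by field_simp
  rw [this, hstat, mul_zero]
end
end
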